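/- arXiv:1307.0092 — 3 statements merged into one kernel-verified Lean document; each statement's English description precedes it below -/
import Mathlib

section
/- For every n ≥ 1, the image Φ(BWTS(n)) of the recursively labelled red and white trees under Φ equals FF₄(n), where FF₄ is the smallest family of subsets FF₄(n) ⊆ FF(n) containing 1/[1] ∈ FF(1) and the four fractions F_≻ = 1/([1][12]), F_≺ = 1/([2][12]), F_∘ = 1/[12], F_⊙ = 1/([1][2]) in FF(2), and closed under all compositions ∘_i. In particular |FF₄(n)| = |BWTS(n)| for all n. -/
open scoped Classical

/-- A *formal fraction*: a finitely supported exponent function on formal symbols `[S]`,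
where `S` is a finset of positive integers.  The fraction `∏_S [S]^(e_S)` is encoded by
the function `S ↦ e_S`; multiplication of fractions is addition of exponent functions. -/
abbrev FFrac : Type := Finset ℕ →₀ ℤ

/-- `F` is a formal fraction of arity `n`: all its symbols are nonempty subsets of `{1,…,n}`. -/
def MemFF (n : ℕ) (F : FFrac) : Prop :=
  ∀ S ∈ F.support, S.Nonempty ∧ S ⊆ Finset.Icc 1 n

/-- Symbol relabelling for the left factor of `∘ᵢ` with an arity-`n` fraction:
indices `j < i` are fixed, `i` is replaced by the whole block `{i,…,i+n-1}`, and
`j > i` is replaced by `j + n - 1`. -/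
def subSym (i n : ℕ) (T : Finset ℕ) : Finset ℕ :=
  T.biUnion fun j =>
    if j < i then {j} else if j = i then Finset.Icc i (i + n - 1) else {j + n - 1}

/-- Symbol relabelling for the right factor of `∘ᵢ`: `j ↦ i + j - 1`. -/
def shiftSym (i : ℕ) (T : Finset ℕ) : Finset ℕ := T.image fun j => i + j - 1

/-- Composition of formal fractions: `F ∘ᵢ G = [S_{i,n}] ⬝ F̂ ⬝ Ĝ`, where `n` is the arity
of `G`.  (`Finsupp.mapDomain` adds the exponents of symbols which become equal.) -/
noncomputable def ffCompose (n i : ℕ) (F G : FFrac) : FFrac :=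
  Finsupp.single (Finset.Icc i (i + n - 1)) 1
    + Finsupp.mapDomain (subSym i n) F
    + Finsupp.mapDomain (shiftSym i) G

/-- The formal fraction `1/[1] ∈ FF(1)`. -/
noncomputable def ffUnit : FFrac := Finsupp.single {1} (-1)

/-- `F_≻ = 1/([1][12])`. -/
noncomputable def Fsucc : FFrac := Finsupp.single {1} (-1) + Finsupp.single {1, 2} (-1)
/-- `F_≺ = 1/([2][12])`. -/
noncomputable def Fprec : FFrac := Finsupp.single {2} (-1) + Finsupp.single {1, 2} (-1)
/-- `F_∘ = 1/[12]`. -/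
noncomputable def Fmid : FFrac := Finsupp.single {1, 2} (-1)
/-- `F_⊙ = 1/([1][2])`. -/
noncomputable def Fdot : FFrac := Finsupp.single {1} (-1) + Finsupp.single {2} (-1)

/- A labelled red and white tree on `{1,…,n}` is encoded by the (laminar) family of the
sets `S(z)` of all labels carried by the subtree rooted at each node `z`; this determines
the tree completely (children of a node are the maximal proper members of the family
below it, its own labels are those not appearing in its children, and the condition that
an unlabelled node has at least two children is automatic). -/

/-- The children of the node `S` in the family `fam`: maximal members strictly below `S`. -/
def childrenF (fam : Finset (Finset ℕ)) (S : Finset ℕ) : Finset (Finset ℕ) :=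
  fam.filter fun T => T ⊂ S ∧ ∀ U ∈ fam, T ⊂ U → ¬ U ⊂ S

/-- The set of labels carried by the node `S` itself. -/
def labelsOf (fam : Finset (Finset ℕ)) (S : Finset ℕ) : Finset ℕ :=
  S \ (childrenF fam S).biUnion id

/-- `fam` encodes a labelled red and white tree on `{1,…,n}` (`fam ∈ BWTSL(n)`). -/
def IsRWTree (n : ℕ) (fam : Finset (Finset ℕ)) : Prop :=
  (∀ S ∈ fam, S.Nonempty ∧ S ⊆ Finset.Icc 1 n) ∧
  Finset.Icc 1 n ∈ fam ∧
  ∀ S ∈ fam, ∀ T ∈ fam, S ⊆ T ∨ T ⊆ S ∨ Disjoint S T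

/-- The tree is recursively labelled: the total label set of every subtree is an
interval of consecutive integers. -/
def IsRecursive (fam : Finset (Finset ℕ)) : Prop :=
  ∀ S ∈ fam, ∃ a b : ℕ, S = Finset.Icc a b

/-- The node `S` is red: it carries no label and all of its children are white. -/
def IsRed (fam : Finset (Finset ℕ)) (S : Finset ℕ) : Prop :=
  labelsOf fam S = ∅ ∧ ∀ T ∈ childrenF fam S, ¬ IsRed fam T
termination_by S.card
decreasing_by
  rename_i hT
  exact Finset.card_lt_card (Finset.mem_filter.mp hT).2.1

/-- Relabelling of the first tree in `T₁ ∘ₓ T₂` (`n` the arity of `T₂`): labels `j > x`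
are shifted by `n - 1` and the label `x` becomes the whole block `{x,…,x+n-1}`. -/
def relabL (x n : ℕ) (T : Finset ℕ) : Finset ℕ :=
  T.biUnion fun j =>
    if j < x then {j} else if j = x then Finset.Icc x (x + n - 1) else {j + n - 1}

/-- Relabelling of the second tree in `T₁ ∘ₓ T₂`: labels are shifted by `x - 1`. -/
def relabR (x : ℕ) (T : Finset ℕ) : Finset ℕ := T.image fun j => x + j - 1

/-- The composition `T₁ ∘ₓ T₂` of labelled red and white trees (in the laminar-family
encoding), `n` being the arity of `T₂`.  The four cases correspond to the rules
(R1), (R3), (R2) and (W) respectively:  if the root of `T₂` is red then the result is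
`T₂` when `T₁` is the single node labelled `x` (R1); the node `z` of `T₁` containing `x`
is deleted and the children of the root of `T₂` are attached to its parent when `z` is a
leaf whose only label is `x` (R3); otherwise the root of `T₂` becomes a new child of `z`
(R2).  If the root of `T₂` is not red, it is merged with `z` (W). -/
noncomputable def rwCompose (n x : ℕ) (fam₁ fam₂ : Finset (Finset ℕ)) :
    Finset (Finset ℕ) :=
  let B : Finset ℕ := Finset.Icc x (x + n - 1)
  let f₁ := fam₁.image (relabL x n)
  let f₂ := fam₂.image (relabR x)
  if IsRed fam₂ (Finset.Icc 1 n) then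
    if fam₁ = {{x}} then f₂
    else if {x} ∈ fam₁ then (f₁ \ {B}) ∪ (f₂ \ {B})
    else f₁ ∪ f₂
  else f₁ ∪ (f₂ \ {B})

/-- The unit: the single node labelled `{1}`. -/
def unitT : Finset (Finset ℕ) := {{1}}
/-- `T_≺`: white root labelled `{1}` with a single white child labelled `{2}`. -/
def Tprec : Finset (Finset ℕ) := {{1, 2}, {2}}
/-- `T_≻`: white root labelled `{2}` with a single white child labelled `{1}`. -/
def Tsucc : Finset (Finset ℕ) := {{1, 2}, {1}}
/-- `T_∘`: a single white node labelled `{1,2}`. -/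
def Tmid : Finset (Finset ℕ) := {{1, 2}}
/-- `T_⊙`: red empty root with two white children labelled `{1}` and `{2}`. -/
def Tdot : Finset (Finset ℕ) := {{1, 2}, {1}, {2}}

/-- The map `Φ` from labelled red and white trees to formal fractions: each white node
`z` contributes `[S(z)]⁻¹`, each non-root red node contributes `[S(z)]`, and a red root
contributes `1`. -/
noncomputable def PhiT (n : ℕ) (fam : Finset (Finset ℕ)) : FFrac :=
  ∑ S ∈ fam, Finsupp.single S
    (if IsRed fam S then (if S = Finset.Icc 1 n then 0 else 1) else (-1 : ℤ))

/-- The closure of a family of generating fractions under the compositions `∘ᵢ`: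
the smallest family containing the generators and closed under all compositions. -/
inductive FFClosure (G : ℕ → FFrac → Prop) : ℕ → FFrac → Prop
  | gen {n : ℕ} {F : FFrac} : G n F → FFClosure G n F
  | comp {m n i : ℕ} {F F' : FFrac} :
      FFClosure G m F → FFClosure G n F' → 1 ≤ i → i ≤ m →
      FFClosure G (m + n - 1) (ffCompose n i F F')

/-- The unit `1/[1]` together with the four generating fractions. -/
def GenFF4 (n : ℕ) (F : FFrac) : Prop :=
  (n = 1 ∧ F = ffUnit) ∨ (n = 2 ∧ (F = Fsucc ∨ F = Fprec ∨ F = Fmid ∨ F = Fdot))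


def IsTree (R : Finset ℕ) (fam : Finset (Finset ℕ)) : Prop :=
  (∀ S ∈ fam, S.Nonempty ∧ S ⊆ R) ∧ R ∈ fam ∧
  ∀ S ∈ fam, ∀ T ∈ fam, S ⊆ T ∨ T ⊆ S ∨ Disjoint S T

noncomputable def PhiR (R : Finset ℕ) (fam : Finset (Finset ℕ)) : FFrac :=
  ∑ S ∈ fam, Finsupp.single S
    (if IsRed fam S then (if S = R then 0 else 1) else (-1 : ℤ))

theorem PhiR_apply (R : Finset ℕ) (fam : Finset (Finset ℕ)) (S : Finset ℕ) :
    PhiR R fam S = if S ∈ fam then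
      (if IsRed fam S then (if S = R then 0 else 1) else (-1 : ℤ)) else 0 := by
  unfold PhiR
  rw [Finsupp.finsetSum_apply]
  simp only [Finsupp.single_apply]
  rw [Finset.sum_ite_eq']

def Good (fam : Finset (Finset ℕ)) (S : Finset ℕ) (j : ℕ) : Prop :=
  ∃ T ∈ fam, j ∈ T ∧ T ⊂ S ∧ (∀ U ∈ fam, T ⊂ U → ¬ U ⊂ S) ∧ ¬ IsRed fam T

theorem isRed_iff {R : Finset ℕ} {fam : Finset (Finset ℕ)} (h : IsTree R fam) (S : Finset ℕ) :
    IsRed fam S ↔ ∀ j ∈ S, Good fam S j := by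
  rw [IsRed]
  constructor
  · rintro ⟨h1, h2⟩ j hj
    have : j ∈ (childrenF fam S).biUnion id := by
      by_contra hc
      have : j ∈ labelsOf fam S := Finset.mem_sdiff.2 ⟨hj, hc⟩
      simp [h1] at this
    obtain ⟨T, hT, hjT⟩ := Finset.mem_biUnion.1 this
    have h3 := Finset.mem_filter.1 hT
    exact ⟨T, h3.1, hjT, h3.2.1, h3.2.2, h2 T hT⟩
  · intro hg
    constructor
    · apply Finset.sdiff_eq_empty_iff_subset.2
      intro j hj
      obtain ⟨T, hT, hjT, h1, h2, h3⟩ := hg j hj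
      exact Finset.mem_biUnion.2 ⟨T, Finset.mem_filter.2 ⟨hT, h1, h2⟩, hjT⟩
    · intro T hT
      obtain ⟨hT, h1, h2⟩ := Finset.mem_filter.1 hT
      obtain ⟨j, hj⟩ := (h.1 T hT).1
      obtain ⟨T', hT', hjT', h1', h2', h3'⟩ := hg j (h1.1 hj)
      have : T = T' := by
        rcases h.2.2 T hT T' hT' with h4 | h4 | h4
        · by_contra hne
          exact h2 T' hT' (lt_of_le_of_ne h4 hne) h1'
        · by_contra hne
          exact h2' T hT (lt_of_le_of_ne h4 (Ne.symm hne)) h1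
        · exact absurd hjT' (Finset.disjoint_left.1 h4 hj)
      rw [this]; exact h3'

theorem isRed_congr {fam fam' : Finset (Finset ℕ)} (S : Finset ℕ)
    (h : ∀ T, T ⊂ S → (T ∈ fam ↔ T ∈ fam')) : IsRed fam S ↔ IsRed fam' S := by
  induction S using Finset.strongInduction with
  | H S ih =>
    have hc : childrenF fam S = childrenF fam' S := by
      ext T
      simp only [childrenF, Finset.mem_filter]
      constructor
      · rintro ⟨a, b, c⟩
        exact ⟨(h T b).1 a, b, fun U hU hTU hUS => c U ((h U hUS).2 hU) hTU hUS⟩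
      · rintro ⟨a, b, c⟩
        exact ⟨(h T b).2 a, b, fun U hU hTU hUS => c U ((h U hUS).1 hU) hTU hUS⟩
    rw [IsRed, IsRed, labelsOf, labelsOf, hc]
    refine and_congr Iff.rfl (forall₂_congr fun T hT => not_congr ?_)
    have hT' := (Finset.mem_filter.1 hT).2.1
    exact ih T hT' fun V hV => h V (hV.trans hT')

/-- The union of the two trees with the block toggled. -/
noncomputable def glue (B : Finset ℕ) (U D : Finset (Finset ℕ)) : Finset (Finset ℕ) :=
  (U ∪ D).filter fun S => S ≠ B ∨ (B ∈ U ↔ ¬ IsRed D B)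

section host
variable {R B : Finset ℕ} {U D : Finset (Finset ℕ)}

theorem mem_glue_B (hD : IsTree B D) : B ∈ glue B U D ↔ (B ∈ U ↔ ¬ IsRed D B) := by
  simp [glue, hD.2.1]

theorem mem_glue_U (hD : IsTree B D) {S : Finset ℕ} (hS : ¬ S ⊆ B) :
    S ∈ glue B U D ↔ S ∈ U := by
  have h1 : S ∉ D := fun h => hS (hD.1 S h).2
  have h2 : S ≠ B := by rintro rfl; exact hS subset_rfl
  simp [glue, h1, h2]

theorem mem_glue_D (hU : IsTree R U) (hs : ∀ S ∈ U, B ⊆ S ∨ Disjoint S B)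
    {S : Finset ℕ} (hS : S ⊂ B) : S ∈ glue B U D ↔ S ∈ D := by
  have h1 : S ∉ U := by
    intro h
    rcases hs S h with h' | h'
    · exact hS.2 h'
    · obtain ⟨j, hj⟩ := (hU.1 S h).1
      exact Finset.disjoint_left.1 h' hj (hS.1 hj)
  simp [glue, h1, hS.ne]

theorem glue_tree (hU : IsTree R U) (hD : IsTree B D) (hBR : B ⊂ R)
    (hs : ∀ S ∈ U, B ⊆ S ∨ Disjoint S B) : IsTree R (glue B U D) := by
  refine ⟨?_, (mem_glue_U hD hBR.2).2 hU.2.1, ?_⟩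
  · intro S hS
    rcases Finset.mem_union.1 (Finset.mem_filter.1 hS).1 with h | h
    · exact hU.1 S h
    · exact ⟨(hD.1 S h).1, (hD.1 S h).2.trans hBR.1⟩
  · intro S hS T hT
    rcases Finset.mem_union.1 (Finset.mem_filter.1 hS).1 with h | h <;>
    rcases Finset.mem_union.1 (Finset.mem_filter.1 hT).1 with h' | h'
    · exact hU.2.2 S h T h'
    · rcases hs S h with h1 | h1
      · exact Or.inr (Or.inl ((hD.1 T h').2.trans h1))
      · exact Or.inr (Or.inr (h1.mono_right (hD.1 T h').2))
    · rcases hs T h' with h1 | h1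
      · exact Or.inl ((hD.1 S h).2.trans h1)
      · exact Or.inr (Or.inr ((h1.mono_right (hD.1 S h).2).symm))
    · exact hD.2.2 S h T h'

theorem red_D (hU : IsTree R U) (hs : ∀ S ∈ U, B ⊆ S ∨ Disjoint S B)
    {S : Finset ℕ} (hS : S ⊆ B) : IsRed (glue B U D) S ↔ IsRed D S :=
  isRed_congr S fun _ hT => mem_glue_D hU hs (lt_of_lt_of_le hT hS)

theorem not_red_U_B (hU : IsTree R U) (hB : B.Nonempty)
    (hs : ∀ S ∈ U, B ⊆ S ∨ Disjoint S B) : ¬ IsRed U B := by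
  rw [isRed_iff hU]
  intro h
  obtain ⟨j, hj⟩ := hB
  obtain ⟨T, hT, hjT, hTB, -⟩ := h j hj
  rcases hs T hT with h' | h'
  · exact hTB.2 h'
  · exact Finset.disjoint_left.1 h' hjT hj

theorem red_U (hU : IsTree R U) (hD : IsTree B D) (hBR : B ⊂ R)
    (hs : ∀ S ∈ U, B ⊆ S ∨ Disjoint S B) (S : Finset ℕ) (hSU : S ∈ U) (hSB : ¬ S ⊆ B) :
    IsRed (glue B U D) S ↔ IsRed U S := by
  induction S using Finset.strongInduction with
  | H S ih =>
  have hW := glue_tree hU hD hBR hs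
  rw [isRed_iff hW, isRed_iff hU]
  have hcov : ∀ T ∈ U, ∀ j ∈ T, j ∈ B → B ⊆ T := by
    intro T hT j hj hjB
    rcases hs T hT with h | h
    · exact h
    · exact absurd hjB (Finset.disjoint_left.1 h hj)
  have hnB : ∀ T : Finset ℕ, ∀ j ∈ T, j ∉ B → ¬ T ⊆ B := fun T j hj hjB h => hjB (h hj)
  -- points outside of the block
  have hout : ∀ j, j ∉ B → (Good (glue B U D) S j ↔ Good U S j) := by
    intro j hjB
    constructor
    · rintro ⟨T, hT, hjT, hTS, hmax, hr⟩
      have hTB := hnB T j hjT hjB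
      have hTU := (mem_glue_U hD hTB).1 hT
      exact ⟨T, hTU, hjT, hTS, fun V hV hTV => hmax V
        ((mem_glue_U hD (hnB V j (hTV.1 hjT) hjB)).2 hV) hTV, fun h => hr ((ih T hTS hTU hTB).2 h)⟩
    · rintro ⟨T, hTU, hjT, hTS, hmax, hr⟩
      have hTB := hnB T j hjT hjB
      exact ⟨T, (mem_glue_U hD hTB).2 hTU, hjT, hTS, fun V hV hTV => hmax V
        ((mem_glue_U hD (hnB V j (hTV.1 hjT) hjB)).1 hV) hTV, fun h => hr ((ih T hTS hTU hTB).1 h)⟩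
  rcases hs S hSU with hBS | hdis
  swap
  · exact forall₂_congr fun j hj => hout j (Finset.disjoint_left.1 hdis hj)
  have hBS' : B ⊂ S := ⟨hBS, hSB⟩
  have hin : (∀ j ∈ B, Good (glue B U D) S j) ↔ (∀ j ∈ B, Good U S j) := by
    by_cases hex : ∃ T ∈ U, B ⊂ T ∧ T ⊂ S
    · obtain ⟨T₁, hT₁, hBT₁, hT₁S⟩ := hex
      refine forall₂_congr fun j hj => ?_
      constructor
      · rintro ⟨T, hT, hjT, hTS, hmax, hr⟩
        have hTB : ¬ T ⊆ B := fun h =>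
          hmax T₁ ((mem_glue_U hD hBT₁.2).2 hT₁) (lt_of_le_of_lt h hBT₁) hT₁S
        have hTU := (mem_glue_U hD hTB).1 hT
        exact ⟨T, hTU, hjT, hTS, fun V hV hTV => hmax V
          ((mem_glue_U hD (fun h => hTB (hTV.1.trans h))).2 hV) hTV,
          fun h => hr ((ih T hTS hTU hTB).2 h)⟩
      · rintro ⟨T, hTU, hjT, hTS, hmax, hr⟩
        have hTB : ¬ T ⊆ B := fun h => hmax T₁ hT₁ (lt_of_le_of_lt h hBT₁) hT₁S
        exact ⟨T, (mem_glue_U hD hTB).2 hTU, hjT, hTS, fun V hV hTV => hmax V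
          ((mem_glue_U hD (fun h => hTB (hTV.1.trans h))).1 hV) hTV,
          fun h => hr ((ih T hTS hTU hTB).1 h)⟩
    · push Not at hex
      obtain ⟨j₀, hj₀⟩ := (hD.1 B hD.2.1).1
      have e1 : (∀ j ∈ B, Good U S j) ↔ B ∈ U := by
        constructor
        · intro h
          obtain ⟨T, hT, hjT, hTS, -⟩ := h j₀ hj₀
          have hBT := hcov T hT j₀ hjT hj₀
          have : B = T := by
            by_contra hne
            exact hex T hT (lt_of_le_of_ne hBT hne) hTS
          rwa [this]
        · intro h j hj
          exact ⟨B, h, hj, hBS', hex, not_red_U_B hU ⟨j₀, hj₀⟩ hs⟩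
      have hmem : ∀ T ∈ glue B U D, ∀ j ∈ T, j ∈ B → T ⊂ S → T ⊆ B := by
        intro T hT j hjT hjB hTS
        by_contra hTB
        have hTU := (mem_glue_U hD hTB).1 hT
        exact hex T hTU ⟨hcov T hTU j hjT hjB, hTB⟩ hTS
      rw [e1]
      by_cases hBW : B ∈ glue B U D
      · have e2 : (∀ j ∈ B, Good (glue B U D) S j) ↔ ¬ IsRed D B := by
          rw [← red_D hU hs (subset_refl B)]
          constructor
          · intro h
            obtain ⟨T, hT, hjT, hTS, hmax, hr⟩ := h j₀ hj₀
            have hTB := hmem T hT j₀ hjT hj₀ hTS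
            have : T = B := by
              by_contra hne
              exact hmax B hBW (lt_of_le_of_ne hTB hne) hBS'
            rw [this] at hr
            exact hr
          · intro h j hj
            refine ⟨B, hBW, hj, hBS', fun V hV hBV hVS => ?_, h⟩
            exact hBV.2 (hmem V hV j (hBV.1 hj) hj hVS)
        rw [e2, (mem_glue_B hD).1 hBW]
      · have e2 : (∀ j ∈ B, Good (glue B U D) S j) ↔ IsRed D B := by
          rw [isRed_iff hD]
          refine forall₂_congr fun j hj => ?_
          constructor
          · rintro ⟨T, hT, hjT, hTS, hmax, hr⟩
            have hTB := hmem T hT j hjT hj hTS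
            have hTB' : T ⊂ B := lt_of_le_of_ne hTB (by rintro rfl; exact hBW hT)
            exact ⟨T, (mem_glue_D hU hs hTB').1 hT, hjT, hTB', fun V hV hTV hVB =>
              hmax V ((mem_glue_D hU hs hVB).2 hV) hTV (hVB.trans hBS'),
              fun h => hr ((red_D hU hs hTB).2 h)⟩
          · rintro ⟨T, hT, hjT, hTB, hmax, hr⟩
            refine ⟨T, (mem_glue_D hU hs hTB).2 hT, hjT, hTB.trans hBS', fun V hV hTV hVS => ?_,
              fun h => hr ((red_D hU hs hTB.1).1 h)⟩
            have hVB := hmem V hV j (hTV.1 hjT) hj hVS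
            have hVB' : V ⊂ B := lt_of_le_of_ne hVB (by rintro rfl; exact hBW hV)
            exact hmax V ((mem_glue_D hU hs hVB').1 hV) hTV hVB'
        have := (mem_glue_B hD).not.1 hBW
        rw [e2]; tauto
  constructor
  · intro h j hj
    by_cases hjB : j ∈ B
    · exact hin.1 (fun j hj => h j (hBS hj)) j hjB
    · exact (hout j hjB).1 (h j hj)
  · intro h j hj
    by_cases hjB : j ∈ B
    · exact hin.2 (fun j hj => h j (hBS hj)) j hjB
    · exact (hout j hjB).2 (h j hj)

theorem phi_glue (hU : IsTree R U) (hD : IsTree B D) (hBR : B ⊂ R)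
    (hs : ∀ S ∈ U, B ⊆ S ∨ Disjoint S B) :
    PhiR R (glue B U D) = Finsupp.single B 1 + PhiR R U + PhiR B D := by
  ext S
  simp only [Finsupp.add_apply, PhiR_apply, Finsupp.single_apply]
  by_cases hSB : S ⊆ B
  · by_cases hE : S = B
    · subst hE
      have h1 := not_red_U_B hU (hD.1 S hD.2.1).1 hs
      have h2 := red_D (D := D) hU hs (subset_refl S)
      have h3 := hBR.ne
      have h4 := hD.2.1
      simp only [mem_glue_B hD]
      by_cases a : IsRed D S <;> by_cases b : S ∈ U <;> simp [*]
    · have hlt : S ⊂ B := lt_of_le_of_ne hSB hE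
      have h1 : S ≠ R := by rintro rfl; exact hBR.2 hSB
      have h2 : S ∉ U := by
        intro h
        rcases hs S h with h' | h'
        · exact hlt.2 h'
        · obtain ⟨j, hj⟩ := (hU.1 S h).1
          exact Finset.disjoint_left.1 h' hj (hSB hj)
      simp only [mem_glue_D hU hs hlt, red_D hU hs hSB]
      simp [h1, h2, hE, Ne.symm hE]
  · have h1 : S ∉ D := fun h => hSB (hD.1 S h).2
    have h2 : B ≠ S := by rintro rfl; exact hSB subset_rfl
    simp only [mem_glue_U hD hSB]
    by_cases h : S ∈ U
    · simp only [red_U hU hD hBR hs S h hSB]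
      simp [h1, h2]
    · simp [h, h1, h2]

end host


/-- A relabelling which replaces points by nonempty pairwise disjoint blocks. -/
structure Blk (g : ℕ → Finset ℕ) : Prop where
  ne : ∀ j, (g j).Nonempty
  dj : ∀ j k y, y ∈ g j → y ∈ g k → j = k

theorem Blk.sub {g : ℕ → Finset ℕ} (hg : Blk g) {S T : Finset ℕ} :
    S.biUnion g ⊆ T.biUnion g ↔ S ⊆ T := by
  constructor
  · intro h j hj
    obtain ⟨y, hy⟩ := hg.ne j
    obtain ⟨k, hk, hyk⟩ := Finset.mem_biUnion.1 (h (Finset.mem_biUnion.2 ⟨j, hj, hy⟩))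
    rwa [hg.dj j k y hy hyk]
  · exact fun h => Finset.biUnion_subset_biUnion_of_subset_left g h

theorem Blk.ssub {g : ℕ → Finset ℕ} (hg : Blk g) {S T : Finset ℕ} :
    S.biUnion g ⊂ T.biUnion g ↔ S ⊂ T := by
  rw [Finset.ssubset_def, Finset.ssubset_def, hg.sub, hg.sub]

theorem Blk.inj {g : ℕ → Finset ℕ} (hg : Blk g) :
    Function.Injective fun S : Finset ℕ => S.biUnion g := by
  intro S T h
  exact subset_antisymm (hg.sub.1 h.subset) (hg.sub.1 h.symm.subset)

theorem Blk.disj {g : ℕ → Finset ℕ} (hg : Blk g) {S T : Finset ℕ} :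
    Disjoint (S.biUnion g) (T.biUnion g) ↔ Disjoint S T := by
  rw [Finset.disjoint_left, Finset.disjoint_left]
  constructor
  · intro h j hj hj'
    obtain ⟨y, hy⟩ := hg.ne j
    exact h (Finset.mem_biUnion.2 ⟨j, hj, hy⟩) (Finset.mem_biUnion.2 ⟨j, hj', hy⟩)
  · intro h y hy hy'
    obtain ⟨j, hj, h1⟩ := Finset.mem_biUnion.1 hy
    obtain ⟨k, hk, h2⟩ := Finset.mem_biUnion.1 hy'
    exact h hj (by rwa [hg.dj j k y h1 h2])

theorem Blk.red {g : ℕ → Finset ℕ} (hg : Blk g) (fam : Finset (Finset ℕ)) (S : Finset ℕ) :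
    IsRed (fam.image fun S => S.biUnion g) (S.biUnion g) ↔ IsRed fam S := by
  induction S using Finset.strongInduction with
  | H S ih =>
    have hc : childrenF (fam.image fun S => S.biUnion g) (S.biUnion g)
        = (childrenF fam S).image fun S => S.biUnion g := by
      ext T
      simp only [childrenF, Finset.mem_filter, Finset.mem_image]
      constructor
      · rintro ⟨⟨T', h1, rfl⟩, h2, h3⟩
        exact ⟨T', ⟨h1, hg.ssub.1 h2, fun V hV h4 h5 =>
          h3 _ ⟨V, hV, rfl⟩ (hg.ssub.2 h4) (hg.ssub.2 h5)⟩, rfl⟩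
      · rintro ⟨T', ⟨h1, h2, h3⟩, rfl⟩
        refine ⟨⟨T', h1, rfl⟩, hg.ssub.2 h2, ?_⟩
        rintro _ ⟨V, hV, rfl⟩ h4 h5
        exact h3 V hV (hg.ssub.1 h4) (hg.ssub.1 h5)
    rw [IsRed, IsRed, labelsOf, labelsOf, hc]
    apply and_congr
    · rw [Finset.sdiff_eq_empty_iff_subset, Finset.sdiff_eq_empty_iff_subset]
      have e : ((childrenF fam S).image fun S => S.biUnion g).biUnion id
          = ((childrenF fam S).biUnion id).biUnion g := by
        rw [Finset.image_biUnion, Finset.biUnion_biUnion]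
        rfl
      rw [e, hg.sub]
    · rw [Finset.forall_mem_image]
      exact forall₂_congr fun T hT => not_congr (ih T (Finset.mem_filter.1 hT).2.1)

theorem Blk.phi {g : ℕ → Finset ℕ} (hg : Blk g) (R : Finset ℕ) (fam : Finset (Finset ℕ)) :
    Finsupp.mapDomain (fun S : Finset ℕ => S.biUnion g) (PhiR R fam)
      = PhiR (R.biUnion g) (fam.image fun S => S.biUnion g) := by
  unfold PhiR
  rw [Finsupp.mapDomain_finsetSum, Finset.sum_image (fun _ _ _ _ h => hg.inj h)]
  refine Finset.sum_congr rfl fun S _ => ?_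
  rw [Finsupp.mapDomain_single]
  simp only [hg.red]
  have : S.biUnion g = R.biUnion g ↔ S = R := ⟨fun h => hg.inj h, fun h => by rw [h]⟩
  simp only [this]

theorem Blk.tree {g : ℕ → Finset ℕ} (hg : Blk g) (R : Finset ℕ) (fam : Finset (Finset ℕ)) :
    IsTree (R.biUnion g) (fam.image fun S => S.biUnion g) ↔ IsTree R fam := by
  unfold IsTree
  simp only [Finset.forall_mem_image, hg.sub, hg.disj]
  refine and_congr (forall₂_congr fun S _ => and_congr ?_ Iff.rfl) (and_congr ?_ Iff.rfl)
  · rw [Finset.biUnion_nonempty]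
    exact ⟨fun ⟨j, h, _⟩ => ⟨j, h⟩, fun ⟨j, h⟩ => ⟨j, h, hg.ne j⟩⟩
  · rw [Finset.mem_image]
    exact ⟨fun ⟨S, h, h'⟩ => by rwa [← hg.inj h'], fun h => ⟨R, h, rfl⟩⟩

def gL (i n : ℕ) : ℕ → Finset ℕ := fun j =>
    if j < i then {j} else if j = i then Finset.Icc i (i + n - 1) else {j + n - 1}
def gR (i : ℕ) : ℕ → Finset ℕ := fun j => {i + j - 1}

theorem subSym_eq (i n : ℕ) : subSym i n = fun S => S.biUnion (gL i n) := rfl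
theorem shiftSym_eq (i : ℕ) : shiftSym i = fun S => S.biUnion (gR i) := by
  funext S
  exact (Finset.biUnion_singleton (s := S) (f := fun j => i + j - 1)).symm

def col (i n y : ℕ) : ℕ := if y < i then y else if y ≤ i + n - 1 then i else y + 1 - n

theorem mem_gL {i n : ℕ} (hi : 1 ≤ i) (hn : 1 ≤ n) (j y : ℕ) : y ∈ gL i n j ↔ col i n y = j := by
  unfold gL col
  split_ifs <;> simp <;> omega

theorem blkL {i n : ℕ} (hi : 1 ≤ i) (hn : 1 ≤ n) : Blk (gL i n) := by
  constructor
  · intro j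
    refine ⟨if j ≤ i then j else j + n - 1, ?_⟩
    rw [mem_gL hi hn]
    unfold col
    split_ifs <;> omega
  · intro j k y h1 h2
    rw [mem_gL hi hn] at h1 h2
    rw [← h1, ← h2]

theorem blkR {i : ℕ} (hi : 1 ≤ i) : Blk (gR i) := by
  constructor
  · intro j
    simp [gR]
  · intro j k y h1 h2
    simp [gR] at h1 h2
    omega

theorem mem_sub {i n : ℕ} (hi : 1 ≤ i) (hn : 1 ≤ n) (y : ℕ) (S : Finset ℕ) :
    y ∈ subSym i n S ↔ col i n y ∈ S := by
  rw [subSym_eq]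
  simp only [Finset.mem_biUnion, mem_gL hi hn]
  simp

theorem mem_shift {i : ℕ} (hi : 1 ≤ i) (y : ℕ) (S : Finset ℕ) :
    y ∈ shiftSym i S ↔ i ≤ y + 1 ∧ y + 1 - i ∈ S := by
  simp only [shiftSym, Finset.mem_image]
  constructor
  · rintro ⟨j, hj, rfl⟩
    refine ⟨by omega, ?_⟩
    have : i + j - 1 + 1 - i = j := by omega
    rwa [this]
  · rintro ⟨h1, h2⟩
    exact ⟨_, h2, by omega⟩

theorem sub_Icc {i n : ℕ} (hi : 1 ≤ i) (hn : 1 ≤ n) (a b : ℕ) (hab : a ≤ b) :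
    subSym i n (Finset.Icc a b) =
      Finset.Icc (if a ≤ i then a else a + n - 1) (if b < i then b else b + n - 1) := by
  ext y
  rw [mem_sub hi hn, Finset.mem_Icc, Finset.mem_Icc]
  unfold col
  split_ifs <;> omega

theorem shift_Icc {i : ℕ} (hi : 1 ≤ i) (a b : ℕ) :
    shiftSym i (Finset.Icc a b) = Finset.Icc (i + a - 1) (i + b - 1) := by
  ext y
  rw [mem_shift hi, Finset.mem_Icc, Finset.mem_Icc]
  omega

/-- The composition of two host trees. -/
theorem host_comp {m n i : ℕ} {T₁ T₂ : Finset (Finset ℕ)} (hn : 1 ≤ n) (hi : 1 ≤ i)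
    (him : i ≤ m) (hm : 2 ≤ m)
    (h₁ : IsRWTree m T₁) (h₂ : IsRWTree n T₂) :
    IsRWTree (m + n - 1) (glue (Finset.Icc i (i + n - 1)) (T₁.image (subSym i n))
      (T₂.image (shiftSym i))) ∧
    PhiT (m + n - 1) (glue (Finset.Icc i (i + n - 1)) (T₁.image (subSym i n))
      (T₂.image (shiftSym i))) = ffCompose n i (PhiT m T₁) (PhiT n T₂) := by
  have bL := blkL hi hn
  have bR := blkR hi
  have eR : subSym i n (Finset.Icc 1 m) = Finset.Icc 1 (m + n - 1) := by
    rw [sub_Icc hi hn _ _ (by omega), if_pos hi, if_neg (by omega)]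
  have eB : shiftSym i (Finset.Icc 1 n) = Finset.Icc i (i + n - 1) := by
    rw [shift_Icc hi, show i + 1 - 1 = i by omega]
  have hU : IsTree (Finset.Icc 1 (m + n - 1)) (T₁.image (subSym i n)) := by
    rw [← eR, subSym_eq]; exact (bL.tree _ _).2 h₁
  have hD : IsTree (Finset.Icc i (i + n - 1)) (T₂.image (shiftSym i)) := by
    rw [← eB, shiftSym_eq]; exact (bR.tree _ _).2 h₂
  have hBR : Finset.Icc i (i + n - 1) ⊂ Finset.Icc 1 (m + n - 1) := by
    constructor
    · exact Finset.Icc_subset_Icc hi (by omega)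
    · intro h
      have h1 := h (Finset.mem_Icc.2 (⟨by omega, by omega⟩ : 1 ≤ 1 ∧ 1 ≤ m + n - 1))
      have h2 := h (Finset.mem_Icc.2 (⟨by omega, by omega⟩ : 1 ≤ m + n - 1 ∧ m + n - 1 ≤ m + n - 1))
      rw [Finset.mem_Icc] at h1 h2
      omega
  have hcol : ∀ y ∈ Finset.Icc i (i + n - 1), col i n y = i := by
    intro y hy
    rw [Finset.mem_Icc] at hy
    unfold col
    split_ifs <;> omega
  have hs : ∀ S ∈ T₁.image (subSym i n), Finset.Icc i (i + n - 1) ⊆ S ∨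
      Disjoint S (Finset.Icc i (i + n - 1)) := by
    rw [Finset.forall_mem_image]
    intro S _
    by_cases h : i ∈ S
    · left
      intro y hy
      rwa [mem_sub hi hn, hcol y hy]
    · right
      rw [Finset.disjoint_left]
      intro y hy hyB
      rw [mem_sub hi hn, hcol y hyB] at hy
      exact h hy
  refine ⟨glue_tree hU hD hBR hs, (phi_glue hU hD hBR hs).trans ?_⟩
  unfold ffCompose
  have e1 := bL.phi (Finset.Icc 1 m) T₁
  have e2 := bR.phi (Finset.Icc 1 n) T₂
  rw [← subSym_eq] at e1
  rw [← shiftSym_eq] at e2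
  change _ = _ + Finsupp.mapDomain (subSym i n) (PhiR _ _)
    + Finsupp.mapDomain (shiftSym i) (PhiR _ _)
  rw [e1, e2]
  have e3 : (Finset.Icc 1 m).biUnion (gL i n) = Finset.Icc 1 (m + n - 1) := eR
  have e4 : (Finset.Icc 1 n).biUnion (gR i) = Finset.Icc i (i + n - 1) := by
    rw [← eB, shiftSym_eq]
  rw [e3, e4]

theorem glue_recursive {B : Finset ℕ} {U D : Finset (Finset ℕ)} (hU : IsRecursive U)
    (hD : IsRecursive D) : IsRecursive (glue B U D) := by
  intro S hS
  rcases Finset.mem_union.1 (Finset.mem_filter.1 hS).1 with h | h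
  · exact hU S h
  · exact hD S h

theorem pos_of_tree {n : ℕ} {T : Finset (Finset ℕ)} (h : IsRWTree n T) : 1 ≤ n := by
  obtain ⟨y, hy⟩ := (h.1 _ h.2.1).1
  rw [Finset.mem_Icc] at hy
  omega

theorem leaf_white {fam : Finset (Finset ℕ)} {R S : Finset ℕ} (h : IsTree R fam) (hS : S ∈ fam)
    (hc : S.card ≤ 1) : ¬ IsRed fam S := by
  rw [isRed_iff h]
  intro hg
  obtain ⟨j, hj⟩ := (h.1 S hS).1
  obtain ⟨T, hT, hjT, hTS, -⟩ := hg j hj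
  have := Finset.card_lt_card hTS
  have h2 : 0 < T.card := Finset.card_pos.2 ⟨j, hjT⟩
  omega

theorem tree_one {T : Finset (Finset ℕ)} (h : IsRWTree 1 T) : T = {{1}} := by
  ext S
  rw [Finset.mem_singleton]
  constructor
  · intro hS
    obtain ⟨h1, h2⟩ := h.1 S hS
    rw [Finset.Icc_self] at h2
    exact (h1.subset_singleton_iff).1 h2
  · rintro rfl
    have := h.2.1
    rwa [Finset.Icc_self] at this

theorem tree_unit : IsRWTree 1 {{1}} := by
  refine ⟨?_, ?_, ?_⟩ <;> simp

theorem phi_unit : PhiT 1 {{1}} = ffUnit := by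
  have h := leaf_white (S := {1}) tree_unit (by simp) (by simp)
  simp [PhiT, ffUnit, h]

theorem red_two {T : Finset (Finset ℕ)} (h : IsRWTree 2 T) :
    IsRed T {1, 2} ↔ ({1} ∈ T ∧ {2} ∈ T) := by
  have hs1 : ∀ S ∈ T, 1 ∈ S → S ⊂ {1, 2} → S = {1} := by
    intro S _ h1 h2
    ext y
    have hy : y ∈ S → y ∈ ({1, 2} : Finset ℕ) := fun h => h2.1 h
    by_cases h3 : 2 ∈ S
    · exact absurd (by intro z hz; simp at hz; rcases hz with rfl | rfl <;> assumption) h2.2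
    · simp at hy ⊢
      constructor
      · intro hyS
        rcases hy hyS with rfl | rfl
        · rfl
        · exact absurd hyS h3
      · rintro rfl; exact h1
  have hs2 : ∀ S ∈ T, 2 ∈ S → S ⊂ {1, 2} → S = {2} := by
    intro S _ h1 h2
    ext y
    have hy : y ∈ S → y ∈ ({1, 2} : Finset ℕ) := fun h => h2.1 h
    by_cases h3 : 1 ∈ S
    · exact absurd (by intro z hz; simp at hz; rcases hz with rfl | rfl <;> assumption) h2.2
    · simp at hy ⊢
      constructor
      · intro hyS
        rcases hy hyS with rfl | rfl
        · exact absurd hyS h3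
        · rfl
      · rintro rfl; exact h1
  rw [isRed_iff h]
  constructor
  · intro hg
    obtain ⟨S, hS, h1, h2, -⟩ := hg 1 (by simp)
    obtain ⟨S', hS', h1', h2', -⟩ := hg 2 (by simp)
    rw [hs1 S hS h1 h2] at hS
    rw [hs2 S' hS' h1' h2'] at hS'
    exact ⟨hS, hS'⟩
  · rintro ⟨ha, hb⟩ j hj
    simp at hj
    rcases hj with rfl | rfl
    · refine ⟨{1}, ha, by simp, by decide, ?_, leaf_white h ha (by simp)⟩
      intro V hV h1 h2
      exact h1.ne (hs1 V hV (h1.1 (by simp)) h2).symm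
    · refine ⟨{2}, hb, by simp, by decide, ?_, leaf_white h hb (by simp)⟩
      intro V hV h1 h2
      exact h1.ne (hs2 V hV (h1.1 (by simp)) h2).symm

theorem icc12 : Finset.Icc 1 2 = ({1, 2} : Finset ℕ) := by decide

theorem tree_two {T : Finset (Finset ℕ)} : IsRWTree 2 T ↔
    T = Tsucc ∨ T = Tprec ∨ T = Tmid ∨ T = Tdot := by
  constructor
  · intro h
    have h0 : ({1, 2} : Finset ℕ) ∈ T := icc12 ▸ h.2.1
    have hT : ∀ S ∈ T, S = {1} ∨ S = {2} ∨ S = {1, 2} := by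
      intro S hS
      obtain ⟨h1, h2⟩ := h.1 S hS
      rw [icc12] at h2
      have : S ∈ ({1, 2} : Finset ℕ).powerset := Finset.mem_powerset.2 h2
      have h3 : ({1, 2} : Finset ℕ).powerset = {∅, {1}, {2}, {1, 2}} := by decide
      rw [h3] at this
      simp at this
      rcases this with rfl | h | h | h
      · simp at h1
      all_goals tauto
    by_cases h1 : {1} ∈ T <;> by_cases h2 : {2} ∈ T
    · right; right; right
      ext S; simp only [Tdot, Finset.mem_insert, Finset.mem_singleton]
      constructor
      · intro hS; have := hT S hS; tauto
      · rintro (rfl | rfl | rfl) <;> assumption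
    · left
      ext S; simp only [Tsucc, Finset.mem_insert, Finset.mem_singleton]
      constructor
      · intro hS
        rcases hT S hS with rfl | rfl | rfl
        · tauto
        · exact absurd hS h2
        · tauto
      · rintro (rfl | rfl) <;> assumption
    · right; left
      ext S; simp only [Tprec, Finset.mem_insert, Finset.mem_singleton]
      constructor
      · intro hS
        rcases hT S hS with rfl | rfl | rfl
        · exact absurd hS h1
        · tauto
        · tauto
      · rintro (rfl | rfl) <;> assumption
    · right; right; left
      ext S; simp only [Tmid, Finset.mem_singleton]
      constructor
      · intro hS
        rcases hT S hS with rfl | rfl | rfl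
        · exact absurd hS h1
        · exact absurd hS h2
        · rfl
      · rintro rfl; assumption
  · rintro (rfl | rfl | rfl | rfl) <;>
    · unfold IsRWTree
      rw [icc12]
      simp [Tsucc, Tprec, Tmid, Tdot]

theorem phi_two {T : Finset (Finset ℕ)} (h : IsRWTree 2 T) : PhiT 2 T =
    (if {1} ∈ T then Finsupp.single {1} (-1) else 0) +
    (if {2} ∈ T then Finsupp.single {2} (-1) else 0) +
    (if {1} ∈ T ∧ {2} ∈ T then 0 else Finsupp.single {1, 2} (-1)) := by
  have h12 := red_two h
  have l1 : {1} ∈ T → ¬ IsRed T {1} := fun h' => leaf_white h h' (by simp)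
  have l2 : {2} ∈ T → ¬ IsRed T {2} := fun h' => leaf_white h h' (by simp)
  have d1 : ({1, 2} : Finset ℕ) ≠ {1} := by decide
  have d2 : ({1, 2} : Finset ℕ) ≠ {2} := by decide
  have d3 : ({1} : Finset ℕ) ≠ {2} := by decide
  rcases tree_two.1 h with rfl | rfl | rfl | rfl
  · rw [PhiT, icc12, Tsucc, Finset.sum_pair d1]
    simp only [Tsucc] at h12 l1 l2
    simp [Tsucc, h12, l1, d1, d1.symm, d2, d2.symm, d3, d3.symm]
    rw [add_comm]
  · rw [PhiT, icc12, Tprec, Finset.sum_pair d2]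
    simp only [Tprec] at h12 l1 l2
    simp [Tprec, h12, l2, d1, d1.symm, d2, d2.symm, d3, d3.symm]
    rw [add_comm]
  · rw [PhiT, icc12, Tmid, Finset.sum_singleton]
    simp only [Tmid] at h12 l1 l2
    simp [Tmid, h12, d1, d1.symm, d2, d2.symm, d3, d3.symm]
  · rw [PhiT, icc12, Tdot, Finset.sum_insert (by simp [d1, d2]), Finset.sum_pair d3]
    simp only [Tdot] at h12 l1 l2
    simp [Tdot, h12, l1, l2, d1, d1.symm, d2, d2.symm, d3, d3.symm]

theorem phi_gens : PhiT 2 Tsucc = Fsucc ∧ PhiT 2 Tprec = Fprec ∧ PhiT 2 Tmid = Fmid ∧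
    PhiT 2 Tdot = Fdot := by
  have d1 : ({1, 2} : Finset ℕ) ≠ {1} := by decide
  have d2 : ({1, 2} : Finset ℕ) ≠ {2} := by decide
  have d3 : ({1} : Finset ℕ) ≠ {2} := by decide
  refine ⟨?_, ?_, ?_, ?_⟩
  · rw [phi_two (tree_two.2 (by tauto))]
    simp [Tsucc, Fsucc, d1, d1.symm, d2, d2.symm, d3, d3.symm]
  · rw [phi_two (tree_two.2 (by tauto))]
    simp [Tprec, Fprec, d1, d1.symm, d2, d2.symm, d3, d3.symm]
  · rw [phi_two (tree_two.2 (by tauto))]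
    simp [Tmid, Fmid, d1, d1.symm, d2, d2.symm, d3, d3.symm]
  · rw [phi_two (tree_two.2 (by tauto))]
    simp [Tdot, Fdot, d1, d1.symm, d2, d2.symm, d3, d3.symm]

theorem rec_two {T : Finset (Finset ℕ)} (h : IsRWTree 2 T) : IsRecursive T := by
  have a : ∃ a b : ℕ, ({1, 2} : Finset ℕ) = Finset.Icc a b := ⟨1, 2, by decide⟩
  have b : ∃ a b : ℕ, ({1} : Finset ℕ) = Finset.Icc a b := ⟨1, 1, by decide⟩
  have c : ∃ a b : ℕ, ({2} : Finset ℕ) = Finset.Icc a b := ⟨2, 2, by decide⟩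
  rcases tree_two.1 h with rfl | rfl | rfl | rfl <;>
  · intro S hS
    simp only [Tsucc, Tprec, Tmid, Tdot, Finset.mem_insert, Finset.mem_singleton] at hS
    first
    | (rcases hS with rfl | rfl | rfl <;> assumption)
    | (rcases hS with rfl | rfl <;> assumption)
    | (rcases hS with rfl; assumption)

theorem comp_unit (n : ℕ) (G : FFrac) : ffCompose n 1 ffUnit G = G := by
  unfold ffCompose ffUnit
  rw [Finsupp.mapDomain_single]
  have e1 : subSym 1 n {1} = Finset.Icc 1 (1 + n - 1) := by simp [subSym]
  have e2 : shiftSym 1 = id := by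
    funext S
    simp [shiftSym]
  rw [e1, e2, Finsupp.mapDomain_id, ← Finsupp.single_add]
  simp

theorem closure_sub {n : ℕ} {F : FFrac} (h : FFClosure GenFF4 n F) :
    ∃ T, (IsRWTree n T ∧ IsRecursive T) ∧ PhiT n T = F := by
  induction h with
  | gen h =>
    rcases h with ⟨rfl, rfl⟩ | ⟨rfl, h⟩
    · exact ⟨_, ⟨tree_unit, fun S hS => ⟨1, 1, by simpa using hS⟩⟩, phi_unit⟩
    · obtain ⟨p1, p2, p3, p4⟩ := phi_gens
      have key : ∀ T, (T = Tsucc ∨ T = Tprec ∨ T = Tmid ∨ T = Tdot) →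
          (IsRWTree 2 T ∧ IsRecursive T) := fun T hT =>
        ⟨tree_two.2 hT, rec_two (tree_two.2 hT)⟩
      rcases h with rfl | rfl | rfl | rfl
      · exact ⟨_, key _ (by tauto), p1⟩
      · exact ⟨_, key _ (by tauto), p2⟩
      · exact ⟨_, key _ (by tauto), p3⟩
      · exact ⟨_, key _ (by tauto), p4⟩
  | @comp m n i F F' _ _ hi him ih1 ih2 =>
    obtain ⟨T₁, ⟨h₁, r₁⟩, rfl⟩ := ih1
    obtain ⟨T₂, ⟨h₂, r₂⟩, rfl⟩ := ih2
    have hn := pos_of_tree h₂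
    by_cases hm : 2 ≤ m
    · obtain ⟨a, b⟩ := host_comp hn hi him hm h₁ h₂
      refine ⟨_, ⟨a, glue_recursive ?_ ?_⟩, b⟩
      · unfold IsRecursive
        rw [Finset.forall_mem_image]
        intro S hS
        obtain ⟨a, b, rfl⟩ := r₁ S hS
        exact ⟨_, _, sub_Icc hi hn a b (Finset.nonempty_Icc.1 (h₁.1 _ hS).1)⟩
      · unfold IsRecursive
        rw [Finset.forall_mem_image]
        intro S hS
        obtain ⟨a, b, rfl⟩ := r₂ S hS
        exact ⟨_, _, shift_Icc hi a b⟩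
    · have : m = 1 := by omega
      subst this
      have : i = 1 := by omega
      subst this
      have := tree_one h₁
      subst this
      rw [phi_unit, comp_unit, show 1 + n - 1 = n by omega]
      exact ⟨T₂, ⟨h₂, r₂⟩, rfl⟩

/-- Splitting a tree along an interval. -/
theorem split_tree {m n i : ℕ} {W : Finset (Finset ℕ)} (hn : 1 ≤ n) (hi : 1 ≤ i)
    (him : i ≤ m) (hm : 2 ≤ m) (hW : IsRWTree (m + n - 1) W) (rW : IsRecursive W)
    (hB : ∀ S ∈ W, S ⊆ Finset.Icc i (i + n - 1) ∨ Finset.Icc i (i + n - 1) ⊆ S ∨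
      Disjoint S (Finset.Icc i (i + n - 1))) :
    ∃ T₁ T₂, (IsRWTree m T₁ ∧ IsRecursive T₁) ∧ (IsRWTree n T₂ ∧ IsRecursive T₂) ∧
      PhiT (m + n - 1) W = ffCompose n i (PhiT m T₁) (PhiT n T₂) := by
  set B := Finset.Icc i (i + n - 1) with hBdef
  have hiB : i ∈ B := Finset.mem_Icc.2 ⟨le_rfl, by omega⟩
  have heB : i + n - 1 ∈ B := Finset.mem_Icc.2 ⟨by omega, le_rfl⟩
  have bL := blkL hi hn
  have bR := blkR hi
  have eR : subSym i n (Finset.Icc 1 m) = Finset.Icc 1 (m + n - 1) := by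
    rw [sub_Icc hi hn _ _ (by omega), if_pos hi, if_neg (by omega)]
  have eB : shiftSym i (Finset.Icc 1 n) = B := by
    rw [shift_Icc hi, show i + 1 - 1 = i by omega]
  have hBR : B ⊆ Finset.Icc 1 (m + n - 1) := Finset.Icc_subset_Icc hi (by omega)
  have hRB : ¬ Finset.Icc 1 (m + n - 1) ⊆ B := by
    intro h
    have h1 := h (Finset.mem_Icc.2 (⟨by omega, by omega⟩ : 1 ≤ 1 ∧ 1 ≤ m + n - 1))
    have h2 := h (Finset.mem_Icc.2 (⟨by omega, by omega⟩ : 1 ≤ m + n - 1 ∧ m + n - 1 ≤ m + n - 1))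
    rw [hBdef, Finset.mem_Icc] at h1 h2
    omega
  have hcol : ∀ y, col i n y = i ↔ y ∈ B := by
    intro y
    rw [hBdef, Finset.mem_Icc]
    unfold col
    split_ifs <;> omega
  have hcol2 : ∀ y z, col i n y = col i n z → y = z ∨ (y ∈ B ∧ z ∈ B) := by
    intro y z
    rw [hBdef, Finset.mem_Icc, Finset.mem_Icc]
    unfold col
    split_ifs <;> omega
  set D : Finset (Finset ℕ) := insert B (W.filter fun S => S ⊂ B) with hDdef
  set U : Finset (Finset ℕ) := W.filter (fun S => ¬ S ⊆ B) ∪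
    (if (B ∈ W ↔ IsRed D B) then ∅ else {B}) with hUdef
  have hUm : ∀ S, S ∈ U → (S ∈ W ∧ ¬ S ⊆ B) ∨ S = B := by
    intro S hS
    rw [hUdef, Finset.mem_union, Finset.mem_filter] at hS
    rcases hS with h | h
    · exact Or.inl h
    · split_ifs at h
      · simp at h
      · exact Or.inr (by simpa using h)
  have hBU : B ∈ U ↔ ¬ (B ∈ W ↔ IsRed D B) := by
    rw [hUdef, Finset.mem_union, Finset.mem_filter]
    split_ifs with h <;> simp [h]
  have hUW : ∀ S, ¬ S ⊆ B → (S ∈ U ↔ S ∈ W) := by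
    intro S hS
    have hne : S ≠ B := by rintro rfl; exact hS subset_rfl
    constructor
    · intro h
      rcases hUm S h with h | h
      · exact h.1
      · exact absurd h hne
    · intro h
      exact Finset.mem_union_left _ (Finset.mem_filter.2 ⟨h, hS⟩)
  have hglue : glue B U D = W := by
    ext S
    by_cases h1 : S = B
    · rw [h1]
      have : B ∈ D := Finset.mem_insert_self _ _
      simp only [glue, Finset.mem_filter, Finset.mem_union, this, or_true, true_and, hBU]
      tauto
    · by_cases h2 : S ⊆ B
      · have h3 : S ⊂ B := lt_of_le_of_ne h2 h1
        have h4 : S ∉ U := by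
          intro h
          rcases hUm S h with h | h
          · exact h.2 h2
          · exact h1 h
        simp [glue, h1, h4, hDdef, h3]
      · have h3 : S ∉ D := by
          intro h
          rcases Finset.mem_insert.1 h with h | h
          · exact h1 h
          · exact h2 (Finset.mem_filter.1 h).2.1
        simp [glue, h1, h3, hUW S h2]
  have hU : IsTree (Finset.Icc 1 (m + n - 1)) U := by
    refine ⟨?_, (hUW _ hRB).2 hW.2.1, ?_⟩
    · intro S hS
      rcases hUm S hS with h | rfl
      · exact hW.1 S h.1
      · exact ⟨⟨i, hiB⟩, hBR⟩
    · intro S hS T hT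
      rcases hUm S hS with h | h <;> rcases hUm T hT with h' | h'
      · exact hW.2.2 S h.1 T h'.1
      · rw [h']; exact hB S h.1
      · rw [h]
        rcases hB T h'.1 with h | h | h
        · exact Or.inr (Or.inl h)
        · exact Or.inl h
        · exact Or.inr (Or.inr h.symm)
      · rw [h, h']; exact Or.inl subset_rfl
  have hDm : ∀ S, S ∈ D → S = B ∨ (S ∈ W ∧ S ⊂ B) := by
    intro S hS
    simpa [hDdef] using hS
  have hD : IsTree B D := by
    refine ⟨?_, Finset.mem_insert_self _ _, ?_⟩
    · intro S hS
      rcases hDm S hS with rfl | h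
      · exact ⟨⟨i, hiB⟩, subset_rfl⟩
      · exact ⟨(hW.1 S h.1).1, h.2.1⟩
    · intro S hS T hT
      rcases hDm S hS with h | h <;> rcases hDm T hT with h' | h'
      · rw [h, h']; exact Or.inl subset_rfl
      · rw [h]; exact Or.inr (Or.inl h'.2.1)
      · rw [h']; exact Or.inl h.2.1
      · exact hW.2.2 S h.1 T h'.1
  have rU : IsRecursive U := by
    intro S hS
    rcases hUm S hS with h | rfl
    · exact rW S h.1
    · exact ⟨_, _, rfl⟩
  have rD : IsRecursive D := by
    intro S hS
    rcases hDm S hS with rfl | h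
    · exact ⟨_, _, rfl⟩
    · exact rW S h.1
  have hs : ∀ S ∈ U, B ⊆ S ∨ Disjoint S B := by
    intro S hS
    rcases hUm S hS with h | rfl
    · rcases hB S h.1 with h' | h'
      · exact absurd h' h.2
      · exact h'
    · exact Or.inl subset_rfl
  have i1 : ∀ S ∈ U, subSym i n (S.image (col i n)) = S := by
    intro S hS
    ext y
    rw [mem_sub hi hn, Finset.mem_image]
    constructor
    · rintro ⟨z, hz, hzy⟩
      rcases hcol2 z y hzy with rfl | ⟨h1, h2⟩
      · exact hz
      · rcases hs S hS with h | h
        · exact h h2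
        · exact absurd h1 (Finset.disjoint_left.1 h hz)
    · exact fun h => ⟨y, h, rfl⟩
  have i2 : ∀ S ∈ D, shiftSym i (S.image fun y => y + 1 - i) = S := by
    intro S hS
    have hSB := (hD.1 S hS).2
    ext y
    rw [mem_shift hi, Finset.mem_image]
    constructor
    · rintro ⟨h1, z, hz, hzy⟩
      have := Finset.mem_Icc.1 (hSB hz)
      have : z = y := by omega
      rwa [← this]
    · intro h
      have := Finset.mem_Icc.1 (hSB h)
      exact ⟨by omega, y, h, rfl⟩
  set T₁ := U.image fun S => S.image (col i n) with hT₁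
  set T₂ := D.image fun S => S.image (fun y => y + 1 - i) with hT₂
  have j1 : T₁.image (subSym i n) = U := by
    rw [hT₁, Finset.image_image]
    conv_rhs => rw [← Finset.image_id (s := U)]
    exact Finset.image_congr fun S hS => i1 S hS
  have j2 : T₂.image (shiftSym i) = D := by
    rw [hT₂, Finset.image_image]
    conv_rhs => rw [← Finset.image_id (s := D)]
    exact Finset.image_congr fun S hS => i2 S hS
  have t1 : IsRWTree m T₁ := by
    have h := hU
    rw [← j1, ← eR, subSym_eq] at h
    exact (bL.tree _ _).1 h
  have t2 : IsRWTree n T₂ := by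
    have h := hD
    rw [← j2, ← eB, shiftSym_eq] at h
    exact (bR.tree _ _).1 h
  refine ⟨T₁, T₂, ⟨t1, ?_⟩, ⟨t2, ?_⟩, ?_⟩
  · unfold IsRecursive
    rw [hT₁, Finset.forall_mem_image]
    intro S hS
    have hs' := hs S hS
    have hne := (hU.1 S hS).1
    obtain ⟨a, b, rfl⟩ := rU S hS
    have hab := Finset.nonempty_Icc.1 hne
    have hcase : (a ≤ i ∧ i + n - 1 ≤ b) ∨ b < i ∨ i + n - 1 < a := by
      rcases hs' with h | h
      · have h1 := Finset.mem_Icc.1 (h hiB)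
        have h2 := Finset.mem_Icc.1 (h heB)
        omega
      · by_contra hc
        have h1 : max a i ∈ Finset.Icc a b := Finset.mem_Icc.2 (by omega)
        have h2 : max a i ∈ B := Finset.mem_Icc.2 (by omega)
        exact Finset.disjoint_left.1 h h1 h2
    refine ⟨col i n a, col i n b, ?_⟩
    ext k
    rw [Finset.mem_image, Finset.mem_Icc]
    constructor
    · rintro ⟨y, hy, rfl⟩
      rw [Finset.mem_Icc] at hy
      unfold col
      split_ifs <;> omega
    · intro h
      refine ⟨if k ≤ i then k else k + n - 1, ?_, ?_⟩
      · rw [Finset.mem_Icc]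
        unfold col at h
        split_ifs at h ⊢ <;> omega
      · unfold col
        split_ifs <;> omega
  · unfold IsRecursive
    rw [hT₂, Finset.forall_mem_image]
    intro S hS
    obtain ⟨hne, hSB⟩ := hD.1 S hS
    obtain ⟨a, b, rfl⟩ := rD S hS
    have hab := Finset.nonempty_Icc.1 hne
    have ha := Finset.mem_Icc.1 (hSB (Finset.left_mem_Icc.2 hab))
    refine ⟨a + 1 - i, b + 1 - i, ?_⟩
    ext k
    rw [Finset.mem_image, Finset.mem_Icc]
    constructor
    · rintro ⟨y, hy, rfl⟩
      rw [Finset.mem_Icc] at hy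
      omega
    · intro h
      exact ⟨k + i - 1, Finset.mem_Icc.2 (by omega), by omega⟩
  · have := (host_comp hn hi him hm t1 t2).2
    rw [j1, j2, ← hBdef, hglue] at this
    exact this

theorem sub_closure (n : ℕ) : ∀ W, IsRWTree n W → IsRecursive W →
    FFClosure GenFF4 n (PhiT n W) := by
  induction n using Nat.strong_induction_on with
  | _ N ih =>
  intro W hW rW
  have hN := pos_of_tree hW
  by_cases h1 : N = 1
  · subst h1
    rw [tree_one hW, phi_unit]
    exact FFClosure.gen (Or.inl ⟨rfl, rfl⟩)
  by_cases h2 : N = 2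
  · subst h2
    refine FFClosure.gen (Or.inr ⟨rfl, ?_⟩)
    obtain ⟨p1, p2, p3, p4⟩ := phi_gens
    rcases tree_two.1 hW with rfl | rfl | rfl | rfl
    · exact Or.inl p1
    · exact Or.inr (Or.inl p2)
    · exact Or.inr (Or.inr (Or.inl p3))
    · exact Or.inr (Or.inr (Or.inr p4))
  have key : ∃ m n i, 2 ≤ n ∧ 1 ≤ i ∧ i ≤ m ∧ 2 ≤ m ∧ N = m + n - 1 ∧
      ∀ S ∈ W, S ⊆ Finset.Icc i (i + n - 1) ∨ Finset.Icc i (i + n - 1) ⊆ S ∨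
      Disjoint S (Finset.Icc i (i + n - 1)) := by
    by_cases hex : ∃ S ∈ W, S ≠ Finset.Icc 1 N ∧ 2 ≤ S.card
    · obtain ⟨S, hS, hne, hc⟩ := hex
      have hSR := (hW.1 S hS).2
      obtain ⟨a, b, rfl⟩ := rW S hS
      rw [Nat.card_Icc] at hc
      have ha := Finset.mem_Icc.1 (hSR (Finset.left_mem_Icc.2 (by omega)))
      have hb := Finset.mem_Icc.1 (hSR (Finset.right_mem_Icc.2 (by omega)))
      have hlt : b + 1 - a < N := by
        by_contra hc
        apply hne
        have : a = 1 := by omega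
        have : b = N := by omega
        subst a b; rfl
      refine ⟨N - (b + 1 - a) + 1, b + 1 - a, a, hc, ha.1, by omega, by omega, by omega, ?_⟩
      intro T hT
      rw [show a + (b + 1 - a) - 1 = b by omega]
      exact hW.2.2 T hT _ hS
    · push Not at hex
      refine ⟨N - 1, 2, 1, le_rfl, le_rfl, by omega, by omega, by omega, ?_⟩
      intro S hS
      by_cases hR : S = Finset.Icc 1 N
      · right; left
        rw [hR]
        exact Finset.Icc_subset_Icc le_rfl (by omega)
      · have h3 := hex S hS hR
        have h4 := Finset.card_pos.2 (hW.1 S hS).1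
        obtain ⟨x, rfl⟩ := Finset.card_eq_one.1 (by omega : S.card = 1)
        rw [Finset.singleton_subset_iff, Finset.disjoint_singleton_left]
        tauto
  obtain ⟨m, n, i, hn, hi, him, hm, rfl, hB⟩ := key
  obtain ⟨T₁, T₂, ⟨t1, r1⟩, ⟨t2, r2⟩, e⟩ := split_tree (by omega) hi him hm hW rW hB
  rw [e]
  exact FFClosure.comp (ih m (by omega) T₁ t1 r1) (ih n (by omega) T₂ t2 r2) hi him

theorem phi_inj (n : ℕ) :
    Set.InjOn (PhiT n) {fam : Finset (Finset ℕ) | IsRWTree n fam ∧ IsRecursive fam} := by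
  rintro T ⟨hT, -⟩ T' ⟨hT', -⟩ h
  ext S
  by_cases hS : S = Finset.Icc 1 n
  · subst hS
    exact ⟨fun _ => hT'.2.1, fun _ => hT.2.1⟩
  · have h1 : PhiR (Finset.Icc 1 n) T S = PhiR (Finset.Icc 1 n) T' S := DFunLike.congr_fun h S
    rw [PhiR_apply, PhiR_apply] at h1
    by_cases a : S ∈ T <;> by_cases b : S ∈ T' <;> simp [a, b, hS] at h1 ⊢
    all_goals (split_ifs at h1 <;> simp at h1)

/-- The image under `Φ` of the recursively labelled red and white
trees on `{1,…,n}` is exactly `FF₄(n)`; in particular these sets are equinumerous. -/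
theorem phiT_image_eq_FF4 (n : ℕ) (hn : 1 ≤ n) :
    PhiT n '' {fam : Finset (Finset ℕ) | IsRWTree n fam ∧ IsRecursive fam}
        = {F : FFrac | FFClosure GenFF4 n F} ∧
    Set.ncard {F : FFrac | FFClosure GenFF4 n F}
        = Set.ncard {fam : Finset (Finset ℕ) | IsRWTree n fam ∧ IsRecursive fam} := by
  have h : PhiT n '' {fam : Finset (Finset ℕ) | IsRWTree n fam ∧ IsRecursive fam}
        = {F : FFrac | FFClosure GenFF4 n F} := by
    ext F
    constructor
    · rintro ⟨W, ⟨h1, h2⟩, rfl⟩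
      exact sub_closure n W h1 h2
    · intro hF
      exact closure_sub hF
  refine ⟨h, ?_⟩
  rw [← h, Set.ncard_image_of_injOn (phi_inj n)]
end

section
/- A recursively labelled red and white tree T ∈ BWTS(n) belongs to the closure of the three generators T_≺, T_≻, T_⊙ (together with the unit single-node tree labelled {1}) under the compositions ∘_x if and only if: every node of T carries at most one label, no node with a nonempty label set has a red child, and no white node has two or more red children. -/
open scoped Classical

/-- The closure of a family of generators under the compositions `∘ₓ`. -/
inductive RWClosure (G : ℕ → Finset (Finset ℕ) → Prop) : ℕ → Finset (Finset ℕ) → Prop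
  | gen {n : ℕ} {fam : Finset (Finset ℕ)} : G n fam → RWClosure G n fam
  | comp {m n x : ℕ} {fam₁ fam₂ : Finset (Finset ℕ)} :
      RWClosure G m fam₁ → RWClosure G n fam₂ → 1 ≤ x → x ≤ m →
      RWClosure G (m + n - 1) (rwCompose n x fam₁ fam₂)

/-- The unit together with the three generators `T_≺, T_≻, T_⊙`. -/
def GenST (n : ℕ) (fam : Finset (Finset ℕ)) : Prop :=
  (n = 1 ∧ fam = unitT) ∨ (n = 2 ∧ (fam = Tprec ∨ fam = Tsucc ∨ fam = Tdot))

/-- Number of members of `F` contained in `S`. -/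
def NN (F : Finset (Finset ℕ)) (S : Finset ℕ) : ℕ := (F.filter (· ⊆ S)).card

def ind (R : Finset (Finset ℕ)) (S : Finset ℕ) : ℕ := if S ∈ R then 1 else 0

/-- Laminar family with root `I`. -/
structure Lam (I : Finset ℕ) (fam : Finset (Finset ℕ)) : Prop where
  ne : ∀ S ∈ fam, S.Nonempty
  sub : ∀ S ∈ fam, S ⊆ I
  root : I ∈ fam
  lam : ∀ S ∈ fam, ∀ T ∈ fam, S ⊆ T ∨ T ⊆ S ∨ Disjoint S T

structure Cnt (I : Finset ℕ) (fam R : Finset (Finset ℕ)) : Prop extends Lam I fam where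
  RF : R ⊆ fam
  eq : ∀ S ∈ fam, NN fam S + ind R S = S.card + 2 * NN R S

lemma mem_children {fam : Finset (Finset ℕ)} {S T : Finset ℕ} :
    T ∈ childrenF fam S ↔ T ∈ fam ∧ T ⊂ S ∧ ∀ U ∈ fam, T ⊂ U → ¬ U ⊂ S := by
  simp [childrenF]

lemma exists_child {fam : Finset (Finset ℕ)} {S T : Finset ℕ} (hT : T ∈ fam) (h : T ⊂ S) :
    ∃ C ∈ childrenF fam S, T ⊆ C := by
  obtain ⟨C, h1, h2⟩ := Finset.exists_le_maximal (fam.filter (· ⊂ S)) (a := T) (by simp [hT, h])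
  have h3 := h2.prop
  simp only [Finset.mem_filter] at h3
  refine ⟨C, mem_children.2 ⟨h3.1, h3.2, fun U hU hCU hUS => ?_⟩, h1⟩
  exact hCU.2 (h2.2 (by simp [hU, hUS]) hCU.1)

lemma children_disj {I : Finset ℕ} {fam : Finset (Finset ℕ)} (hl : Lam I fam) {S C D : Finset ℕ}
    (hC : C ∈ childrenF fam S) (hD : D ∈ childrenF fam S) (hne : C ≠ D) : Disjoint C D := by
  rw [mem_children] at hC hD
  rcases hl.lam C hC.1 D hD.1 with h | h | h
  · exact absurd hD.2.1 (hC.2.2 D hD.1 (lt_of_le_of_ne h hne))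
  · exact absurd hC.2.1 (hD.2.2 C hC.1 (lt_of_le_of_ne h hne.symm))
  · exact h

lemma nn_children {I : Finset ℕ} {fam F : Finset (Finset ℕ)} (hl : Lam I fam) (hF : F ⊆ fam)
    (S : Finset ℕ) : NN F S = ind F S + ∑ C ∈ childrenF fam S, NN F C := by
  have h1 : F.filter (· ⊆ S) =
      (F.filter (· = S)) ∪ (childrenF fam S).biUnion (fun C => F.filter (· ⊆ C)) := by
    ext T
    simp only [Finset.mem_filter, Finset.mem_union, Finset.mem_biUnion]
    constructor
    · rintro ⟨hT, hTS⟩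
      by_cases h : T = S
      · exact Or.inl ⟨hT, h⟩
      · obtain ⟨C, hC, hTC⟩ := exists_child (hF hT) (lt_of_le_of_ne hTS h)
        exact Or.inr ⟨C, hC, hT, hTC⟩
    · rintro (⟨hT, rfl⟩ | ⟨C, hC, hT, hTC⟩)
      · exact ⟨hT, subset_rfl⟩
      · exact ⟨hT, hTC.trans (mem_children.1 hC).2.1.1⟩
  have h2 : Disjoint (F.filter (· = S))
      ((childrenF fam S).biUnion (fun C => F.filter (· ⊆ C))) := by
    rw [Finset.disjoint_left]
    intro T hT hT'
    simp only [Finset.mem_filter, Finset.mem_biUnion] at hT hT'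
    obtain ⟨C, hC, -, hTC⟩ := hT'
    rw [hT.2] at hTC
    exact (mem_children.1 hC).2.1.2 hTC
  rw [NN, h1, Finset.card_union_of_disjoint h2, Finset.card_biUnion]
  · congr 1
    rw [Finset.filter_eq' F S, ind]
    split_ifs <;> simp
  · intro C hC D hD hne
    rw [Function.onFun, Finset.disjoint_left]
    intro T hT hT'
    simp only [Finset.mem_filter] at hT hT'
    have hd := children_disj hl hC hD hne
    obtain ⟨k, hk⟩ := hl.ne T (hF hT.1)
    exact Finset.disjoint_left.1 hd (hT.2 hk) (hT'.2 hk)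

lemma card_children {I : Finset ℕ} {fam : Finset (Finset ℕ)} (hl : Lam I fam)
    (S : Finset ℕ) : S.card = (labelsOf fam S).card + ∑ C ∈ childrenF fam S, C.card := by
  have h : ((childrenF fam S).biUnion id) ⊆ S := by
    intro k hk
    simp only [Finset.mem_biUnion, id] at hk
    obtain ⟨C, hC, hk⟩ := hk
    exact (mem_children.1 hC).2.1.1 hk
  have h2 : ((childrenF fam S).biUnion id).card = ∑ C ∈ childrenF fam S, C.card := by
    rw [Finset.card_biUnion]
    · rfl
    · intro C hC D hD hne
      exact children_disj hl hC hD hne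
  rw [labelsOf, ← h2, Finset.card_sdiff_add_card_eq_card h]

lemma sum_ind (s R : Finset (Finset ℕ)) : ∑ C ∈ s, ind R C = (s.filter (· ∈ R)).card := by
  rw [Finset.card_filter]; rfl

/-- local form of the counting identity -/
lemma Cnt.loc_eq {I : Finset ℕ} {fam R : Finset (Finset ℕ)} (h : Cnt I fam R) {S : Finset ℕ}
    (hS : S ∈ fam) :
    (labelsOf fam S).card + ((childrenF fam S).filter (· ∈ R)).card + ind R S = 1 := by
  have e := h.eq S hS
  rw [nn_children h.toLam subset_rfl, nn_children h.toLam h.RF, card_children h.toLam S] at e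
  have e2 : ∑ C ∈ childrenF fam S, (NN fam C + ind R C) =
      ∑ C ∈ childrenF fam S, (C.card + 2 * NN R C) :=
    Finset.sum_congr rfl fun C hC => h.eq C (mem_children.1 hC).1
  rw [Finset.sum_add_distrib, Finset.sum_add_distrib, ← Finset.mul_sum, sum_ind] at e2
  have e3 : ind fam S = 1 := by simp [ind, hS]
  omega

lemma cnt_of_local {I : Finset ℕ} {fam R : Finset (Finset ℕ)} (h : Lam I fam) (hR : R ⊆ fam)
    (hl : ∀ S ∈ fam,
      (labelsOf fam S).card + ((childrenF fam S).filter (· ∈ R)).card + ind R S = 1) :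
    Cnt I fam R := by
  refine ⟨h, hR, ?_⟩
  have : ∀ k : ℕ, ∀ S ∈ fam, S.card = k → NN fam S + ind R S = S.card + 2 * NN R S := by
    intro k
    induction k using Nat.strong_induction_on with
    | _ k ih =>
      intro S hS hk
      have e2 : ∑ C ∈ childrenF fam S, (NN fam C + ind R C) =
          ∑ C ∈ childrenF fam S, (C.card + 2 * NN R C) := by
        refine Finset.sum_congr rfl fun C hC => ?_
        have hC' := mem_children.1 hC
        exact ih C.card (hk ▸ Finset.card_lt_card hC'.2.1) C hC'.1 rfl
      rw [Finset.sum_add_distrib, Finset.sum_add_distrib, ← Finset.mul_sum, sum_ind] at e2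
      have e3 : ind fam S = 1 := by simp [ind, hS]
      have e4 := hl S hS
      rw [nn_children h subset_rfl, nn_children h hR, card_children h S]
      omega
  exact fun S hS => this _ S hS rfl

lemma Cnt.red_iff {I : Finset ℕ} {fam R : Finset (Finset ℕ)} (h : Cnt I fam R) {S : Finset ℕ}
    (hS : S ∈ fam) : IsRed fam S ↔ S ∈ R := by
  have : ∀ k : ℕ, ∀ S ∈ fam, S.card = k → (IsRed fam S ↔ S ∈ R) := by
    intro k
    induction k using Nat.strong_induction_on with
    | _ k ih =>
      intro S hS hk
      have e := h.loc_eq hS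
      have e2 : (∀ T ∈ childrenF fam S, ¬ IsRed fam T) ↔
          ((childrenF fam S).filter (· ∈ R)).card = 0 := by
        rw [Finset.card_eq_zero, Finset.filter_eq_empty_iff]
        refine forall₂_congr fun T hT => ?_
        have hT' := mem_children.1 hT
        rw [ih T.card (hk ▸ Finset.card_lt_card hT'.2.1) T hT'.1 rfl]
      rw [IsRed, e2, ← Finset.card_eq_zero]
      unfold ind at e
      split_ifs at e with h1
      · simp only [h1, iff_true]; omega
      · simp only [h1, iff_false]; omega
  exact this _ S hS rfl

lemma cnt_iff_cond {I : Finset ℕ} {fam : Finset (Finset ℕ)} (h : Lam I fam) :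
    (∃ R, Cnt I fam R) ↔ (∀ S ∈ fam, (labelsOf fam S).card ≤ 1) ∧
      (∀ S ∈ fam, (labelsOf fam S).Nonempty → ∀ T ∈ childrenF fam S, ¬ IsRed fam T) ∧
      (∀ S ∈ fam, ¬ IsRed fam S →
        ¬ 2 ≤ ((childrenF fam S).filter fun T => IsRed fam T).card) := by
  constructor
  · rintro ⟨R, hc⟩
    have key : ∀ S ∈ fam, (labelsOf fam S).card +
        ((childrenF fam S).filter fun T => IsRed fam T).card + ind R S = 1 := by
      intro S hS
      rw [← hc.loc_eq hS]
      congr 3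
      exact Finset.filter_congr fun T hT => hc.red_iff (mem_children.1 hT).1
    refine ⟨fun S hS => by have := key S hS; omega, fun S hS hn T hT hr => ?_, fun S hS _ => by
      have := key S hS; omega⟩
    have := key S hS
    have h1 := hn.card_pos
    have h2 : 0 < ((childrenF fam S).filter fun T => IsRed fam T).card :=
      Finset.card_pos.2 ⟨T, by simp [hT, hr]⟩
    omega
  · rintro ⟨c1, c2, c3⟩
    refine ⟨fam.filter (IsRed fam), cnt_of_local h (Finset.filter_subset _ _) fun S hS => ?_⟩
    have e : (childrenF fam S).filter (· ∈ fam.filter (IsRed fam)) =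
        (childrenF fam S).filter fun T => IsRed fam T := by
      refine Finset.filter_congr fun T hT => ?_
      simp [(mem_children.1 hT).1]
    rw [e]
    have d1 := c1 S hS
    have d2 := c2 S hS
    have d3 := c3 S hS
    have d2' : (labelsOf fam S).Nonempty →
        ((childrenF fam S).filter fun T => IsRed fam T).card = 0 := fun hn => by
      rw [Finset.card_eq_zero, Finset.filter_eq_empty_iff]
      exact fun T hT => d2 hn T hT
    rw [← Finset.card_pos] at d2'
    have d4 : IsRed fam S ↔ (labelsOf fam S).card = 0 ∧
        ((childrenF fam S).filter fun T => IsRed fam T).card = 0 := by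
      rw [IsRed, Finset.card_eq_zero, Finset.card_eq_zero, Finset.filter_eq_empty_iff]
    unfold ind
    simp only [Finset.mem_filter, hS, true_and]
    split_ifs with h1
    · have := d4.1 h1
      omega
    · have := d3 h1
      by_cases h0 : (labelsOf fam S).card = 0
      · have : ((childrenF fam S).filter fun T => IsRed fam T).card ≠ 0 :=
          fun h' => h1 (d4.2 ⟨h0, h'⟩)
        omega
      · have := d2' (by omega)
        omega

/-- collapse of the block onto `x` -/
def cl (x n k : ℕ) : ℕ := if k < x then k else if k ≤ x + n - 1 then x else k - (n - 1)

lemma mem_relabL {x n : ℕ} (hn : 1 ≤ n) {T : Finset ℕ} {k : ℕ} :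
    k ∈ relabL x n T ↔ cl x n k ∈ T := by
  simp only [relabL, Finset.mem_biUnion, cl]
  constructor
  · rintro ⟨j, hj, hk⟩
    split_ifs at hk with h1 h2
    · simp only [Finset.mem_singleton] at hk
      subst hk; simpa [h1] using hj
    · simp only [Finset.mem_Icc] at hk
      subst h2
      rw [if_neg (by omega), if_pos (by omega)]; exact hj
    · simp only [Finset.mem_singleton] at hk
      rw [if_neg (by omega), if_neg (by omega)]
      rwa [show k - (n - 1) = j by omega]
  · intro h
    split_ifs at h with h1 h2
    · exact ⟨k, h, by simp [h1]⟩
    · exact ⟨x, h, by simp; omega⟩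
    · refine ⟨_, h, ?_⟩
      rw [if_neg (by omega), if_neg (by omega)]
      simp; omega

lemma cl_surj {x n : ℕ} (hn : 1 ≤ n) (j : ℕ) : ∃ k, cl x n k = j := by
  refine ⟨if j ≤ x then j else j + n - 1, ?_⟩
  unfold cl
  split_ifs <;> omega

lemma L_sub {x n : ℕ} (hn : 1 ≤ n) {S T : Finset ℕ} :
    relabL x n S ⊆ relabL x n T ↔ S ⊆ T := by
  constructor
  · intro h j hj
    obtain ⟨k, rfl⟩ := cl_surj (x := x) hn j
    exact (mem_relabL hn).1 (h ((mem_relabL hn).2 hj))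
  · intro h k hk
    exact (mem_relabL hn).2 (h ((mem_relabL hn).1 hk))

lemma L_inj {x n : ℕ} (hn : 1 ≤ n) : Function.Injective (relabL x n) := by
  intro S T h
  exact subset_antisymm ((L_sub hn).1 h.le) ((L_sub hn).1 h.ge)

lemma R_fun_inj {x : ℕ} (hx : 1 ≤ x) : Function.Injective (fun j => x + j - 1) := by
  intro a b h
  simp only at h
  omega

lemma R_sub {x : ℕ} (hx : 1 ≤ x) {S T : Finset ℕ} :
    relabR x S ⊆ relabR x T ↔ S ⊆ T := Finset.image_subset_image_iff (R_fun_inj hx)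

lemma R_inj {x : ℕ} (hx : 1 ≤ x) : Function.Injective (relabR x) :=
  Finset.image_injective (R_fun_inj hx)

lemma card_R {x : ℕ} (hx : 1 ≤ x) (S : Finset ℕ) : (relabR x S).card = S.card :=
  Finset.card_image_of_injective _ (R_fun_inj hx)

lemma mem_relabR {x : ℕ} {S : Finset ℕ} {k : ℕ} :
    k ∈ relabR x S ↔ ∃ j ∈ S, x + j - 1 = k := by simp [relabR]

lemma L_single {x n : ℕ} (hn : 1 ≤ n) : relabL x n {x} = Finset.Icc x (x + n - 1) := by
  ext k
  rw [mem_relabL hn]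
  unfold cl
  simp only [Finset.mem_singleton, Finset.mem_Icc]
  split_ifs <;> omega

lemma L_root {x n m : ℕ} (hn : 1 ≤ n) (hx : 1 ≤ x) (hm : x ≤ m) :
    relabL x n (Finset.Icc 1 m) = Finset.Icc 1 (m + n - 1) := by
  ext k
  rw [mem_relabL hn]
  unfold cl
  simp only [Finset.mem_Icc]
  split_ifs <;> omega

lemma R_Icc {x a b : ℕ} (hx : 1 ≤ x) :
    relabR x (Finset.Icc a b) = Finset.Icc (x + a - 1) (x + b - 1) := by
  ext k
  rw [mem_relabR]
  simp only [Finset.mem_Icc]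
  constructor
  · rintro ⟨j, hj, rfl⟩; omega
  · intro h
    exact ⟨k + 1 - x, by omega, by omega⟩

lemma R_root {x n : ℕ} (hx : 1 ≤ x) :
    relabR x (Finset.Icc 1 n) = Finset.Icc x (x + n - 1) := by
  rw [R_Icc hx]; rfl

lemma card_L {x n : ℕ} (hn : 1 ≤ n) (S : Finset ℕ) :
    (relabL x n S).card = S.card + if x ∈ S then n - 1 else 0 := by
  rw [relabL, Finset.card_biUnion]
  · have : ∀ j ∈ S, (if j < x then ({j} : Finset ℕ) else if j = x then
        Finset.Icc x (x + n - 1) else {j + n - 1}).card = 1 + if j = x then n - 1 else 0 := by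
      intro j _
      split_ifs
      all_goals first | omega | simp
      omega
    rw [Finset.sum_congr rfl this, Finset.sum_add_distrib, Finset.sum_ite_eq' S x]
    simp
  · intro a _ b _ hab
    rw [Function.onFun, Finset.disjoint_left]
    intro k hk hk'
    split_ifs at hk hk' <;> simp at hk hk' <;> omega

lemma nn_image {f : Finset ℕ → Finset ℕ} (hi : Function.Injective f)
    (hf : ∀ S T, f S ⊆ f T ↔ S ⊆ T) (F : Finset (Finset ℕ)) (S : Finset ℕ) :
    NN (F.image f) (f S) = NN F S := by
  unfold NN
  rw [Finset.filter_image, Finset.card_image_of_injective _ hi]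
  simp only [hf]

lemma ind_image {f : Finset ℕ → Finset ℕ} (hi : Function.Injective f)
    (F : Finset (Finset ℕ)) (S : Finset ℕ) :
    ind (F.image f) (f S) = ind F S := by
  unfold ind
  simp only [hi.mem_finset_image]

lemma nn_union {F G : Finset (Finset ℕ)} (h : Disjoint F G) (S : Finset ℕ) :
    NN (F ∪ G) S = NN F S + NN G S := by
  unfold NN
  rw [Finset.filter_union, Finset.card_union_of_disjoint]
  exact Finset.disjoint_filter_filter h

lemma nn_zero {F : Finset (Finset ℕ)} {S : Finset ℕ} (h : ∀ T ∈ F, ¬ T ⊆ S) : NN F S = 0 := by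
  unfold NN
  rw [Finset.card_eq_zero, Finset.filter_eq_empty_iff]
  exact fun T hT => h T hT

lemma nn_all {F : Finset (Finset ℕ)} {S : Finset ℕ} (h : ∀ T ∈ F, T ⊆ S) : NN F S = F.card := by
  unfold NN
  rw [Finset.filter_true_of_mem h]

lemma nn_sdiff (F : Finset (Finset ℕ)) (B S : Finset ℕ) :
    NN (F \ {B}) S + (if B ∈ F ∧ B ⊆ S then 1 else 0) = NN F S := by
  have : F.filter (· ⊆ S) \ {B} = (F \ {B}).filter (· ⊆ S) := by
    ext T; simp; tauto
  unfold NN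
  rw [← this, Finset.sdiff_singleton_eq_erase]
  split_ifs with h
  · rw [Finset.card_erase_add_one]; rwa [Finset.mem_filter]
  · rw [Finset.erase_eq_of_notMem (by rwa [Finset.mem_filter]), add_zero]

lemma nn_self {fam : Finset (Finset ℕ)} {I : Finset ℕ} (h : ∀ S ∈ fam, S ⊆ I) :
    NN fam I = fam.card := nn_all h

lemma rootpos {n : ℕ} {fam : Finset (Finset ℕ)} (h : Lam (Finset.Icc 1 n) fam) : 1 ≤ n := by
  have := h.ne _ h.root
  rwa [Finset.nonempty_Icc] at this

/-- L U inside R T -/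
lemma L_sub_R {x n : ℕ} (hn : 1 ≤ n) (hx : 1 ≤ x) {U T : Finset ℕ} (hU : U.Nonempty)
    (hT : T ⊆ Finset.Icc 1 n) (h : relabL x n U ⊆ relabR x T) : U = {x} ∧ T = Finset.Icc 1 n := by
  have h1 : relabL x n U ⊆ relabL x n {x} := by
    rw [L_single hn, ← R_root hx]
    exact h.trans ((R_sub hx).2 hT)
  rw [L_sub hn] at h1
  have h2 : U = {x} := (Finset.Nonempty.subset_singleton_iff hU).1 h1
  refine ⟨h2, subset_antisymm hT ?_⟩
  rw [h2, L_single hn, ← R_root hx, R_sub hx] at h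
  exact h

lemma R_sub_L {x n : ℕ} (hn : 1 ≤ n) (hx : 1 ≤ x) {S T : Finset ℕ}
    (hT : T ⊆ Finset.Icc 1 n) (hS : x ∈ S) : relabR x T ⊆ relabL x n S := by
  refine ((R_sub hx).2 hT).trans ?_
  rw [R_root hx, ← L_single hn, L_sub hn]
  simpa using hS

lemma R_disj_L {x n : ℕ} (hn : 1 ≤ n) (hx : 1 ≤ x) {S T : Finset ℕ}
    (hT : T ⊆ Finset.Icc 1 n) (hS : x ∉ S) : Disjoint (relabL x n S) (relabR x T) := by
  rw [Finset.disjoint_left]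
  intro k hk hk'
  have h1 := (R_sub hx).2 hT hk'
  rw [R_root hx, ← L_single hn, mem_relabL hn, Finset.mem_singleton] at h1
  rw [mem_relabL hn, h1] at hk
  exact hS hk

lemma cnt_mk {m n x : ℕ} {fam₁ fam₂ A₁ A₂ Q₁ Q₂ : Finset (Finset ℕ)}
    (h₁ : Lam (Finset.Icc 1 m) fam₁) (h₂ : Lam (Finset.Icc 1 n) fam₂) (hx : 1 ≤ x) (hm : x ≤ m)
    (hA₁ : A₁ ⊆ fam₁.image (relabL x n)) (hA₂ : A₂ ⊆ fam₂.image (relabR x))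
    (hd : Disjoint A₁ A₂) (hroot : relabL x n (Finset.Icc 1 m) ∈ A₁)
    (hQ₁ : Q₁ ⊆ A₁) (hQ₂ : Q₂ ⊆ A₂)
    (e₁ : ∀ S ∈ fam₁, relabL x n S ∈ A₁ →
      NN A₁ (relabL x n S) + NN A₂ (relabL x n S) + ind Q₁ (relabL x n S) =
      (relabL x n S).card + 2 * (NN Q₁ (relabL x n S) + NN Q₂ (relabL x n S)))
    (e₂ : ∀ T ∈ fam₂, relabR x T ∈ A₂ →
      NN A₁ (relabR x T) + NN A₂ (relabR x T) + ind Q₂ (relabR x T) =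
      T.card + 2 * (NN Q₁ (relabR x T) + NN Q₂ (relabR x T))) :
    Cnt (Finset.Icc 1 (m + n - 1)) (A₁ ∪ A₂) (Q₁ ∪ Q₂) := by
  have hn := rootpos h₂
  have hdQ : Disjoint Q₁ Q₂ := Finset.disjoint_of_subset_left hQ₁
    (Finset.disjoint_of_subset_right hQ₂ hd)
  have cases1 : ∀ S ∈ A₁, ∃ S' ∈ fam₁, relabL x n S' = S := fun S hS => by
    simpa using hA₁ hS
  have cases2 : ∀ S ∈ A₂, ∃ S' ∈ fam₂, relabR x S' = S := fun S hS => by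
    simpa using hA₂ hS
  have cross : ∀ S ∈ A₁, ∀ T ∈ A₂, T ⊆ S ∨ Disjoint S T := by
    intro S hS T hT
    obtain ⟨S, hS', rfl⟩ := cases1 S hS
    obtain ⟨T, hT', rfl⟩ := cases2 T hT
    by_cases hxS : x ∈ S
    · exact Or.inl (R_sub_L hn hx (h₂.sub T hT') hxS)
    · exact Or.inr (R_disj_L hn hx (h₂.sub T hT') hxS)
  have cases3 : ∀ S ∈ A₁ ∪ A₂, (∃ S' ∈ fam₁, relabL x n S' = S) ∨
      (∃ S' ∈ fam₂, relabR x S' = S) := by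
    intro S hS
    rcases Finset.mem_union.1 hS with h | h
    · exact Or.inl (cases1 S h)
    · exact Or.inr (cases2 S h)
  refine ⟨⟨?_, ?_, ?_, ?_⟩, ?_, ?_⟩
  · intro S hS
    rcases cases3 S hS with ⟨S', hS', rfl⟩ | ⟨S', hS', rfl⟩
    · obtain ⟨j, hj⟩ := h₁.ne S' hS'
      obtain ⟨k, rfl⟩ := cl_surj (x := x) hn j
      exact ⟨k, (mem_relabL hn).2 hj⟩
    · exact (h₂.ne S' hS').image _
  · intro S hS
    rw [← L_root hn hx hm]
    rcases cases3 S hS with ⟨S', hS', rfl⟩ | ⟨S', hS', rfl⟩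
    · exact (L_sub hn).2 (h₁.sub S' hS')
    · exact R_sub_L hn hx (h₂.sub S' hS') (by simp [hx, hm])
  · rw [← L_root hn hx hm]
    exact Finset.mem_union_left _ hroot
  · intro S hS T hT
    rcases Finset.mem_union.1 hS with hS | hS <;> rcases Finset.mem_union.1 hT with hT | hT
    · obtain ⟨S, hS', rfl⟩ := cases1 S hS
      obtain ⟨T, hT', rfl⟩ := cases1 T hT
      rcases h₁.lam S hS' T hT' with h | h | h
      · exact Or.inl ((L_sub hn).2 h)
      · exact Or.inr (Or.inl ((L_sub hn).2 h))
      · refine Or.inr (Or.inr ?_)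
        rw [Finset.disjoint_left] at h ⊢
        intro k hk hk'
        exact h ((mem_relabL hn).1 hk) ((mem_relabL hn).1 hk')
    · rcases cross S hS T hT with h | h
      · exact Or.inr (Or.inl h)
      · exact Or.inr (Or.inr h)
    · rcases cross T hT S hS with h | h
      · exact Or.inl h
      · exact Or.inr (Or.inr h.symm)
    · obtain ⟨S, hS', rfl⟩ := cases2 S hS
      obtain ⟨T, hT', rfl⟩ := cases2 T hT
      rcases h₂.lam S hS' T hT' with h | h | h
      · exact Or.inl ((R_sub hx).2 h)
      · exact Or.inr (Or.inl ((R_sub hx).2 h))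
      · exact Or.inr (Or.inr ((Finset.disjoint_image (R_fun_inj hx)).2 h))
  · exact Finset.union_subset_union hQ₁ hQ₂
  · intro S hS
    rw [nn_union hd, nn_union hdQ]
    rcases Finset.mem_union.1 hS with hS | hS
    · have hi : ind (Q₁ ∪ Q₂) S = ind Q₁ S := by
        have : S ∉ Q₂ := fun h => Finset.disjoint_left.1 hd hS (hQ₂ h)
        simp [ind, this]
      rw [hi]
      obtain ⟨S, hS', rfl⟩ := cases1 S hS
      exact e₁ S hS' hS
    · have hi : ind (Q₁ ∪ Q₂) S = ind Q₂ S := by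
        have : S ∉ Q₁ := fun h => Finset.disjoint_left.1 hd (hQ₁ h) hS
        simp [ind, this]
      rw [hi]
      obtain ⟨S, hS', rfl⟩ := cases2 S hS
      rw [card_R hx]
      exact e₂ S hS' hS

lemma cnt_comp {m n x : ℕ} {fam₁ fam₂ R₁ R₂ : Finset (Finset ℕ)}
    (h₁ : Cnt (Finset.Icc 1 m) fam₁ R₁) (h₂ : Cnt (Finset.Icc 1 n) fam₂ R₂)
    (hx : 1 ≤ x) (hm : x ≤ m) :
    ∃ R, Cnt (Finset.Icc 1 (m + n - 1)) (rwCompose n x fam₁ fam₂) R := by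
  have hn := rootpos h₂.toLam
  have hred := h₂.red_iff h₂.root
  have nnL : ∀ F S, NN (F.image (relabL x n)) (relabL x n S) = NN F S :=
    nn_image (L_inj hn) (fun _ _ => L_sub hn)
  have nnR : ∀ F S, NN (F.image (relabR x)) (relabR x S) = NN F S :=
    nn_image (R_inj hx) (fun _ _ => R_sub hx)
  have nnLR : ∀ F ⊆ fam₁, ∀ T ∈ fam₂, (T ≠ Finset.Icc 1 n ∨ {x} ∉ F) →
      NN (F.image (relabL x n)) (relabR x T) = 0 := by
    intro F hF T hT hc
    apply nn_zero
    intro U hU hUT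
    obtain ⟨U, hU', rfl⟩ := Finset.mem_image.1 hU
    obtain ⟨rfl, r2⟩ := L_sub_R hn hx (h₁.ne U (hF hU')) (h₂.sub T hT) hUT
    rcases hc with hc | hc
    · exact hc r2
    · exact hc hU'
  have nnRL : ∀ F ⊆ fam₂, ∀ S, NN (F.image (relabR x)) (relabL x n S) =
      if x ∈ S then F.card else 0 := by
    intro F hF S
    split_ifs with h
    · rw [nn_all, Finset.card_image_of_injective _ (R_inj hx)]
      intro T hT
      obtain ⟨T, hT', rfl⟩ := Finset.mem_image.1 hT
      exact R_sub_L hn hx (h₂.sub T (hF hT')) h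
    · apply nn_zero
      intro T hT hTS
      obtain ⟨T, hT', rfl⟩ := Finset.mem_image.1 hT
      have := R_disj_L hn hx (h₂.sub T (hF hT')) h
      obtain ⟨k, hk⟩ := (h₂.ne T (hF hT')).image (fun j => x + j - 1)
      exact Finset.disjoint_left.1 this (hTS hk) hk
  have hBR : Finset.Icc x (x + n - 1) = relabR x (Finset.Icc 1 n) := (R_root hx).symm
  have hBL : Finset.Icc x (x + n - 1) = relabL x n {x} := (L_single hn).symm
  have hinter : ∀ S, S ∈ fam₁.image (relabL x n) → S ∈ fam₂.image (relabR x) →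
      S = Finset.Icc x (x + n - 1) ∧ {x} ∈ fam₁ := by
    intro S hS hS'
    obtain ⟨U, hU, rfl⟩ := Finset.mem_image.1 hS
    obtain ⟨T, hT, hUT⟩ := Finset.mem_image.1 hS'
    obtain ⟨rfl, r2⟩ := L_sub_R hn hx (h₁.ne U hU) (h₂.sub T hT) hUT.ge
    exact ⟨hBL.symm, hU⟩
  have BsubL : ∀ S, Finset.Icc x (x + n - 1) ⊆ relabL x n S ↔ x ∈ S := by
    intro S
    rw [hBL, L_sub hn]; simp
  have Bmem2 : ∀ F : Finset (Finset ℕ), Finset.Icc x (x + n - 1) ∈ F.image (relabR x) ↔ Finset.Icc 1 n ∈ F := by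
    intro F
    rw [hBR, (R_inj hx).mem_finset_image]
  have Bmem1 : ∀ F : Finset (Finset ℕ), Finset.Icc x (x + n - 1) ∈ F.image (relabL x n) ↔ {x} ∈ F := by
    intro F
    rw [hBL, (L_inj hn).mem_finset_image]
  have BsubR : ∀ T ∈ fam₂, Finset.Icc x (x + n - 1) ⊆ relabR x T ↔ T = Finset.Icc 1 n := by
    intro T hT
    rw [hBR, R_sub hx]
    exact ⟨fun h => subset_antisymm (h₂.sub T hT) h, fun h => h.ge⟩
  have hcard2 := h₂.eq _ h₂.root
  rw [nn_all h₂.sub, nn_all (fun S hS => h₂.sub S (h₂.RF hS)), Nat.card_Icc] at hcard2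
  have hxR : {x} ∉ R₁ := by
    intro h
    have e := h₁.eq _ (h₁.RF h)
    have e3 : ({x} : Finset ℕ).card = 1 := by simp
    have e1 : NN fam₁ {x} ≤ 1 := by
      unfold NN
      rw [Finset.card_le_one]
      intro a ha b hb
      simp only [Finset.mem_filter] at ha hb
      rw [(Finset.Nonempty.subset_singleton_iff (h₁.ne a ha.1)).1 ha.2,
        (Finset.Nonempty.subset_singleton_iff (h₁.ne b hb.1)).1 hb.2]
    have e2 : 1 ≤ NN R₁ {x} := by
      unfold NN
      exact Finset.card_pos.2 ⟨{x}, by simp [h]⟩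
    have e4 : ind R₁ {x} = 1 := by simp [ind, h]
    omega
  unfold rwCompose
  simp only
  split_ifs with c1 c2 c3
  · -- R1
    subst c2
    have hr := h₁.root
    rw [Finset.mem_singleton] at hr
    have hc := congrArg Finset.card hr
    rw [Nat.card_Icc, Finset.card_singleton] at hc
    have : x = 1 := by omega
    subst this
    have hid : fam₂.image (relabR 1) = fam₂ := by
      have : relabR 1 = id := by
        funext T; ext k; simp [relabR]
      rw [this, Finset.image_id]
    rw [hid, show m + n - 1 = n by omega]
    exact ⟨R₂, h₂⟩
  · -- R3
    have hR2 : Finset.Icc 1 n ∈ R₂ := hred.1 c1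
    refine ⟨R₁.image (relabL x n) ∪ (R₂.image (relabR x) \ {Finset.Icc x (x + n - 1)}),
      cnt_mk h₁.toLam h₂.toLam hx hm Finset.sdiff_subset Finset.sdiff_subset ?_ ?_ ?_ ?_ ?_ ?_⟩
    · rw [Finset.disjoint_left]
      intro S hS hS'
      simp only [Finset.mem_sdiff, Finset.mem_singleton] at hS hS'
      exact hS.2 (hinter S hS.1 hS'.1).1
    · rw [Finset.mem_sdiff]
      refine ⟨Finset.mem_image_of_mem _ h₁.root, ?_⟩
      rw [Finset.mem_singleton, hBL]
      intro h
      have h := L_inj hn h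
      apply c2
      ext S
      rw [Finset.mem_singleton]
      constructor
      · intro hS
        have := h₁.sub S hS
        rw [h] at this
        exact (Finset.Nonempty.subset_singleton_iff (h₁.ne S hS)).1 this
      · rintro rfl
        exact c3
    · intro S hS
      rw [Finset.mem_sdiff, Finset.mem_singleton]
      refine ⟨Finset.image_subset_image h₁.RF hS, ?_⟩
      rintro rfl
      exact hxR ((Bmem1 _).1 hS)
    · exact Finset.sdiff_subset_sdiff (Finset.image_subset_image h₂.RF) subset_rfl
    · intro S hS hS'
      have d1 := nn_sdiff (fam₁.image (relabL x n)) (Finset.Icc x (x + n - 1)) (relabL x n S)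
      have d2 := nn_sdiff (fam₂.image (relabR x)) (Finset.Icc x (x + n - 1)) (relabL x n S)
      have d3 := nn_sdiff (R₂.image (relabR x)) (Finset.Icc x (x + n - 1)) (relabL x n S)
      have e := h₁.eq S hS
      simp only [nnL, BsubL, Bmem1] at d1
      simp only [nnRL _ subset_rfl, BsubL, Bmem2] at d2
      simp only [nnRL _ h₂.RF, BsubL, Bmem2] at d3
      rw [card_L hn, nnL, ind_image (L_inj hn)]
      simp only [c3, h₂.root, hR2, true_and] at d1 d2 d3
      simp only [ind, hR2, if_true] at hcard2 e ⊢
      split_ifs at * <;> omega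
    · intro T hT hT'
      have hTr : T ≠ Finset.Icc 1 n := by
        rintro rfl
        rw [← hBR] at hT'
        simp at hT'
      have d1 := nn_sdiff (fam₁.image (relabL x n)) (Finset.Icc x (x + n - 1)) (relabR x T)
      have d2 := nn_sdiff (fam₂.image (relabR x)) (Finset.Icc x (x + n - 1)) (relabR x T)
      have d3 := nn_sdiff (R₂.image (relabR x)) (Finset.Icc x (x + n - 1)) (relabR x T)
      have e := h₂.eq T hT
      have d4 : ind (R₂.image (relabR x) \ {Finset.Icc x (x + n - 1)}) (relabR x T) = ind R₂ T := by
        unfold ind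
        simp only [Finset.mem_sdiff, (R_inj hx).mem_finset_image, Finset.mem_singleton, hBR,
          (R_inj hx).eq_iff, hTr, not_false_eq_true, and_true]
      simp only [nnLR _ subset_rfl T hT (Or.inl hTr), BsubR T hT] at d1
      simp only [nnR, BsubR T hT] at d2 d3
      simp only [hTr, and_false, if_false] at d1 d2 d3
      rw [nnLR _ h₁.RF T hT (Or.inl hTr), d4]
      omega
  · -- R2
    have hR2 : Finset.Icc 1 n ∈ R₂ := hred.1 c1
    refine ⟨R₁.image (relabL x n) ∪ R₂.image (relabR x),
      cnt_mk h₁.toLam h₂.toLam hx hm subset_rfl subset_rfl ?_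
        (Finset.mem_image_of_mem _ h₁.root) (Finset.image_subset_image h₁.RF)
        (Finset.image_subset_image h₂.RF) ?_ ?_⟩
    · rw [Finset.disjoint_left]
      intro S hS hS'
      exact c3 (hinter S hS hS').2
    · intro S hS _
      have e := h₁.eq S hS
      rw [card_L hn, nnL, nnL, ind_image (L_inj hn), nnRL _ subset_rfl, nnRL _ h₂.RF]
      simp only [ind, hR2, if_true] at hcard2 e ⊢
      split_ifs at * <;> omega
    · intro T hT _
      have e := h₂.eq T hT
      rw [nnLR _ subset_rfl T hT (Or.inr c3), nnLR _ h₁.RF T hT (Or.inr hxR), nnR, nnR,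
        ind_image (R_inj hx)]
      omega
  · -- W
    have hR2 : Finset.Icc 1 n ∉ R₂ := fun h => c1 (hred.2 h)
    refine ⟨R₁.image (relabL x n) ∪ R₂.image (relabR x),
      cnt_mk h₁.toLam h₂.toLam hx hm subset_rfl Finset.sdiff_subset ?_
        (Finset.mem_image_of_mem _ h₁.root) (Finset.image_subset_image h₁.RF) ?_ ?_ ?_⟩
    · rw [Finset.disjoint_left]
      intro S hS hS'
      simp only [Finset.mem_sdiff, Finset.mem_singleton] at hS'
      exact hS'.2 (hinter S hS hS'.1).1
    · intro S hS
      rw [Finset.mem_sdiff, Finset.mem_singleton]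
      refine ⟨Finset.image_subset_image h₂.RF hS, ?_⟩
      rintro rfl
      exact hR2 ((Bmem2 _).1 hS)
    · intro S hS _
      have e := h₁.eq S hS
      have d2 := nn_sdiff (fam₂.image (relabR x)) (Finset.Icc x (x + n - 1)) (relabL x n S)
      simp only [nnRL _ subset_rfl, BsubL, Bmem2] at d2
      rw [card_L hn, nnL, nnL, ind_image (L_inj hn), nnRL _ h₂.RF]
      simp only [h₂.root, true_and] at d2
      simp only [ind, hR2, if_false] at hcard2 e ⊢
      split_ifs at * <;> omega
    · intro T hT hT'
      have hTr : T ≠ Finset.Icc 1 n := by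
        rintro rfl
        rw [← hBR] at hT'
        simp at hT'
      have e := h₂.eq T hT
      have d2 := nn_sdiff (fam₂.image (relabR x)) (Finset.Icc x (x + n - 1)) (relabR x T)
      simp only [nnR, BsubR T hT] at d2
      simp only [hTr, and_false, if_false] at d2
      rw [nnLR _ subset_rfl T hT (Or.inl hTr), nnLR _ h₁.RF T hT (Or.inl hTr), nnR,
        ind_image (R_inj hx)]
      omega

lemma lam_of_tree {n : ℕ} {fam : Finset (Finset ℕ)} (h : IsRWTree n fam) :
    Lam (Finset.Icc 1 n) fam :=
  ⟨fun S hS => (h.1 S hS).1, fun S hS => (h.1 S hS).2, h.2.1, h.2.2⟩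

lemma cnt_gen {n : ℕ} {fam : Finset (Finset ℕ)} (h : GenST n fam) :
    ∃ R, Cnt (Finset.Icc 1 n) fam R := by
  have i1 : Finset.Icc 1 1 = ({1} : Finset ℕ) := by decide
  have i2 : Finset.Icc 1 2 = ({1, 2} : Finset ℕ) := by decide
  rcases h with ⟨rfl, rfl⟩ | ⟨rfl, rfl | rfl | rfl⟩
  · refine ⟨∅, ⟨⟨?_, ?_, ?_, ?_⟩, ?_, ?_⟩⟩ <;> rw [unitT] <;> (try unfold NN ind) <;>
      (try rw [i1]) <;> decide
  · refine ⟨∅, ⟨⟨?_, ?_, ?_, ?_⟩, ?_, ?_⟩⟩ <;> rw [Tprec] <;> (try unfold NN ind) <;>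
      (try rw [i2]) <;> decide
  · refine ⟨∅, ⟨⟨?_, ?_, ?_, ?_⟩, ?_, ?_⟩⟩ <;> rw [Tsucc] <;> (try unfold NN ind) <;>
      (try rw [i2]) <;> decide
  · refine ⟨{{1, 2}}, ⟨⟨?_, ?_, ?_, ?_⟩, ?_, ?_⟩⟩ <;> rw [Tdot] <;> (try unfold NN ind) <;>
      (try rw [i2]) <;> decide

lemma cnt_closure {n : ℕ} {fam : Finset (Finset ℕ)} (h : RWClosure GenST n fam) :
    ∃ R, Cnt (Finset.Icc 1 n) fam R := by
  induction h with
  | gen h => exact cnt_gen h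
  | comp _ _ hx hm ih₁ ih₂ =>
    obtain ⟨R₁, h₁⟩ := ih₁
    obtain ⟨R₂, h₂⟩ := ih₂
    exact cnt_comp h₁ h₂ hx hm

lemma nn_filter (F : Finset (Finset ℕ)) {S C : Finset ℕ} (h : S ⊆ C) :
    NN (F.filter (· ⊆ C)) S = NN F S := by
  unfold NN
  rw [Finset.filter_filter]
  congr 1
  exact Finset.filter_congr fun T _ => ⟨fun hT => hT.2, fun hT => ⟨hT.trans h, hT⟩⟩

lemma Cnt.restrict {I : Finset ℕ} {fam R : Finset (Finset ℕ)} (h : Cnt I fam R) {C : Finset ℕ}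
    (hC : C ∈ fam) : Cnt C (fam.filter (· ⊆ C)) (R.filter (· ⊆ C)) := by
  refine ⟨⟨?_, ?_, ?_, ?_⟩, ?_, ?_⟩
  · exact fun S hS => h.ne S (Finset.mem_filter.1 hS).1
  · exact fun S hS => (Finset.mem_filter.1 hS).2
  · simp [hC]
  · exact fun S hS T hT => h.lam S (Finset.mem_filter.1 hS).1 T (Finset.mem_filter.1 hT).1
  · exact Finset.filter_subset_filter _ h.RF
  · intro S hS
    rw [Finset.mem_filter] at hS
    rw [nn_filter _ hS.2, nn_filter _ hS.2, ← h.eq S hS.1]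
    simp [ind, hS.2]

lemma cnt_translate {a d : ℕ} (ha : 1 ≤ a) (hd : 1 ≤ d) {G R : Finset (Finset ℕ)}
    (h : Cnt (Finset.Icc a (a + d - 1)) G R) (hr : IsRecursive G) :
    ∃ G₀ R₀, Cnt (Finset.Icc 1 d) G₀ R₀ ∧ IsRecursive G₀ ∧ G₀.image (relabR a) = G ∧
      (Finset.Icc 1 d ∈ R₀ ↔ Finset.Icc a (a + d - 1) ∈ R) := by
  have hpre : ∀ F ⊆ G,
      ((Finset.Icc 1 d).powerset.filter (fun S => relabR a S ∈ F)).image (relabR a) = F := by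
    intro F hF
    ext S
    simp only [Finset.mem_image, Finset.mem_filter, Finset.mem_powerset]
    constructor
    · rintro ⟨S, hS, rfl⟩; exact hS.2
    · intro hS
      have hsub := h.sub S (hF hS)
      have e : relabR a (S.image (fun k => k + 1 - a)) = S := by
        ext k
        simp only [mem_relabR, Finset.mem_image]
        constructor
        · rintro ⟨j, ⟨i, hi, rfl⟩, rfl⟩
          have := Finset.mem_Icc.1 (hsub hi)
          rwa [show a + (i + 1 - a) - 1 = i by omega]
        · intro hk
          have := Finset.mem_Icc.1 (hsub hk)
          exact ⟨_, ⟨k, hk, rfl⟩, by omega⟩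
      refine ⟨_, ⟨?_, by rwa [e]⟩, e⟩
      intro j hj
      obtain ⟨i, hi, rfl⟩ := Finset.mem_image.1 hj
      have := Finset.mem_Icc.1 (hsub hi)
      rw [Finset.mem_Icc]; omega
  obtain ⟨G₀, hG₀⟩ : ∃ G₀, G₀ = (Finset.Icc 1 d).powerset.filter (fun S => relabR a S ∈ G) :=
    ⟨_, rfl⟩
  obtain ⟨R₀, hR₀⟩ : ∃ R₀, R₀ = (Finset.Icc 1 d).powerset.filter (fun S => relabR a S ∈ R) :=
    ⟨_, rfl⟩
  have iG := hpre G subset_rfl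
  have iR := hpre R h.RF
  rw [← hG₀] at iG
  rw [← hR₀] at iR
  have mG : ∀ S, S ∈ G₀ ↔ relabR a S ∈ G := fun S => by
    rw [← iG, (R_inj ha).mem_finset_image]
  have mR : ∀ S, S ∈ R₀ ↔ relabR a S ∈ R := fun S => by
    rw [← iR, (R_inj ha).mem_finset_image]
  have sG : ∀ S ∈ G₀, S ⊆ Finset.Icc 1 d := fun S hS => by
    rw [hG₀] at hS
    simpa using (Finset.mem_filter.1 hS).1
  refine ⟨G₀, R₀, ⟨⟨?_, sG, ?_, ?_⟩, ?_, ?_⟩, ?_, iG, ?_⟩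
  · intro S hS
    have := h.ne _ ((mG S).1 hS)
    exact Finset.image_nonempty.1 this
  · rw [mG, R_root ha]; exact h.root
  · intro S hS T hT
    rcases h.lam _ ((mG S).1 hS) _ ((mG T).1 hT) with h | h | h
    · exact Or.inl ((R_sub ha).1 h)
    · exact Or.inr (Or.inl ((R_sub ha).1 h))
    · exact Or.inr (Or.inr ((Finset.disjoint_image (R_fun_inj ha)).1 h))
  · intro S hS
    exact (mG S).2 (h.RF ((mR S).1 hS))
  · intro S hS
    have e := h.eq _ ((mG S).1 hS)
    rw [card_R ha, ← iG, ← iR, nn_image (R_inj ha) (fun _ _ => R_sub ha),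
      nn_image (R_inj ha) (fun _ _ => R_sub ha), ind_image (R_inj ha)] at e
    exact e
  · intro S hS
    obtain ⟨p, q, hpq⟩ := hr _ ((mG S).1 hS)
    have hs := h.sub _ ((mG S).1 hS)
    have hne := h.ne _ ((mG S).1 hS)
    rw [hpq] at hs hne
    rw [Finset.nonempty_Icc] at hne
    have h1 := Finset.mem_Icc.1 (hs (Finset.left_mem_Icc.2 hne))
    refine ⟨p + 1 - a, q + 1 - a, R_inj ha ?_⟩
    rw [hpq, R_Icc ha]
    congr 1 <;> omega
  · rw [mR, R_root ha]

lemma nn_split {I C D : Finset ℕ} {fam F : Finset (Finset ℕ)} (hl : Lam I fam) (hF : F ⊆ fam)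
    (hC : C ⊂ I) (hD : D ⊂ I) (hCD : Disjoint C D)
    (hs : ∀ S ∈ fam, S = I ∨ S ⊆ C ∨ S ⊆ D) : NN F I = ind F I + NN F C + NN F D := by
  have h1 : F = (F.filter (· = I)) ∪ (F.filter (· ⊆ C) ∪ F.filter (· ⊆ D)) := by
    ext S
    simp only [Finset.mem_union, Finset.mem_filter]
    constructor
    · intro h
      rcases hs S (hF h) with h' | h' | h' <;> tauto
    · tauto
  have d1 : Disjoint (F.filter (· ⊆ C)) (F.filter (· ⊆ D)) := by
    rw [Finset.disjoint_left]
    intro S h1 h2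
    rw [Finset.mem_filter] at h1 h2
    obtain ⟨k, hk⟩ := hl.ne S (hF h1.1)
    exact Finset.disjoint_left.1 hCD (h1.2 hk) (h2.2 hk)
  have d2 : Disjoint (F.filter (· = I)) (F.filter (· ⊆ C) ∪ F.filter (· ⊆ D)) := by
    rw [Finset.disjoint_left]
    intro S h1 h2
    simp only [Finset.mem_union, Finset.mem_filter] at h1 h2
    obtain ⟨_, rfl⟩ := h1
    rcases h2 with h2 | h2
    · exact hC.2 h2.2
    · exact hD.2 h2.2
  rw [nn_all (fun S hS => hl.sub S (hF hS))]
  conv_lhs => rw [h1]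
  rw [Finset.card_union_of_disjoint d2, Finset.card_union_of_disjoint d1, ← add_assoc]
  unfold NN ind
  congr 2
  rw [Finset.filter_eq']
  split_ifs <;> simp

/-- the complementary tree -/
lemma Cnt.compl {I C D : Finset ℕ} {fam R : Finset (Finset ℕ)} (h : Cnt I fam R)
    (hC : C ∈ fam) (hCR : C ∉ R) (hCI : C ⊂ I) (hDI : D ⊂ I) (hCD : Disjoint C D)
    (hcard : C.card + D.card = I.card) (hDne : D.Nonempty)
    (hs : ∀ S ∈ fam, S = I ∨ S ⊆ C ∨ S ⊆ D) :
    ∃ R', Cnt D (insert D (fam.filter (· ⊆ D))) R' ∧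
      ((D ∈ fam ∧ (D ∈ R' ↔ I ∉ R)) ∨ (D ∉ fam ∧ (D ∈ R' ↔ I ∈ R))) := by
  have e1 := nn_split h.toLam subset_rfl hCI hDI hCD hs
  have e2 := nn_split h.toLam h.RF hCI hDI hCD hs
  have eI := h.eq I h.root
  have eC := h.eq C hC
  have i1 : ind fam I = 1 := by simp [ind, h.root]
  have i2 : ind R C = 0 := by simp [ind, hCR]
  by_cases hD : D ∈ fam
  · refine ⟨R.filter (· ⊆ D), ?_, Or.inl ⟨hD, ?_⟩⟩
    · rw [Finset.insert_eq_of_mem (by simp [hD])]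
      exact h.restrict hD
    · have eD := h.eq D hD
      have : ind R I + ind R D = 1 := by omega
      unfold ind at this
      simp only [Finset.mem_filter, subset_rfl, and_true]
      split_ifs at this <;> simp_all
  · have hDR : D ∉ R := fun h' => hD (h.RF h')
    have key : ∀ b : Prop, (b ↔ I ∈ R) →
        ∀ Q, (Q = if b then {D} else (∅ : Finset (Finset ℕ))) →
        Cnt D (insert D (fam.filter (· ⊆ D))) (Q ∪ R.filter (· ⊆ D)) := by
      intro b hb Q hQ
      have hQs : Q ⊆ {D} := by rw [hQ]; split_ifs <;> simp
      have dQ : Disjoint Q (R.filter (· ⊆ D)) := by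
        rw [Finset.disjoint_left]
        intro S h1 h2
        have := Finset.mem_singleton.1 (hQs h1)
        subst this
        exact hDR (Finset.mem_filter.1 h2).1
      have dF : Disjoint {D} (fam.filter (· ⊆ D)) := by
        rw [Finset.disjoint_left]
        intro S h1 h2
        have := Finset.mem_singleton.1 h1
        subst this
        exact hD (Finset.mem_filter.1 h2).1
      have subD : ∀ S ∈ insert D (fam.filter (· ⊆ D)), S ⊆ D := by
        intro S hS
        rcases Finset.mem_insert.1 hS with rfl | hS
        · exact subset_rfl
        · exact (Finset.mem_filter.1 hS).2
      refine ⟨⟨?_, subD, Finset.mem_insert_self _ _, ?_⟩, ?_, ?_⟩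
      · intro S hS
        rcases Finset.mem_insert.1 hS with rfl | hS
        · exact hDne
        · exact h.ne S (Finset.mem_filter.1 hS).1
      · intro S hS T hT
        rcases Finset.mem_insert.1 hS with rfl | hS'
        · exact Or.inr (Or.inl (subD T hT))
        · rcases Finset.mem_insert.1 hT with rfl | hT'
          · exact Or.inl (subD S hS)
          · exact h.lam S (Finset.mem_filter.1 hS').1 T (Finset.mem_filter.1 hT').1
      · rw [Finset.insert_eq]
        exact Finset.union_subset_union hQs (Finset.filter_subset_filter _ h.RF)
      · intro S hS
        have hSD := subD S hS
        rw [Finset.insert_eq, nn_union dF, nn_union dQ, nn_filter _ hSD, nn_filter _ hSD]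
        by_cases hSe : S = D
        · subst hSe
          have f1 : NN {S} S = 1 := by
            rw [nn_all (by simp)]; simp
          have f2 : ind (Q ∪ R.filter (· ⊆ S)) S = ind R I := by
            unfold ind
            have : (S ∈ Q ∪ R.filter (· ⊆ S)) ↔ I ∈ R := by
              rw [← hb, hQ]
              simp only [Finset.mem_union, Finset.mem_filter, hDR, false_and, or_false]
              split_ifs with h3 <;> simp [h3]
            simp only [this]
          have f3 : NN Q S = ind R I := by
            rw [nn_all (fun T hT => by rw [Finset.mem_singleton.1 (hQs hT)]), hQ]
            unfold ind
            simp only [hb]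
            split_ifs <;> simp
          rw [f1, f2, f3]
          omega
        · have hnot : ¬ D ⊆ S := fun h' => hSe (subset_antisymm hSD h')
          have f1 : NN {D} S = 0 := nn_zero (by simpa using hnot)
          have f3 : NN Q S = 0 := nn_zero (fun T hT => by
            rw [Finset.mem_singleton.1 (hQs hT)]; exact hnot)
          have hSQ : S ∉ Q := fun h' => hSe (Finset.mem_singleton.1 (hQs h'))
          have f2 : ind (Q ∪ R.filter (· ⊆ D)) S = ind R S := by
            simp [ind, hSQ, hSD]
          have hSf : S ∈ fam := by
            rcases Finset.mem_insert.1 hS with h' | h'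
            · exact absurd h' hSe
            · exact (Finset.mem_filter.1 h').1
          rw [f1, f2, f3]
          have := h.eq S hSf
          omega
    refine ⟨_, key (I ∈ R) Iff.rfl _ rfl, Or.inr ⟨hD, ?_⟩⟩
    simp only [Finset.mem_union, Finset.mem_filter, hDR, false_and, or_false]
    split_ifs with h3 <;> simp [h3]

lemma set_aux1 {X U : Finset (Finset ℕ)} {B : Finset ℕ} (hB : B ∈ U) :
    X ∪ {B} ∪ (U \ {B}) = X ∪ U := by
  ext S
  simp only [Finset.mem_union, Finset.mem_sdiff, Finset.mem_singleton]
  by_cases hS : S = B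
  · subst hS; tauto
  · tauto

lemma set_aux2 {X U : Finset (Finset ℕ)} {B : Finset ℕ} (hB : B ∉ X) :
    ((X ∪ {B}) \ {B}) ∪ (U \ {B}) = X ∪ (U \ {B}) := by
  ext S
  simp only [Finset.mem_union, Finset.mem_sdiff, Finset.mem_singleton]
  by_cases hS : S = B
  · subst hS; tauto
  · tauto

lemma recompose {c d x y aC : ℕ} {GC GD fam : Finset (Finset ℕ)}
    (hpos : (y = 2 ∧ x = 1 ∧ aC = d + 1) ∨ (y = 1 ∧ x = c + 1 ∧ aC = 1))
    (hc : 1 ≤ c) (hd : 1 ≤ d)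
    (kC : RWClosure GenST c GC) (kD : RWClosure GenST d GD)
    (lC : Lam (Finset.Icc 1 c) GC) (lD : Lam (Finset.Icc 1 d) GD)
    (wC : ¬ IsRed GC (Finset.Icc 1 c)) (p : Prop)
    (hfam : ((IsRed GD (Finset.Icc 1 d) ↔ ¬ p) ∧
        fam = {Finset.Icc 1 (c + d)} ∪ GC.image (relabR aC) ∪ GD.image (relabR x)) ∨
      ((IsRed GD (Finset.Icc 1 d) ↔ p) ∧ fam = {Finset.Icc 1 (c + d)} ∪ GC.image (relabR aC) ∪
        (GD.image (relabR x) \ {Finset.Icc x (x + d - 1)}))) :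
    RWClosure GenST (c + d) fam := by
  have hx : 1 ≤ x := by omega
  have hy : 1 ≤ y := by omega
  obtain ⟨G, hG, hGe⟩ : ∃ G, GenST 2 G ∧
      G = ({{1, 2}, {y}} : Finset (Finset ℕ)) ∪ (if p then {{3 - y}} else ∅) := by
    by_cases hp : p
    · refine ⟨Tdot, Or.inr ⟨rfl, Or.inr (Or.inr rfl)⟩, ?_⟩
      rcases hpos with ⟨rfl, -⟩ | ⟨rfl, -⟩ <;> simp only [hp, if_true] <;> rw [Tdot] <;> decide
    · rcases hpos with ⟨rfl, -⟩ | ⟨rfl, -⟩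
      · refine ⟨Tprec, Or.inr ⟨rfl, Or.inl rfl⟩, ?_⟩
        simp [hp, Tprec]
      · refine ⟨Tsucc, Or.inr ⟨rfl, Or.inr (Or.inl rfl)⟩, ?_⟩
        simp [hp, Tsucc]
  -- first composition
  have k1 := RWClosure.comp (RWClosure.gen hG) kC hy (show y ≤ 2 by omega)
  have r12 : relabL y c {1, 2} = Finset.Icc 1 (c + 1) := by
    have : ({1, 2} : Finset ℕ) = Finset.Icc 1 2 := by decide
    rw [this, L_root hc hy (by omega)]
    congr 1; omega
  have r3 : relabL y c {3 - y} = {x} := by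
    ext k
    rw [mem_relabL hc]
    unfold cl
    simp only [Finset.mem_singleton]
    split_ifs <;> omega
  have t1 : rwCompose c y G GC = {Finset.Icc 1 (c + 1)} ∪ GC.image (relabR y) ∪
      (if p then {{x}} else ∅) := by
    have hB : Finset.Icc y (y + c - 1) ∈ GC.image (relabR y) := by
      rw [← R_root hy]; exact Finset.mem_image_of_mem _ lC.root
    have hGi : G.image (relabL y c) = {Finset.Icc 1 (c + 1), Finset.Icc y (y + c - 1)} ∪
        (if p then {{x}} else ∅) := by
      rw [hGe, Finset.image_union, Finset.image_insert, Finset.image_singleton, r12, L_single hc]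
      congr 1
      split_ifs
      · rw [Finset.image_singleton, r3]
      · simp
    unfold rwCompose
    simp only [wC, if_false]
    rw [hGi]
    ext S
    simp only [Finset.mem_union, Finset.mem_sdiff, Finset.mem_singleton, Finset.mem_insert]
    by_cases hS : S = Finset.Icc y (y + c - 1)
    · subst hS; tauto
    · tauto
  rw [t1, show 2 + c - 1 = c + 1 by omega] at k1
  have k2 := RWClosure.comp k1 kD hx (show x ≤ c + 1 by omega)
  rw [show c + 1 + d - 1 = c + d by omega] at k2
  convert k2 using 1
  have rr : ∀ S ∈ GC, relabL x d (relabR y S) = relabR aC S := by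
    intro S hS
    have hsub := lC.sub S hS
    ext k
    rw [mem_relabL hd, mem_relabR, mem_relabR]
    unfold cl
    constructor
    · rintro ⟨j, hj, e⟩
      have := Finset.mem_Icc.1 (hsub hj)
      refine ⟨j, hj, ?_⟩
      split_ifs at e <;> omega
    · rintro ⟨j, hj, e⟩
      have := Finset.mem_Icc.1 (hsub hj)
      refine ⟨j, hj, ?_⟩
      split_ifs <;> omega
  have f1 : ({Finset.Icc 1 (c + 1)} ∪ GC.image (relabR y) ∪
      (if p then {{x}} else ∅)).image (relabL x d) = {Finset.Icc 1 (c + d)} ∪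
      GC.image (relabR aC) ∪ (if p then {Finset.Icc x (x + d - 1)} else ∅) := by
    rw [Finset.image_union, Finset.image_union, Finset.image_singleton, Finset.image_image,
      L_root hd hx (by omega), show c + 1 + d - 1 = c + d by omega]
    congr 1
    · congr 1
      exact Finset.image_congr rr
    · split_ifs
      · rw [Finset.image_singleton, L_single hd]
      · simp
  have hxGC : {x} ∉ GC.image (relabR y) := by
    intro h
    obtain ⟨S, hS, e⟩ := Finset.mem_image.1 h
    have hxS : x ∈ relabR y S := by rw [e]; simp
    obtain ⟨j, hj, e⟩ := mem_relabR.1 hxS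
    have := Finset.mem_Icc.1 (lC.sub S hS hj)
    omega
  have hBGC : Finset.Icc x (x + d - 1) ∉ GC.image (relabR aC) := by
    intro h
    obtain ⟨S, hS, e⟩ := Finset.mem_image.1 h
    have hxS : x ∈ relabR aC S := by rw [e]; simp; omega
    obtain ⟨j, hj, e⟩ := mem_relabR.1 hxS
    have := Finset.mem_Icc.1 (lC.sub S hS hj)
    omega
  have hcard1 : Finset.Icc 1 (c + 1) ≠ {x} := by
    intro h
    have := congrArg Finset.card h
    simp at this
    omega
  have hcard2 : Finset.Icc 1 (c + d) ≠ Finset.Icc x (x + d - 1) := by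
    intro h
    have := congrArg Finset.card h
    simp at this
    omega
  have hne : ({Finset.Icc 1 (c + 1)} ∪ GC.image (relabR y) ∪ (if p then {{x}} else ∅) :
      Finset (Finset ℕ)) ≠ {{x}} := by
    intro h
    have : Finset.Icc 1 (c + 1) ∈ ({{x}} : Finset (Finset ℕ)) := by
      rw [← h]; simp
    exact hcard1 (Finset.mem_singleton.1 this)
  have hmem : {x} ∈ ({Finset.Icc 1 (c + 1)} ∪ GC.image (relabR y) ∪ (if p then {{x}} else ∅) :
      Finset (Finset ℕ)) ↔ p := by
    rw [Finset.mem_union, Finset.mem_union, Finset.mem_singleton]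
    constructor
    · rintro ((h | h) | h)
      · exact absurd h.symm hcard1
      · exact absurd h hxGC
      · by_contra hp
        simp [hp] at h
    · intro hp
      simp [hp]
  have hBD : Finset.Icc x (x + d - 1) ∈ GD.image (relabR x) := by
    rw [← R_root hx]; exact Finset.mem_image_of_mem _ lD.root
  unfold rwCompose
  simp only [hne, if_false, hmem, f1]
  by_cases hp : p
  · simp only [hp, not_true_eq_false, iff_false, iff_true] at hfam
    rcases hfam with ⟨hr, rfl⟩ | ⟨hr, rfl⟩
    · simp only [hr, hp, if_true, if_false]
      exact (set_aux1 hBD).symm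
    · simp only [hr, hp, if_true]
      refine (set_aux2 ?_).symm
      rw [Finset.mem_union, Finset.mem_singleton]
      rintro (h | h)
      · exact hcard2 h.symm
      · exact hBGC h
  · simp only [hp, not_false_eq_true, iff_false, iff_true] at hfam
    rcases hfam with ⟨hr, rfl⟩ | ⟨hr, rfl⟩
    · simp [hr, hp]
    · simp [hr, hp]

lemma closure_step {n c d x y aC : ℕ} {fam R : Finset (Finset ℕ)}
    (ih : ∀ k < n, ∀ F Q, Cnt (Finset.Icc 1 k) F Q → IsRecursive F → RWClosure GenST k F)
    (h : Cnt (Finset.Icc 1 n) fam R) (hrec : IsRecursive fam)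
    (hpos : (y = 2 ∧ x = 1 ∧ aC = d + 1) ∨ (y = 1 ∧ x = c + 1 ∧ aC = 1))
    (hc : 1 ≤ c) (hd : 1 ≤ d) (hn : n = c + d)
    (hC : Finset.Icc aC (aC + c - 1) ∈ fam) (hCR : Finset.Icc aC (aC + c - 1) ∉ R)
    (hs : ∀ S ∈ fam, S = Finset.Icc 1 n ∨ S ⊆ Finset.Icc aC (aC + c - 1) ∨
      S ⊆ Finset.Icc x (x + d - 1)) : RWClosure GenST n fam := by
  have hx : 1 ≤ x := by omega
  have ha : 1 ≤ aC := by omega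
  have hCI : Finset.Icc aC (aC + c - 1) ⊂ Finset.Icc 1 n := by
    refine Finset.ssubset_iff_subset_ne.2 ⟨Finset.Icc_subset_Icc (by omega) (by omega), fun h => ?_⟩
    have := congrArg Finset.card h
    simp at this; omega
  have hDI : Finset.Icc x (x + d - 1) ⊂ Finset.Icc 1 n := by
    refine Finset.ssubset_iff_subset_ne.2 ⟨Finset.Icc_subset_Icc (by omega) (by omega), fun h => ?_⟩
    have := congrArg Finset.card h
    simp at this; omega
  have hCD : Disjoint (Finset.Icc aC (aC + c - 1)) (Finset.Icc x (x + d - 1)) := by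
    rw [Finset.disjoint_left]
    intro k h1 h2
    rw [Finset.mem_Icc] at h1 h2
    omega
  obtain ⟨R', hD, hcase⟩ := h.compl hC hCR hCI hDI hCD (by simp; omega)
    (by simp; omega) hs
  have recD : IsRecursive (insert (Finset.Icc x (x + d - 1))
      (fam.filter (· ⊆ Finset.Icc x (x + d - 1)))) := by
    intro S hS
    rcases Finset.mem_insert.1 hS with rfl | hS
    · exact ⟨_, _, rfl⟩
    · exact hrec S (Finset.mem_filter.1 hS).1
  obtain ⟨GC, RC, cC, rC, eC, wC⟩ := cnt_translate ha hc (h.restrict hC)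
    (fun S hS => hrec S (Finset.mem_filter.1 hS).1)
  obtain ⟨GD, RD, cD, rD, eD, wD⟩ := cnt_translate hx hd hD recD
  subst hn
  refine recompose hpos hc hd (ih c (by omega) _ _ cC rC) (ih d (by omega) _ _ cD rD)
    cC.toLam cD.toLam ?_ (Finset.Icc 1 (c + d) ∈ R) ?_
  · rw [cC.red_iff cC.root, wC]
    simp [hCR]
  · rw [cD.red_iff cD.root, wD, eC, eD]
    rcases hcase with ⟨hDf, hw⟩ | ⟨hDf, hw⟩
    · refine Or.inl ⟨hw, ?_⟩
      rw [Finset.insert_eq_of_mem (by simp [hDf])]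
      ext S
      simp only [Finset.mem_union, Finset.mem_filter, Finset.mem_singleton]
      constructor
      · intro hS
        rcases hs S hS with h' | h' | h' <;> tauto
      · rintro ((rfl | h') | h')
        · exact h.root
        · exact h'.1
        · exact h'.1
    · refine Or.inr ⟨hw, ?_⟩
      rw [Finset.sdiff_singleton_eq_erase, Finset.erase_insert (by simp [hDf])]
      ext S
      simp only [Finset.mem_union, Finset.mem_filter, Finset.mem_singleton]
      constructor
      · intro hS
        rcases hs S hS with h' | h' | h' <;> tauto
      · rintro ((rfl | h') | h')
        · exact h.root
        · exact h'.1
        · exact h'.1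

lemma closure_of_cnt (n : ℕ) : ∀ fam R, Cnt (Finset.Icc 1 n) fam R → IsRecursive fam →
    RWClosure GenST n fam := by
  induction n using Nat.strong_induction_on with
  | _ n ih =>
  intro fam R h hrec
  have hn := rootpos h.toLam
  by_cases hn1 : n = 1
  · subst hn1
    refine RWClosure.gen (Or.inl ⟨rfl, ?_⟩)
    have i1 : Finset.Icc 1 1 = ({1} : Finset ℕ) := by decide
    rw [i1] at h
    ext S
    rw [unitT, Finset.mem_singleton]
    constructor
    · intro hS
      exact (Finset.Nonempty.subset_singleton_iff (h.ne S hS)).1 (h.sub S hS)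
    · rintro rfl
      exact h.root
  · have loc := h.loc_eq h.root
    have hlab : ∀ k ∈ Finset.Icc 1 n, k ∈ labelsOf fam (Finset.Icc 1 n) ∨
        ∃ C ∈ childrenF fam (Finset.Icc 1 n), k ∈ C := by
      intro k hk
      by_cases h' : ∃ C ∈ childrenF fam (Finset.Icc 1 n), k ∈ C
      · exact Or.inr h'
      · left
        rw [labelsOf, Finset.mem_sdiff]
        exact ⟨hk, by simpa using h'⟩
    have hC : ∃ C ∈ childrenF fam (Finset.Icc 1 n), C ∉ R ∧ (1 ∈ C ∨ n ∈ C) := by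
      by_contra hcon
      push Not at hcon
      have hcon1 : ∀ C ∈ childrenF fam (Finset.Icc 1 n), (1 ∈ C ∨ n ∈ C) →
          C ∈ (childrenF fam (Finset.Icc 1 n)).filter (· ∈ R) := by
        intro C hC h1
        rw [Finset.mem_filter]
        refine ⟨hC, ?_⟩
        by_contra h2
        have := hcon C hC h2
        tauto
      rcases hlab 1 (by simp; omega) with h1 | ⟨C1, hC1, h1⟩ <;>
        rcases hlab n (by simp; omega) with h2 | ⟨C2, hC2, h2⟩
      · have := Finset.one_lt_card.2 ⟨1, h1, n, h2, by omega⟩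
        omega
      · have a1 := Finset.card_pos.2 ⟨1, h1⟩
        have a2 := Finset.card_pos.2 ⟨C2, hcon1 C2 hC2 (Or.inr h2)⟩
        omega
      · have a1 := Finset.card_pos.2 ⟨n, h2⟩
        have a2 := Finset.card_pos.2 ⟨C1, hcon1 C1 hC1 (Or.inl h1)⟩
        omega
      · by_cases he : C1 = C2
        · subst he
          have hm := mem_children.1 hC1
          obtain ⟨a, b, rfl⟩ := hrec C1 hm.1
          rw [Finset.mem_Icc] at h1 h2
          exact hm.2.1.2 (Finset.Icc_subset_Icc (by omega) (by omega))
        · have := Finset.one_lt_card.2 ⟨C1, hcon1 C1 hC1 (Or.inl h1), C2,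
            hcon1 C2 hC2 (Or.inr h2), he⟩
          omega
    obtain ⟨C, hC, hCR, hex⟩ := hC
    obtain ⟨hCf, hCI, hmax⟩ := mem_children.1 hC
    have hs : ∀ S ∈ fam, S = Finset.Icc 1 n ∨ S ⊆ C ∨ Disjoint S C := by
      intro S hS
      rcases h.lam S hS C hCf with h' | h' | h'
      · exact Or.inr (Or.inl h')
      · by_cases e : C = S
        · exact Or.inr (Or.inl e.ge)
        · left
          by_contra e2
          exact hmax S hS (lt_of_le_of_ne h' e) (lt_of_le_of_ne (h.sub S hS) e2)
      · exact Or.inr (Or.inr h')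
    obtain ⟨a, b, rfl⟩ := hrec C hCf
    have hab := h.ne _ hCf
    rw [Finset.nonempty_Icc] at hab
    have ma := Finset.mem_Icc.1 (hCI.1 (Finset.left_mem_Icc.2 hab))
    have mb := Finset.mem_Icc.1 (hCI.1 (Finset.right_mem_Icc.2 hab))
    have hneI : ¬ (a ≤ 1 ∧ n ≤ b) := fun h' =>
      hCI.2 (Finset.Icc_subset_Icc h'.1 h'.2)
    rw [Finset.mem_Icc, Finset.mem_Icc] at hex
    by_cases h1 : a = 1
    · subst h1
      refine closure_step (c := b) (d := n - b) (x := b + 1) (y := 1) (aC := 1) ih h hrec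
        (by omega) hab (by omega) (by omega) ?_ ?_ ?_
      · rwa [show 1 + b - 1 = b by omega]
      · rwa [show 1 + b - 1 = b by omega]
      · rw [show 1 + b - 1 = b by omega]
        intro S hS
        rcases hs S hS with h' | h' | h'
        · exact Or.inl h'
        · exact Or.inr (Or.inl h')
        · refine Or.inr (Or.inr fun k hk => ?_)
          have k1 := Finset.mem_Icc.1 (h.sub S hS hk)
          have k2 := Finset.disjoint_left.1 h' hk
          rw [Finset.mem_Icc] at k2 ⊢
          omega
    · have hb : b = n := by omega
      subst hb
      refine closure_step (c := b + 1 - a) (d := a - 1) (x := 1) (y := 2) (aC := a) ih h hrec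
        (by omega) (by omega) (by omega) (by omega) ?_ ?_ ?_
      · rwa [show a + (b + 1 - a) - 1 = b by omega]
      · rwa [show a + (b + 1 - a) - 1 = b by omega]
      · rw [show a + (b + 1 - a) - 1 = b by omega]
        intro S hS
        rcases hs S hS with h' | h' | h'
        · exact Or.inl h'
        · exact Or.inr (Or.inl h')
        · refine Or.inr (Or.inr fun k hk => ?_)
          have k1 := Finset.mem_Icc.1 (h.sub S hS hk)
          have k2 := Finset.disjoint_left.1 h' hk
          rw [Finset.mem_Icc] at k2 ⊢
          omega

/-- A recursively labelled red and white tree lies in the closure of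
`{T_≺, T_≻, T_⊙}` if and only if every node carries at most one label, no labelled node
has a red child, and no white node has two or more red children. -/
theorem bws_closure (n : ℕ) (fam : Finset (Finset ℕ))
    (h : IsRWTree n fam) (hrec : IsRecursive fam) :
    RWClosure GenST n fam ↔
      (∀ S ∈ fam, (labelsOf fam S).card ≤ 1) ∧
      (∀ S ∈ fam, (labelsOf fam S).Nonempty → ∀ T ∈ childrenF fam S, ¬ IsRed fam T) ∧
      (∀ S ∈ fam, ¬ IsRed fam S →
        ¬ 2 ≤ ((childrenF fam S).filter fun T => IsRed fam T).card) := by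
  rw [← cnt_iff_cond (lam_of_tree h)]
  exact ⟨cnt_closure, fun ⟨R, hR⟩ => closure_of_cnt n fam R hR hrec⟩
end

section
/- The map Φ is an isomorphism of symmetric operads onto its image: (i) Φ commutes with relabelling, Φ(σ·T) = σ·Φ(T) for all T ∈ BWTSL(n) and σ ∈ S_n, where σ acts on FF(n) by replacing each index i by σ(i) inside every symbol; (ii) Φ(T₁ ∘_x T₂) = Φ(T₁) ∘_x Φ(T₂) for all labelled red and white trees T₁, T₂ and every label x of T₁; and (iii) for every n, Φ(BWTSL(n)) equals the arity-n component of the smallest family of subsets of FF containing 1/[1] ∈ FF(1) and the three fractions F_≻ = 1/([1][12]), F_∘ = 1/[12], F_⊙ = 1/([1][2]) in FF(2), and closed under all compositions ∘_i and all symmetric group actions. -/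
open scoped Classical

/-- The closure of a family of generating fractions under the compositions `∘ᵢ` and the
actions of the symmetric groups (relabelling of the indices inside all symbols). -/
inductive FFSymClosure (G : ℕ → FFrac → Prop) : ℕ → FFrac → Prop
  | gen {n : ℕ} {F : FFrac} : G n F → FFSymClosure G n F
  | comp {m n i : ℕ} {F F' : FFrac} :
      FFSymClosure G m F → FFSymClosure G n F' → 1 ≤ i → i ≤ m →
      FFSymClosure G (m + n - 1) (ffCompose n i F F')
  | perm {n : ℕ} {F : FFrac} (σ : Equiv.Perm ℕ) :
      (∀ j ∉ Finset.Icc 1 n, σ j = j) → FFSymClosure G n F →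
      FFSymClosure G n (Finsupp.mapDomain (fun S => S.image fun j => σ j) F)

/-- The unit `1/[1]` together with the three fractions `F_≻ = 1/([1][12])`,
`F_∘ = 1/[12]` and `F_⊙ = 1/([1][2])`. -/
def GenFF3Sym (n : ℕ) (F : FFrac) : Prop :=
  (n = 1 ∧ F = ffUnit) ∨ (n = 2 ∧ (F = Fsucc ∨ F = Fmid ∨ F = Fdot))

namespace RW

theorem mem_childrenF {fam : Finset (Finset ℕ)} {S T : Finset ℕ} :
    T ∈ childrenF fam S ↔ T ∈ fam ∧ T ⊂ S ∧ ∀ U ∈ fam, T ⊂ U → ¬ U ⊂ S := by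
  simp [childrenF]

/-- Every member strictly below `S` lies below a child of `S`. -/
theorem exists_child {fam : Finset (Finset ℕ)} {S T : Finset ℕ} (hT : T ∈ fam) (hTS : T ⊂ S) :
    ∃ C ∈ childrenF fam S, T ⊆ C := by
  have hne : (fam.filter fun U => T ⊆ U ∧ U ⊂ S).Nonempty :=
    ⟨T, by simp [hT, hTS]⟩
  obtain ⟨C, hC, hmax⟩ := Finset.exists_max_image _ Finset.card hne
  simp only [Finset.mem_filter] at hC hmax
  refine ⟨C, mem_childrenF.2 ⟨hC.1, hC.2.2, fun U hU hCU hUS => ?_⟩, hC.2.1⟩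
  have := hmax U ⟨hU, hC.2.1.trans hCU.subset, hUS⟩
  have := Finset.card_lt_card hCU
  omega

theorem labels_empty_iff {fam : Finset (Finset ℕ)} {S : Finset ℕ} :
    labelsOf fam S = ∅ ↔ ∀ j ∈ S, ∃ C ∈ childrenF fam S, j ∈ C := by
  simp [labelsOf, Finset.sdiff_eq_empty_iff_subset, Finset.subset_iff]

theorem isRed_iff (fam : Finset (Finset ℕ)) (S : Finset ℕ) :
    IsRed fam S ↔ (∀ j ∈ S, ∃ C ∈ childrenF fam S, j ∈ C) ∧
      ∀ T ∈ childrenF fam S, ¬ IsRed fam T := by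
  rw [IsRed, labels_empty_iff]

theorem childrenF_congr {g f : Finset (Finset ℕ)} {S V : Finset ℕ} (hVg : V ∈ g) (hVf : V ∈ f)
    (hVS : V ⊂ S) (h : ∀ T, ¬ T ⊂ V → (T ∈ g ↔ T ∈ f)) : childrenF g S = childrenF f S := by
  ext T
  simp only [mem_childrenF]
  by_cases hT : T ⊂ V
  · constructor
    · rintro ⟨_, _, h3⟩
      exact absurd hVS (h3 V hVg hT)
    · rintro ⟨_, _, h3⟩
      exact absurd hVS (h3 V hVf hT)
  · rw [h T hT]
    refine and_congr_right fun _ => and_congr_right fun _ => ?_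
    constructor
    · intro h3 U hU hTU
      exact h3 U ((h U fun hUV => hT (hTU.trans hUV)).2 hU) hTU
    · intro h3 U hU hTU
      exact h3 U ((h U fun hUV => hT (hTU.trans hUV)).1 hU) hTU

theorem isRed_congr {g f : Finset (Finset ℕ)} (S : Finset ℕ)
    (h : ∀ T, T ⊂ S → (T ∈ g ↔ T ∈ f)) : IsRed g S ↔ IsRed f S := by
  induction S using Finset.strongInduction with
  | H S ih =>
    have hc : childrenF g S = childrenF f S := by
      ext T
      simp only [mem_childrenF]
      constructor
      · rintro ⟨h1, h2, h3⟩
        exact ⟨(h T h2).1 h1, h2, fun U hU hTU hUS => h3 U ((h U hUS).2 hU) hTU hUS⟩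
      · rintro ⟨h1, h2, h3⟩
        exact ⟨(h T h2).2 h1, h2, fun U hU hTU hUS => h3 U ((h U hUS).1 hU) hTU hUS⟩
    rw [isRed_iff, isRed_iff, hc]
    refine and_congr_right fun _ => forall₂_congr fun T hT => not_congr ?_
    have hTS := (mem_childrenF.1 hT).2.1
    exact ih T hTS fun U hU => h U (hU.trans hTS)

theorem not_isRed_of_label {fam : Finset (Finset ℕ)} {S : Finset ℕ} {j : ℕ} (hj : j ∈ S)
    (h : ∀ T ∈ fam, T ⊂ S → j ∉ T) : ¬ IsRed fam S := by
  rw [isRed_iff]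
  rintro ⟨h1, _⟩
  obtain ⟨C, hC, hjC⟩ := h1 j hj
  rw [mem_childrenF] at hC
  exact h C hC.1 hC.2.1 hjC

/-! ### Block relabelling -/

theorem block_subset {φ : ℕ → Finset ℕ} (hne : ∀ j, (φ j).Nonempty)
    (hd : ∀ i j, i ≠ j → Disjoint (φ i) (φ j)) (S T : Finset ℕ) :
    S.biUnion φ ⊆ T.biUnion φ ↔ S ⊆ T := by
  constructor
  · intro h j hj
    obtain ⟨a, ha⟩ := hne j
    have := h (Finset.mem_biUnion.2 ⟨j, hj, ha⟩)
    obtain ⟨k, hk, hak⟩ := Finset.mem_biUnion.1 this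
    by_cases hjk : j = k
    · exact hjk ▸ hk
    · exact absurd hak (Finset.disjoint_left.1 (hd j k hjk) ha)
  · intro h
    exact Finset.biUnion_subset_biUnion_of_subset_left _ h

theorem block_ssubset {φ : ℕ → Finset ℕ} (hne : ∀ j, (φ j).Nonempty)
    (hd : ∀ i j, i ≠ j → Disjoint (φ i) (φ j)) (S T : Finset ℕ) :
    S.biUnion φ ⊂ T.biUnion φ ↔ S ⊂ T := by
  rw [ssubset_iff_subset_not_subset, ssubset_iff_subset_not_subset,
    block_subset hne hd, block_subset hne hd]

theorem block_injective {φ : ℕ → Finset ℕ} (hne : ∀ j, (φ j).Nonempty)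
    (hd : ∀ i j, i ≠ j → Disjoint (φ i) (φ j)) :
    Function.Injective fun S : Finset ℕ => S.biUnion φ := by
  intro S T h
  exact Finset.Subset.antisymm ((block_subset hne hd S T).1 (Finset.Subset.antisymm_iff.1 h).1)
    ((block_subset hne hd T S).1 (Finset.Subset.antisymm_iff.1 h).2)

theorem block_disjoint {φ : ℕ → Finset ℕ}
    (hd : ∀ i j, i ≠ j → Disjoint (φ i) (φ j)) {S T : Finset ℕ} (h : Disjoint S T) :
    Disjoint (S.biUnion φ) (T.biUnion φ) := by
  rw [Finset.disjoint_biUnion_left]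
  intro i hi
  rw [Finset.disjoint_biUnion_right]
  intro j hj
  exact hd i j fun hij => Finset.disjoint_left.1 h hi (hij ▸ hj)

theorem block_children {φ : ℕ → Finset ℕ} (hne : ∀ j, (φ j).Nonempty)
    (hd : ∀ i j, i ≠ j → Disjoint (φ i) (φ j)) (fam : Finset (Finset ℕ)) (S : Finset ℕ) :
    childrenF (fam.image fun S => S.biUnion φ) (S.biUnion φ)
      = (childrenF fam S).image fun S => S.biUnion φ := by
  ext T
  simp only [mem_childrenF, Finset.mem_image]
  constructor
  · rintro ⟨⟨T, hT, rfl⟩, h2, h3⟩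
    refine ⟨T, ⟨hT, (block_ssubset hne hd _ _).1 h2, fun U hU hTU hUS => ?_⟩, rfl⟩
    exact h3 _ ⟨U, hU, rfl⟩ ((block_ssubset hne hd _ _).2 hTU) ((block_ssubset hne hd _ _).2 hUS)
  · rintro ⟨T, ⟨hT, h2, h3⟩, rfl⟩
    refine ⟨⟨T, hT, rfl⟩, (block_ssubset hne hd _ _).2 h2, ?_⟩
    rintro _ ⟨U, hU, rfl⟩ hTU hUS
    exact h3 U hU ((block_ssubset hne hd _ _).1 hTU) ((block_ssubset hne hd _ _).1 hUS)

theorem block_isRed {φ : ℕ → Finset ℕ} (hne : ∀ j, (φ j).Nonempty)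
    (hd : ∀ i j, i ≠ j → Disjoint (φ i) (φ j)) (fam : Finset (Finset ℕ)) (S : Finset ℕ) :
    IsRed (fam.image fun S => S.biUnion φ) (S.biUnion φ) ↔ IsRed fam S := by
  induction S using Finset.strongInduction with
  | H S ih =>
    rw [isRed_iff, isRed_iff, block_children hne hd]
    refine and_congr ?_ ?_
    · constructor
      · intro h j hj
        obtain ⟨a, ha⟩ := hne j
        obtain ⟨C, hC, haC⟩ := h a (Finset.mem_biUnion.2 ⟨j, hj, ha⟩)
        obtain ⟨C, hC', rfl⟩ := Finset.mem_image.1 hC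
        obtain ⟨k, hk, hak⟩ := Finset.mem_biUnion.1 haC
        refine ⟨C, hC', ?_⟩
        by_cases hjk : j = k
        · exact hjk ▸ hk
        · exact absurd hak (Finset.disjoint_left.1 (hd j k hjk) ha)
      · intro h a ha
        obtain ⟨j, hj, haj⟩ := Finset.mem_biUnion.1 ha
        obtain ⟨C, hC, hjC⟩ := h j hj
        exact ⟨_, Finset.mem_image_of_mem _ hC, Finset.mem_biUnion.2 ⟨j, hjC, haj⟩⟩
    · rw [Finset.forall_mem_image]
      exact forall₂_congr fun T hT => not_congr (ih T (mem_childrenF.1 hT).2.1)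

/-! ### The fraction of a family with root `A` -/

/-- Variant of `PhiT` with an arbitrary root set. -/
noncomputable def PhiA (A : Finset ℕ) (fam : Finset (Finset ℕ)) : FFrac :=
  ∑ S ∈ fam, Finsupp.single S
    (if IsRed fam S then (if S = A then 0 else 1) else (-1 : ℤ))

theorem block_PhiA {φ : ℕ → Finset ℕ} (hne : ∀ j, (φ j).Nonempty)
    (hd : ∀ i j, i ≠ j → Disjoint (φ i) (φ j)) (A : Finset ℕ) (fam : Finset (Finset ℕ)) :
    PhiA (A.biUnion φ) (fam.image fun S => S.biUnion φ)
      = Finsupp.mapDomain (fun S => S.biUnion φ) (PhiA A fam) := by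
  unfold PhiA
  rw [Finset.sum_image fun S _ T _ h => block_injective hne hd h, Finsupp.mapDomain_finsetSum]
  refine Finset.sum_congr rfl fun S _ => ?_
  rw [Finsupp.mapDomain_single]
  have : (S.biUnion φ = A.biUnion φ) ↔ S = A := (block_injective hne hd).eq_iff
  simp only [block_isRed hne hd, this]

/-- Laminar family with root `A`. -/
def Lam (A : Finset ℕ) (fam : Finset (Finset ℕ)) : Prop :=
  (∀ S ∈ fam, S.Nonempty ∧ S ⊆ A) ∧ A ∈ fam ∧
  ∀ S ∈ fam, ∀ T ∈ fam, S ⊆ T ∨ T ⊆ S ∨ Disjoint S T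

theorem block_Lam {φ : ℕ → Finset ℕ} (hne : ∀ j, (φ j).Nonempty)
    (hd : ∀ i j, i ≠ j → Disjoint (φ i) (φ j)) {A : Finset ℕ} {fam : Finset (Finset ℕ)}
    (h : Lam A fam) : Lam (A.biUnion φ) (fam.image fun S => S.biUnion φ) := by
  obtain ⟨h1, h2, h3⟩ := h
  refine ⟨?_, Finset.mem_image_of_mem _ h2, ?_⟩
  · rw [Finset.forall_mem_image]
    intro S hS
    obtain ⟨j, hj⟩ := (h1 S hS).1
    obtain ⟨a, ha⟩ := hne j
    exact ⟨⟨a, Finset.mem_biUnion.2 ⟨j, hj, ha⟩⟩, (block_subset hne hd _ _).2 (h1 S hS).2⟩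
  · rw [Finset.forall_mem_image]
    intro S hS
    rw [Finset.forall_mem_image]
    intro T hT
    rcases h3 S hS T hT with h | h | h
    · exact Or.inl ((block_subset hne hd _ _).2 h)
    · exact Or.inr (Or.inl ((block_subset hne hd _ _).2 h))
    · exact Or.inr (Or.inr (block_disjoint hd h))

/-! ### Gluing two families along a block `B` -/

/-- `g` is a family on `A`, `h` a family on `B ⊆ A`, and `B` is a block for `g`. -/
structure Glue (A B : Finset ℕ) (g h : Finset (Finset ℕ)) : Prop where
  lg : Lam A g
  lh : Lam B h
  sub : B ⊆ A
  blk : ∀ S ∈ g, B ⊆ S ∨ Disjoint S B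

theorem Glue.not_ssub {A B : Finset ℕ} {g h : Finset (Finset ℕ)} (H : Glue A B g h)
    {V T : Finset ℕ} (hV : V ∈ g) (hVT : V ⊂ T) (hT : T ⊆ B) : False := by
  obtain ⟨a, ha⟩ := (H.lg.1 V hV).1
  rcases H.blk V hV with h1 | h1
  · exact hVT.2 (hT.trans h1)
  · exact Finset.disjoint_left.1 h1 ha (hT (hVT.1 ha))

theorem Glue.of_mem {A B : Finset ℕ} {g h : Finset (Finset ℕ)} (H : Glue A B g h)
    {V : Finset ℕ} (hV : V ∈ g) {b : ℕ} (hb : b ∈ B) (hbV : b ∈ V) : B ⊆ V := by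
  rcases H.blk V hV with h1 | h1
  · exact h1
  · exact absurd hb (Finset.disjoint_left.1 h1 hbV)

theorem Glue.not_red_B {A B : Finset ℕ} {g h : Finset (Finset ℕ)} (H : Glue A B g h) :
    ¬ IsRed g B := by
  obtain ⟨b, hb⟩ := (H.lh.1 B H.lh.2.1).1
  exact not_isRed_of_label hb fun T hT hTB => (H.not_ssub hT hTB subset_rfl).elim

/-- redness inside the block -/
theorem Glue.red_h {A B : Finset ℕ} {g h f : Finset (Finset ℕ)} (H : Glue A B g h)
    (hf : ∀ V, V ∈ f → V ∈ g ∨ V ∈ h) (hf' : ∀ V ∈ h, V ⊂ B → V ∈ f) {T : Finset ℕ}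
    (hT : T ⊆ B) : IsRed f T ↔ IsRed h T := by
  refine isRed_congr T fun V hVT => ⟨fun hV => ?_, fun hV => ?_⟩
  · rcases hf V hV with h1 | h1
    · exact (H.not_ssub h1 hVT hT).elim
    · exact h1
  · exact hf' V hV (lt_of_lt_of_le hVT hT)

/-- redness outside the block: reduction to the minimal node above the block -/
theorem Glue.red_g {A B : Finset ℕ} {g h f : Finset (Finset ℕ)} (H : Glue A B g h)
    (hf : ∀ V, ¬ V ⊆ B → (V ∈ g ↔ V ∈ f))
    (base : ∀ S ∈ g, B ⊂ S → (∀ V ∈ g, B ⊂ V → ¬ V ⊂ S) →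
      (∀ V ∈ g, V ⊂ S → ¬ V ⊆ B → (IsRed g V ↔ IsRed f V)) → (IsRed g S ↔ IsRed f S))
    (S : Finset ℕ) (hS : S ∈ g) (hSB : ¬ S ⊆ B) (hne : ∀ V ∈ f, V.Nonempty) :
    IsRed g S ↔ IsRed f S := by
  induction S using Finset.strongInduction with
  | H S ih =>
    rcases H.blk S hS with h1 | h1
    · have hBS : B ⊂ S := ⟨h1, hSB⟩
      by_cases hm : ∀ V ∈ g, B ⊂ V → ¬ V ⊂ S
      · exact base S hS hBS hm fun V hV hVS hVB => ih V hVS hV hVB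
      · push Not at hm
        obtain ⟨V, hV, hBV, hVS⟩ := hm
        have hc : childrenF g S = childrenF f S :=
          childrenF_congr hV ((hf V hBV.2).1 hV) hVS fun T hT =>
            hf T fun hTB => hT (lt_of_le_of_lt hTB hBV)
        rw [isRed_iff, isRed_iff, ← hc]
        refine and_congr_right fun _ => forall₂_congr fun T hT => not_congr ?_
        obtain ⟨hT1, hT2, hT3⟩ := mem_childrenF.1 hT
        exact ih T hT2 hT1 fun hTB => hT3 V hV (lt_of_le_of_lt hTB hBV) hVS
    · refine isRed_congr S fun V hVS => ?_
      by_cases hVB : V ⊆ B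
      · have key : V.Nonempty → False := fun ⟨a, ha⟩ =>
          Finset.disjoint_left.1 h1 (hVS.1 ha) (hVB ha)
        exact ⟨fun hV => (key (H.lg.1 V hV).1).elim, fun hV => (key (hne V hV)).elim⟩
      · exact hf V hVB

/-- Case W. -/
theorem Glue.caseW {A B : Finset ℕ} {g h : Finset (Finset ℕ)} (H : Glue A B g h)
    (hB : ¬ IsRed h B) :
    PhiA A (g ∪ (h \ {B})) = Finsupp.single B 1 + PhiA A g + PhiA B h := by
  set f := g ∪ (h \ {B}) with hfdef
  have memf : ∀ V, V ∈ f ↔ V ∈ g ∨ (V ∈ h ∧ V ≠ B) := by intro V; simp [hfdef]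
  have fne : ∀ V ∈ f, V.Nonempty := by
    intro V hV
    rcases (memf V).1 hV with h1 | h1
    · exact (H.lg.1 V h1).1
    · exact (H.lh.1 V h1.1).1
  have redh : ∀ T, T ⊆ B → (IsRed f T ↔ IsRed h T) := fun T hT =>
    H.red_h (fun V hV => ((memf V).1 hV).imp id And.left)
      (fun V hV hVB => (memf V).2 (Or.inr ⟨hV, hVB.ne⟩)) hT
  have hfg : ∀ V, ¬ V ⊂ B → (V ∈ g ↔ V ∈ f) := by
    intro V hV
    rw [memf]
    refine ⟨Or.inl, ?_⟩
    rintro (h1 | ⟨h1, h2⟩)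
    · exact h1
    · exact absurd (lt_of_le_of_ne (H.lh.1 V h1).2 h2) hV
  have redg : ∀ S ∈ g, (IsRed g S ↔ IsRed f S) := by
    intro S hS
    by_cases hSB : S ⊆ B
    · have hSB' : S = B := by
        by_contra hne
        obtain ⟨a, ha⟩ := (H.lg.1 S hS).1
        exact hne (Finset.Subset.antisymm hSB (H.of_mem hS (hSB ha) ha))
      subst hSB'
      rw [redh S subset_rfl]
      exact iff_of_false H.not_red_B hB
    · refine H.red_g (fun V hV => hfg V fun h => hV h.1) ?_ S hS hSB fne
      intro S hS hBS hmin ih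
      by_cases hBg : B ∈ g
      · have hc : childrenF g S = childrenF f S :=
          childrenF_congr hBg ((memf B).2 (Or.inl hBg)) hBS hfg
        rw [isRed_iff, isRed_iff, ← hc]
        refine and_congr_right fun _ => forall₂_congr fun T hT => not_congr ?_
        obtain ⟨hT1, hT2, hT3⟩ := mem_childrenF.1 hT
        by_cases hTB : T ⊆ B
        · have : T = B := by
            by_contra hne
            exact hT3 B hBg (lt_of_le_of_ne hTB hne) hBS
          subst this
          rw [redh T subset_rfl]
          exact iff_of_false H.not_red_B hB
        · exact ih T hT1 hT2 hTB
      · have hmin' : ∀ V ∈ g, B ⊆ V → ¬ V ⊂ S := fun V hV hBV =>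
          hmin V hV (lt_of_le_of_ne hBV fun h => hBg (h ▸ hV))
        obtain ⟨b, hb⟩ := (H.lh.1 B H.lh.2.1).1
        refine iff_of_false
          (not_isRed_of_label (hBS.1 hb) fun T hT hTS hbT => hmin' T hT (H.of_mem hT hb hbT) hTS) ?_
        intro hred
        apply hB
        rw [isRed_iff] at hred ⊢
        obtain ⟨r1, r2⟩ := hred
        constructor
        · intro j hj
          obtain ⟨C, hC, hjC⟩ := r1 j (hBS.1 hj)
          obtain ⟨hC1, hC2, hC3⟩ := mem_childrenF.1 hC
          rcases (memf C).1 hC1 with h1 | ⟨h1, h2⟩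
          · exact absurd hC2 (hmin' C h1 (H.of_mem h1 hj hjC))
          · obtain ⟨D, hD, hCD⟩ := exists_child h1 (lt_of_le_of_ne (H.lh.1 C h1).2 h2)
            exact ⟨D, hD, hCD hjC⟩
        · intro T hT
          obtain ⟨hT1, hT2, hT3⟩ := mem_childrenF.1 hT
          rw [← redh T hT2.1]
          refine r2 T (mem_childrenF.2 ⟨(memf T).2 (Or.inr ⟨hT1, hT2.ne⟩), hT2.trans hBS, ?_⟩)
          intro U hU hTU hUS
          rcases (memf U).1 hU with h1 | ⟨h1, h2⟩
          · obtain ⟨t, ht⟩ := (H.lh.1 T hT1).1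
            exact hmin' U h1 (H.of_mem h1 (hT2.1 ht) (hTU.1 ht)) hUS
          · exact hT3 U h1 hTU (lt_of_le_of_ne (H.lh.1 U h1).2 h2)
  have hdisj : Disjoint g (h \ {B}) := by
    rw [Finset.disjoint_left]
    intro V hV hV'
    simp only [Finset.mem_sdiff, Finset.mem_singleton] at hV'
    obtain ⟨t, ht⟩ := (H.lg.1 V hV).1
    exact hV'.2 (Finset.Subset.antisymm (H.lh.1 V hV'.1).2
      (H.of_mem hV ((H.lh.1 V hV'.1).2 ht) ht))
  have e1 : PhiA B h = Finsupp.single B (-1) + ∑ S ∈ h \ {B}, Finsupp.single S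
    (if IsRed h S then (if S = B then 0 else 1) else (-1 : ℤ)) := by
    unfold PhiA
    rw [← Finset.sum_sdiff (Finset.singleton_subset_iff.2 H.lh.2.1), Finset.sum_singleton,
      if_neg hB, add_comm]
  have e2 : PhiA A f = PhiA A g + ∑ S ∈ h \ {B}, Finsupp.single S
    (if IsRed h S then (if S = B then 0 else 1) else (-1 : ℤ)) := by
    unfold PhiA
    rw [hfdef, Finset.sum_union hdisj, ← hfdef]
    congr 1
    · refine Finset.sum_congr rfl fun S hS => ?_
      simp only [redg S hS]
    · refine Finset.sum_congr rfl fun S hS => ?_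
      simp only [Finset.mem_sdiff, Finset.mem_singleton] at hS
      have hSB := (H.lh.1 S hS.1).2
      have hSA : S ≠ A := fun h => hS.2 (Finset.Subset.antisymm hSB (h ▸ H.sub))
      simp only [redh S hSB, hS.2, hSA]
  rw [e2, e1]
  have : (Finsupp.single B (-1 : ℤ) : FFrac) = - Finsupp.single B 1 := by
    rw [Finsupp.single_neg]
  rw [this]
  abel

/-- Case R2. -/
theorem Glue.caseR2 {A B : Finset ℕ} {g h : Finset (Finset ℕ)} (H : Glue A B g h)
    (hB : IsRed h B) (hBg : B ∉ g) :
    PhiA A (g ∪ h) = Finsupp.single B 1 + PhiA A g + PhiA B h := by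
  set f := g ∪ h with hfdef
  have memf : ∀ V, V ∈ f ↔ V ∈ g ∨ V ∈ h := by intro V; simp [hfdef]
  have fne : ∀ V ∈ f, V.Nonempty := by
    intro V hV
    rcases (memf V).1 hV with h1 | h1
    · exact (H.lg.1 V h1).1
    · exact (H.lh.1 V h1).1
  have redh : ∀ T, T ⊆ B → (IsRed f T ↔ IsRed h T) := fun T hT =>
    H.red_h (fun V hV => (memf V).1 hV) (fun V hV hVB => (memf V).2 (Or.inr hV)) hT
  have hgB : ∀ S ∈ g, ¬ S ⊆ B := by
    intro S hS hSB
    obtain ⟨a, ha⟩ := (H.lg.1 S hS).1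
    have := Finset.Subset.antisymm hSB (H.of_mem hS (hSB ha) ha)
    exact hBg (this ▸ hS)
  have hAB : B ≠ A := fun h => hBg (h ▸ H.lg.2.1)
  have hfg : ∀ V, ¬ V ⊆ B → (V ∈ g ↔ V ∈ f) := by
    intro V hV
    rw [memf]
    refine ⟨Or.inl, ?_⟩
    rintro (h1 | h1)
    · exact h1
    · exact absurd (H.lh.1 V h1).2 hV
  have redg : ∀ S ∈ g, (IsRed g S ↔ IsRed f S) := by
    intro S hS
    refine H.red_g hfg ?_ S hS (hgB S hS) fne
    intro S hS hBS hmin ih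
    have hmin' : ∀ V ∈ g, B ⊆ V → ¬ V ⊂ S := fun V hV hBV =>
      hmin V hV (lt_of_le_of_ne hBV fun h => hBg (h ▸ hV))
    obtain ⟨b, hb⟩ := (H.lh.1 B H.lh.2.1).1
    refine iff_of_false
      (not_isRed_of_label (hBS.1 hb) fun T hT hTS hbT => hmin' T hT (H.of_mem hT hb hbT) hTS) ?_
    intro hred
    rw [isRed_iff] at hred
    refine hred.2 B (mem_childrenF.2 ⟨(memf B).2 (Or.inr H.lh.2.1), hBS, ?_⟩)
      ((redh B subset_rfl).2 hB)
    intro U hU hBU hUS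
    rcases (memf U).1 hU with h1 | h1
    · exact hmin' U h1 hBU.1 hUS
    · exact hBU.2 (H.lh.1 U h1).2
  have hdisj : Disjoint g h := by
    rw [Finset.disjoint_left]
    intro V hV hV'
    exact hgB V hV (H.lh.1 V hV').2
  have e2 : PhiA A f = PhiA A g + ∑ S ∈ h, Finsupp.single S
    (if IsRed h S then 1 else (-1 : ℤ)) := by
    unfold PhiA
    rw [hfdef, Finset.sum_union hdisj, ← hfdef]
    congr 1
    · refine Finset.sum_congr rfl fun S hS => ?_
      simp only [redg S hS]
    · refine Finset.sum_congr rfl fun S hS => ?_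
      have hSB := (H.lh.1 S hS).2
      have hSA : S ≠ A := fun h => hAB (Finset.Subset.antisymm H.sub (h ▸ hSB))
      simp only [redh S hSB, hSA, if_false]
  have e1 : ∑ S ∈ h, (Finsupp.single S (if IsRed h S then 1 else (-1 : ℤ)) : FFrac)
      = Finsupp.single B 1 + PhiA B h := by
    unfold PhiA
    rw [← Finset.sum_sdiff (Finset.singleton_subset_iff.2 H.lh.2.1), Finset.sum_singleton,
      ← Finset.sum_sdiff (Finset.singleton_subset_iff.2 H.lh.2.1), Finset.sum_singleton,
      if_pos hB, if_pos hB, if_pos rfl, Finsupp.single_zero, add_zero, add_comm]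
    congr 1
    refine Finset.sum_congr rfl fun S hS => ?_
    simp only [Finset.mem_sdiff, Finset.mem_singleton] at hS
    simp only [hS.2, if_false]
  rw [e2, e1]
  abel

/-- Case R3. -/
theorem Glue.caseR3 {A B : Finset ℕ} {g h : Finset (Finset ℕ)} (H : Glue A B g h)
    (hB : IsRed h B) (hBg : B ∈ g) :
    PhiA A ((g \ {B}) ∪ (h \ {B})) = Finsupp.single B 1 + PhiA A g + PhiA B h := by
  set f := (g \ {B}) ∪ (h \ {B}) with hfdef
  have memf : ∀ V, V ∈ f ↔ (V ∈ g ∧ V ≠ B) ∨ (V ∈ h ∧ V ≠ B) := by intro V; simp [hfdef]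
  have fne : ∀ V ∈ f, V.Nonempty := by
    intro V hV
    rcases (memf V).1 hV with h1 | h1
    · exact (H.lg.1 V h1.1).1
    · exact (H.lh.1 V h1.1).1
  have redh : ∀ T, T ⊆ B → (IsRed f T ↔ IsRed h T) := fun T hT =>
    H.red_h (fun V hV => ((memf V).1 hV).imp And.left And.left)
      (fun V hV hVB => (memf V).2 (Or.inr ⟨hV, hVB.ne⟩)) hT
  have hgB : ∀ S ∈ g, S ⊆ B → S = B := by
    intro S hS hSB
    obtain ⟨a, ha⟩ := (H.lg.1 S hS).1
    exact Finset.Subset.antisymm hSB (H.of_mem hS (hSB ha) ha)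
  have hfg : ∀ V, ¬ V ⊆ B → (V ∈ g ↔ V ∈ f) := by
    intro V hV
    rw [memf]
    refine ⟨fun h => Or.inl ⟨h, fun h => hV h.subset⟩, ?_⟩
    rintro (h1 | h1)
    · exact h1.1
    · exact absurd (H.lh.1 V h1.1).2 hV
  have redg : ∀ S ∈ g, S ≠ B → (IsRed g S ↔ IsRed f S) := by
    intro S hS hSB
    refine H.red_g hfg ?_ S hS (fun h => hSB (hgB S hS h)) fne
    intro S hS hBS hmin ih
    have hBc : B ∈ childrenF g S := mem_childrenF.2 ⟨hBg, hBS, hmin⟩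
    have hrB := (isRed_iff h B).1 hB
    -- children of `S` in `f`
    have c1 : ∀ T, T ∈ childrenF f S ↔ (T ∈ childrenF g S ∧ T ≠ B) ∨ T ∈ childrenF h B := by
      intro T
      simp only [mem_childrenF]
      constructor
      · rintro ⟨h1, h2, h3⟩
        rcases (memf T).1 h1 with ⟨h4, h5⟩ | ⟨h4, h5⟩
        · refine Or.inl ⟨⟨h4, h2, fun U hU hTU hUS => ?_⟩, h5⟩
          by_cases hUB : U = B
          · exact H.not_ssub h4 hTU hUB.subset
          · exact h3 U ((memf U).2 (Or.inl ⟨hU, hUB⟩)) hTU hUS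
        · refine Or.inr ⟨h4, lt_of_le_of_ne (H.lh.1 T h4).2 h5, fun U hU hTU hUB => ?_⟩
          exact h3 U ((memf U).2 (Or.inr ⟨hU, hUB.ne⟩)) hTU (hUB.trans hBS)
      · rintro (⟨⟨h1, h2, h3⟩, h4⟩ | ⟨h1, h2, h3⟩)
        · refine ⟨(memf T).2 (Or.inl ⟨h1, h4⟩), h2, fun U hU hTU hUS => ?_⟩
          rcases (memf U).1 hU with ⟨h5, h6⟩ | ⟨h5, h6⟩
          · exact h3 U h5 hTU hUS
          · exact H.not_ssub h1 hTU (H.lh.1 U h5).2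
        · refine ⟨(memf T).2 (Or.inr ⟨h1, h2.ne⟩), h2.trans hBS, fun U hU hTU hUS => ?_⟩
          rcases (memf U).1 hU with ⟨h5, h6⟩ | ⟨h5, h6⟩
          · obtain ⟨t, ht⟩ := (H.lh.1 T h1).1
            exact hmin U h5 (lt_of_le_of_ne (H.of_mem h5 (h2.1 ht) (hTU.1 ht)) h6.symm) hUS
          · exact h3 U h5 hTU (lt_of_le_of_ne (H.lh.1 U h5).2 h6)
    rw [isRed_iff, isRed_iff]
    refine and_congr (forall₂_congr fun j hj => ?_) ?_
    · constructor
      · rintro ⟨C, hC, hjC⟩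
        by_cases hCB : C = B
        · obtain ⟨D, hD, hjD⟩ := hrB.1 j (hCB ▸ hjC)
          exact ⟨D, (c1 D).2 (Or.inr hD), hjD⟩
        · exact ⟨C, (c1 C).2 (Or.inl ⟨hC, hCB⟩), hjC⟩
      · rintro ⟨C, hC, hjC⟩
        rcases (c1 C).1 hC with h1 | h1
        · exact ⟨C, h1.1, hjC⟩
        · exact ⟨B, hBc, (mem_childrenF.1 h1).2.1.1 hjC⟩
    · constructor
      · intro h1 T hT
        rcases (c1 T).1 hT with h2 | h2
        · obtain ⟨hT1, hT2, _⟩ := mem_childrenF.1 h2.1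
          rw [← ih T hT1 hT2 fun h => h2.2 (hgB T hT1 h)]
          exact h1 T h2.1
        · rw [redh T (mem_childrenF.1 h2).2.1.1]
          exact hrB.2 T h2
      · intro h1 T hT
        by_cases hTB : T = B
        · rw [hTB]
          exact H.not_red_B
        · obtain ⟨hT1, hT2, _⟩ := mem_childrenF.1 hT
          rw [ih T hT1 hT2 fun h => hTB (hgB T hT1 h)]
          exact h1 T ((c1 T).2 (Or.inl ⟨hT, hTB⟩))
  have hdisj : Disjoint (g \ {B}) (h \ {B}) := by
    rw [Finset.disjoint_left]
    intro V hV hV'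
    simp only [Finset.mem_sdiff, Finset.mem_singleton] at hV' hV
    exact hV.2 (hgB V hV.1 (H.lh.1 V hV'.1).2)
  have e0 : PhiA A g = Finsupp.single B (-1) + ∑ S ∈ g \ {B}, Finsupp.single S
    (if IsRed g S then (if S = A then 0 else 1) else (-1 : ℤ)) := by
    unfold PhiA
    rw [← Finset.sum_sdiff (Finset.singleton_subset_iff.2 hBg), Finset.sum_singleton,
      if_neg H.not_red_B, add_comm]
  have e1 : PhiA B h = ∑ S ∈ h \ {B}, Finsupp.single S
    (if IsRed h S then (if S = B then 0 else 1) else (-1 : ℤ)) := by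
    unfold PhiA
    rw [← Finset.sum_sdiff (Finset.singleton_subset_iff.2 H.lh.2.1), Finset.sum_singleton,
      if_pos hB, if_pos rfl, Finsupp.single_zero, add_zero]
  have e2 : PhiA A f = (∑ S ∈ g \ {B}, Finsupp.single S
      (if IsRed g S then (if S = A then 0 else 1) else (-1 : ℤ)))
      + ∑ S ∈ h \ {B}, Finsupp.single S
    (if IsRed h S then (if S = B then 0 else 1) else (-1 : ℤ)) := by
    unfold PhiA
    rw [hfdef, Finset.sum_union hdisj, ← hfdef]
    congr 1
    · refine Finset.sum_congr rfl fun S hS => ?_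
      simp only [Finset.mem_sdiff, Finset.mem_singleton] at hS
      simp only [redg S hS.1 hS.2]
    · refine Finset.sum_congr rfl fun S hS => ?_
      simp only [Finset.mem_sdiff, Finset.mem_singleton] at hS
      have hSB := (H.lh.1 S hS.1).2
      have hSA : S ≠ A := fun h => hS.2 (Finset.Subset.antisymm hSB (h ▸ H.sub))
      simp only [redh S hSB, hS.2, hSA]
  rw [e2, e1, e0]
  have : (Finsupp.single B (-1 : ℤ) : FFrac) = - Finsupp.single B 1 := by
    rw [Finsupp.single_neg]
  rw [this]
  abel

/-- Any family between the members outside the block and all members is laminar. -/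
theorem Glue.lam {A B : Finset ℕ} {g h f : Finset (Finset ℕ)} (H : Glue A B g h)
    (hf : ∀ V ∈ f, V ∈ g ∨ V ∈ h) (hA : A ∈ f) : Lam A f := by
  refine ⟨fun V hV => ?_, hA, fun S hS T hT => ?_⟩
  · rcases hf V hV with h1 | h1
    · exact H.lg.1 V h1
    · exact ⟨(H.lh.1 V h1).1, (H.lh.1 V h1).2.trans H.sub⟩
  · rcases hf S hS with h1 | h1 <;> rcases hf T hT with h2 | h2
    · exact H.lg.2.2 S h1 T h2
    · rcases H.blk S h1 with h3 | h3
      · exact Or.inr (Or.inl ((H.lh.1 T h2).2.trans h3))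
      · exact Or.inr (Or.inr (Finset.disjoint_of_subset_right (H.lh.1 T h2).2 h3))
    · rcases H.blk T h2 with h3 | h3
      · exact Or.inl ((H.lh.1 S h1).2.trans h3)
      · exact Or.inr (Or.inr (Finset.disjoint_of_subset_right (H.lh.1 S h1).2 h3).symm)
    · exact H.lh.2.2 S h1 T h2

/-! ### The concrete relabellings -/

/-- blocks of the left relabelling -/
def blkL (x n : ℕ) (j : ℕ) : Finset ℕ :=
  if j < x then {j} else if j = x then Finset.Icc x (x + n - 1) else {j + n - 1}

/-- blocks of the right relabelling -/
def blkR (x : ℕ) (j : ℕ) : Finset ℕ := {x + j - 1}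

theorem mem_blkL {x n j a : ℕ} (hn : 1 ≤ n) : a ∈ blkL x n j ↔
    (j < x ∧ a = j) ∨ (j = x ∧ x ≤ a ∧ a ≤ x + n - 1) ∨ (x < j ∧ a = j + n - 1) := by
  unfold blkL
  split_ifs with h1 h2
  · simp only [Finset.mem_singleton]; omega
  · simp only [Finset.mem_Icc]; omega
  · simp only [Finset.mem_singleton]; omega

theorem blkL_ne {x n : ℕ} (hn : 1 ≤ n) (j : ℕ) : (blkL x n j).Nonempty := by
  rcases lt_trichotomy j x with h | h | h
  · exact ⟨j, (mem_blkL hn).2 (Or.inl ⟨h, rfl⟩)⟩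
  · exact ⟨x, (mem_blkL hn).2 (by omega)⟩
  · exact ⟨j + n - 1, (mem_blkL hn).2 (by omega)⟩

theorem blkL_disj {x n : ℕ} (hn : 1 ≤ n) (i j : ℕ) (hij : i ≠ j) :
    Disjoint (blkL x n i) (blkL x n j) := by
  rw [Finset.disjoint_left]
  intro a h1 h2
  rw [mem_blkL hn] at h1 h2
  omega

theorem blkR_ne {x : ℕ} (j : ℕ) : (blkR x j).Nonempty := Finset.singleton_nonempty _

theorem blkR_disj {x : ℕ} (hx : 1 ≤ x) (i j : ℕ) (hij : i ≠ j) :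
    Disjoint (blkR x i) (blkR x j) := by
  simp only [blkR, Finset.disjoint_singleton]
  omega

theorem relabL_eq (x n : ℕ) : relabL x n = fun S => S.biUnion (blkL x n) := rfl

theorem subSym_eq (x n : ℕ) : subSym x n = fun S => S.biUnion (blkL x n) := rfl

theorem relabR_eq (x : ℕ) : relabR x = fun S => S.biUnion (blkR x) := by
  funext S
  ext a
  simp [relabR, blkR, eq_comm]

theorem shiftSym_eq (x : ℕ) : shiftSym x = fun S => S.biUnion (blkR x) := relabR_eq x

theorem perm_eq (σ : Equiv.Perm ℕ) :
    (fun S : Finset ℕ => S.image fun j => σ j) = fun S => S.biUnion fun j => {σ j} := by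
  funext S
  ext a
  simp [eq_comm]

theorem perm_ne (σ : Equiv.Perm ℕ) (j : ℕ) : ({σ j} : Finset ℕ).Nonempty :=
  Finset.singleton_nonempty _

theorem perm_disj (σ : Equiv.Perm ℕ) (i j : ℕ) (hij : i ≠ j) :
    Disjoint ({σ i} : Finset ℕ) {σ j} := by
  simpa using hij

theorem PhiT_eq (n : ℕ) (fam : Finset (Finset ℕ)) : PhiT n fam = PhiA (Finset.Icc 1 n) fam := rfl

theorem isRWTree_eq (n : ℕ) (fam : Finset (Finset ℕ)) :
    IsRWTree n fam = Lam (Finset.Icc 1 n) fam := rfl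

theorem tree_pos {n : ℕ} {fam : Finset (Finset ℕ)} (h : IsRWTree n fam) : 1 ≤ n := by
  have := (h.1 _ h.2.1).1
  rwa [Finset.nonempty_Icc] at this

theorem perm_root {n : ℕ} (σ : Equiv.Perm ℕ) (hσ : ∀ j ∉ Finset.Icc 1 n, σ j = j) :
    (Finset.Icc 1 n).biUnion (fun j => {σ j}) = Finset.Icc 1 n := by
  have key : ∀ j, σ j ∈ Finset.Icc 1 n ↔ j ∈ Finset.Icc 1 n := by
    intro j
    constructor
    · intro h
      by_contra hj
      rw [hσ j hj] at h
      exact hj h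
    · intro h
      by_contra hj
      have := σ.injective (hσ _ hj)
      rw [this] at hj
      exact hj h
  ext a
  simp only [Finset.mem_biUnion, Finset.mem_singleton]
  constructor
  · rintro ⟨j, hj, rfl⟩
    exact (key j).2 hj
  · intro ha
    exact ⟨σ.symm a, (key _).1 (by simpa using ha), by simp⟩

theorem perm_PhiT {n : ℕ} (fam : Finset (Finset ℕ)) (σ : Equiv.Perm ℕ)
    (hσ : ∀ j ∉ Finset.Icc 1 n, σ j = j) :
    PhiT n (fam.image fun S => S.image fun j => σ j)
      = Finsupp.mapDomain (fun S => S.image fun j => σ j) (PhiT n fam) := by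
  rw [perm_eq, PhiT_eq, PhiT_eq, ← block_PhiA (perm_ne σ) (perm_disj σ), perm_root σ hσ]

theorem perm_tree {n : ℕ} {fam : Finset (Finset ℕ)} (σ : Equiv.Perm ℕ)
    (hσ : ∀ j ∉ Finset.Icc 1 n, σ j = j) (h : IsRWTree n fam) :
    IsRWTree n (fam.image fun S => S.image fun j => σ j) := by
  rw [isRWTree_eq] at h ⊢
  have := block_Lam (perm_ne σ) (perm_disj σ) h
  rwa [perm_root σ hσ, ← perm_eq] at this

theorem L_root {m n x : ℕ} (hn : 1 ≤ n) (hx : 1 ≤ x) (hxm : x ≤ m) :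
    (Finset.Icc 1 m).biUnion (blkL x n) = Finset.Icc 1 (m + n - 1) := by
  ext a
  simp only [Finset.mem_biUnion, mem_blkL hn, Finset.mem_Icc]
  constructor
  · rintro ⟨j, hj, h⟩
    omega
  · intro h
    rcases lt_or_ge a x with h1 | h1
    · exact ⟨a, by omega⟩
    · rcases le_or_gt a (x + n - 1) with h2 | h2
      · exact ⟨x, by omega⟩
      · exact ⟨a + 1 - n, by omega⟩

theorem R_root {n x : ℕ} (hn : 1 ≤ n) (hx : 1 ≤ x) :
    (Finset.Icc 1 n).biUnion (blkR x) = Finset.Icc x (x + n - 1) := by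
  ext a
  simp only [Finset.mem_biUnion, blkR, Finset.mem_singleton, Finset.mem_Icc]
  constructor
  · rintro ⟨j, hj, h⟩
    omega
  · intro h
    exact ⟨a + 1 - x, by omega⟩

theorem L_single (x n : ℕ) : ({x} : Finset ℕ).biUnion (blkL x n) = Finset.Icc x (x + n - 1) := by
  simp [blkL]

theorem relabL_single (x n : ℕ) : relabL x n {x} = Finset.Icc x (x + n - 1) := L_single x n

theorem glue {m n x : ℕ} {fam₁ fam₂ : Finset (Finset ℕ)} (h₁ : IsRWTree m fam₁)
    (h₂ : IsRWTree n fam₂) (hx : 1 ≤ x) (hxm : x ≤ m) :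
    Glue (Finset.Icc 1 (m + n - 1)) (Finset.Icc x (x + n - 1))
      (fam₁.image (relabL x n)) (fam₂.image (relabR x)) := by
  have hn := tree_pos h₂
  refine ⟨?_, ?_, ?_, ?_⟩
  · rw [← L_root hn hx hxm, relabL_eq]
    exact block_Lam (blkL_ne hn) (blkL_disj hn) h₁
  · rw [← R_root hn hx, relabR_eq]
    exact block_Lam blkR_ne (blkR_disj hx) h₂
  · intro a
    simp only [Finset.mem_Icc]
    omega
  · rw [Finset.forall_mem_image]
    intro S _
    rw [← L_single, relabL_eq]
    by_cases hxS : x ∈ S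
    · exact Or.inl ((block_subset (blkL_ne hn) (blkL_disj hn) _ _).2 (by simpa using hxS))
    · exact Or.inr (block_disjoint (blkL_disj hn) (by simpa using hxS))

theorem B_mem {n x : ℕ} (hn : 1 ≤ n) (fam₁ : Finset (Finset ℕ)) :
    Finset.Icc x (x + n - 1) ∈ fam₁.image (relabL x n) ↔ {x} ∈ fam₁ := by
  rw [relabL_eq, ← L_single]
  exact (block_injective (blkL_ne hn) (blkL_disj hn)).mem_finset_image

theorem red_R {n x : ℕ} (hn : 1 ≤ n) (hx : 1 ≤ x) (fam₂ : Finset (Finset ℕ)) :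
    IsRed (fam₂.image (relabR x)) (Finset.Icc x (x + n - 1)) ↔ IsRed fam₂ (Finset.Icc 1 n) := by
  rw [relabR_eq, ← R_root hn hx]
  exact block_isRed blkR_ne (blkR_disj hx) _ _

theorem single_arity {m x : ℕ} (h₁ : IsRWTree m {{x}}) : m = 1 ∧ x = 1 := by
  have hm := tree_pos h₁
  have h := h₁.2.1
  rw [Finset.mem_singleton] at h
  have h1 : (1 : ℕ) ∈ ({x} : Finset ℕ) := h ▸ Finset.mem_Icc.2 ⟨le_rfl, hm⟩
  have h2 : m ∈ ({x} : Finset ℕ) := h ▸ Finset.mem_Icc.2 ⟨hm, le_rfl⟩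
  simp only [Finset.mem_singleton] at h1 h2
  omega

theorem comp_PhiT {m n x : ℕ} {fam₁ fam₂ : Finset (Finset ℕ)} (h₁ : IsRWTree m fam₁)
    (h₂ : IsRWTree n fam₂) (hx : 1 ≤ x) (hxm : x ≤ m) :
    PhiT (m + n - 1) (rwCompose n x fam₁ fam₂)
          = ffCompose n x (PhiT m fam₁) (PhiT n fam₂) := by
  have H := glue h₁ h₂ hx hxm
  have hn := tree_pos h₂
  have e1 : Finsupp.mapDomain (subSym x n) (PhiT m fam₁)
      = PhiA (Finset.Icc 1 (m + n - 1)) (fam₁.image (relabL x n)) := by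
    rw [subSym_eq, PhiT_eq, ← block_PhiA (blkL_ne hn) (blkL_disj hn), L_root hn hx hxm, relabL_eq]
  have e2 : Finsupp.mapDomain (shiftSym x) (PhiT n fam₂)
      = PhiA (Finset.Icc x (x + n - 1)) (fam₂.image (relabR x)) := by
    rw [shiftSym_eq, PhiT_eq, ← block_PhiA blkR_ne (blkR_disj hx), R_root hn hx, relabR_eq]
  rw [ffCompose, e1, e2, PhiT_eq, rwCompose]
  split_ifs with hr hs ht
  · subst hs
    obtain ⟨rfl, rfl⟩ := single_arity h₁
    have hs : PhiA (Finset.Icc 1 (1 + n - 1)) (({{1}} : Finset (Finset ℕ)).image (relabL 1 n))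
        = Finsupp.single (Finset.Icc 1 (1 + n - 1)) (-1) := by
      have hnr := H.not_red_B
      rw [Finset.image_singleton, relabL_single] at hnr ⊢
      rw [PhiA, Finset.sum_singleton, if_neg hnr]
    rw [hs, ← Finsupp.single_add]
    simp
  · exact H.caseR3 ((red_R hn hx fam₂).2 hr) ((B_mem hn fam₁).2 ht)
  · exact H.caseR2 ((red_R hn hx fam₂).2 hr) fun h => ht ((B_mem hn fam₁).1 h)
  · exact H.caseW fun h => hr ((red_R hn hx fam₂).1 h)

theorem comp_tree {m n x : ℕ} {fam₁ fam₂ : Finset (Finset ℕ)} (h₁ : IsRWTree m fam₁)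
    (h₂ : IsRWTree n fam₂) (hx : 1 ≤ x) (hxm : x ≤ m) :
    IsRWTree (m + n - 1) (rwCompose n x fam₁ fam₂) := by
  have H := glue h₁ h₂ hx hxm
  have hn := tree_pos h₂
  rw [isRWTree_eq, rwCompose]
  split_ifs with hr hs ht
  · subst hs
    obtain ⟨rfl, rfl⟩ := single_arity h₁
    exact H.lh
  · refine H.lam (fun V hV => ?_) ?_
    · simp only [Finset.mem_union, Finset.mem_sdiff] at hV
      tauto
    · refine Finset.mem_union_left _ (Finset.mem_sdiff.2 ⟨H.lg.2.1, ?_⟩)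
      rw [Finset.mem_singleton]
      intro hAB
      apply hs
      have hm : m = 1 := by
        have h1 : (1 : ℕ) ∈ Finset.Icc 1 (m + n - 1) := Finset.mem_Icc.2 (by omega)
        have h2 : m + n - 1 ∈ Finset.Icc 1 (m + n - 1) := Finset.mem_Icc.2 (by omega)
        rw [hAB, Finset.mem_Icc] at h1 h2
        omega
      subst hm
      obtain rfl : x = 1 := by omega
      refine Finset.Subset.antisymm (fun V hV => ?_) (by simpa using ht)
      have := h₁.1 V hV
      rw [Finset.Icc_self, Finset.Nonempty.subset_singleton_iff this.1] at this
      simpa using this.2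
  · exact H.lam (fun V hV => Finset.mem_union.1 hV) (Finset.mem_union_left _ H.lg.2.1)
  · refine H.lam (fun V hV => ?_) (Finset.mem_union_left _ H.lg.2.1)
    simp only [Finset.mem_union, Finset.mem_sdiff] at hV
    tauto

/-! ### Generators -/

theorem Icc12 : Finset.Icc 1 2 = ({1, 2} : Finset ℕ) := by decide

theorem unit_tree : IsRWTree 1 unitT := by
  refine ⟨?_, ?_, ?_⟩ <;> simp [unitT]

theorem succ_tree : IsRWTree 2 Tsucc := by
  rw [IsRWTree, Icc12]; refine ⟨?_, ?_, ?_⟩ <;> simp [Tsucc]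

theorem mid_tree : IsRWTree 2 Tmid := by
  rw [IsRWTree, Icc12]; refine ⟨?_, ?_, ?_⟩ <;> simp [Tmid]

theorem dot_tree : IsRWTree 2 Tdot := by
  rw [IsRWTree, Icc12]; refine ⟨?_, ?_, ?_⟩ <;> simp [Tdot]

theorem not_red_single {fam : Finset (Finset ℕ)} (j : ℕ) : ¬ IsRed fam {j} := by
  refine not_isRed_of_label (j := j) (by simp) fun T _ hT hj => ?_
  exact hT.2 (by simpa using hj)

theorem Phi_unit : PhiT 1 unitT = ffUnit := by
  simp [PhiT, unitT, ffUnit, not_red_single]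

theorem not_red_mid : ¬ IsRed Tmid {1, 2} := by
  refine not_isRed_of_label (j := 1) (by simp) fun T hT hT' _ => ?_
  rw [Tmid, Finset.mem_singleton] at hT
  exact hT'.ne hT

theorem Phi_mid : PhiT 2 Tmid = Fmid := by
  have := not_red_mid
  rw [PhiT, Fmid]
  conv_lhs => rw [Tmid]
  rw [Finset.sum_singleton, ← Tmid, if_neg this]

theorem not_red_succ : ¬ IsRed Tsucc {1, 2} := by
  refine not_isRed_of_label (j := 2) (by simp) fun T hT hT' h2 => ?_
  simp only [Tsucc, Finset.mem_insert, Finset.mem_singleton] at hT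
  rcases hT with rfl | rfl
  · exact hT'.ne rfl
  · simp at h2

theorem ne12_1 : ({1, 2} : Finset ℕ) ≠ {1} := by decide

theorem ne12_2 : ({1, 2} : Finset ℕ) ≠ {2} := by decide

theorem Phi_succ : PhiT 2 Tsucc = Fsucc := by
  have h1 := not_red_succ
  have h2 : ¬ IsRed Tsucc {1} := not_red_single 1
  unfold PhiT Fsucc
  rw [show (∑ S ∈ Tsucc, (Finsupp.single S (if IsRed Tsucc S then
      (if S = Finset.Icc 1 2 then 0 else 1) else (-1 : ℤ)) : FFrac)) = _ from
      Finset.sum_insert (by simpa using ne12_1), Finset.sum_singleton, if_neg h1, if_neg h2,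
      add_comm]

theorem red_dot : IsRed Tdot {1, 2} := by
  have hc : ∀ T, T ∈ childrenF Tdot {1, 2} ↔ T = {1} ∨ T = {2} := by
    intro T
    have : childrenF Tdot {1, 2} = {{1}, {2}} := by decide
    rw [this]
    simp
  rw [isRed_iff]
  constructor
  · intro j hj
    simp only [Finset.mem_insert, Finset.mem_singleton] at hj
    rcases hj with rfl | rfl
    · exact ⟨{1}, (hc _).2 (Or.inl rfl), by simp⟩
    · exact ⟨{2}, (hc _).2 (Or.inr rfl), by simp⟩
  · intro T hT
    rcases (hc T).1 hT with rfl | rfl <;> exact not_red_single _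

theorem Phi_dot : PhiT 2 Tdot = Fdot := by
  have h1 := red_dot
  have h2 : ¬ IsRed Tdot {1} := not_red_single 1
  have h3 : ¬ IsRed Tdot {2} := not_red_single 2
  unfold PhiT Fdot
  rw [show (∑ S ∈ Tdot, (Finsupp.single S (if IsRed Tdot S then
      (if S = Finset.Icc 1 2 then 0 else 1) else (-1 : ℤ)) : FFrac)) = _ from
      Finset.sum_insert (by
        simp only [Finset.mem_insert, Finset.mem_singleton, not_or]
        exact ⟨ne12_1, ne12_2⟩),
      Finset.sum_insert (by simp), Finset.sum_singleton, if_pos h1, if_neg h2,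
      if_neg h3, if_pos Icc12.symm, Finsupp.single_zero, zero_add]

theorem closure_image {n : ℕ} {F : FFrac} (h : FFSymClosure GenFF3Sym n F) :
    ∃ fam, IsRWTree n fam ∧ PhiT n fam = F := by
  induction h with
  | gen h =>
    rcases h with ⟨rfl, rfl⟩ | ⟨rfl, rfl | rfl | rfl⟩
    · exact ⟨_, unit_tree, Phi_unit⟩
    · exact ⟨_, succ_tree, Phi_succ⟩
    · exact ⟨_, mid_tree, Phi_mid⟩
    · exact ⟨_, dot_tree, Phi_dot⟩
  | comp _ _ hi him ih₁ ih₂ =>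
    obtain ⟨f₁, h₁, rfl⟩ := ih₁
    obtain ⟨f₂, h₂, rfl⟩ := ih₂
    exact ⟨_, comp_tree h₁ h₂ hi him, comp_PhiT h₁ h₂ hi him⟩
  | perm σ hσ _ ih =>
    obtain ⟨f, hf, rfl⟩ := ih
    exact ⟨_, perm_tree σ hσ hf, perm_PhiT f σ hσ⟩

/-! ### Every tree is generated -/

theorem exists_pair {n : ℕ} (hn : 2 ≤ n) {fam : Finset (Finset ℕ)} (h : IsRWTree n fam) :
    ∃ a ∈ Finset.Icc 1 n, ∃ b ∈ Finset.Icc 1 n, a ≠ b ∧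
      (∀ S ∈ fam, S ≠ {a} → S ≠ {b} → (a ∈ S ↔ b ∈ S)) ∧ ({b} ∈ fam → {a} ∈ fam) := by
  have hne : (fam.filter fun S => 1 < S.card).Nonempty :=
    ⟨Finset.Icc 1 n, by simp [h.2.1]; omega⟩
  obtain ⟨S, hS, hmin⟩ := Finset.exists_min_image _ Finset.card hne
  simp only [Finset.mem_filter] at hS hmin
  obtain ⟨a, ha, b, hb, hab⟩ := Finset.one_lt_card.1 hS.2
  have hsub := (h.1 S hS.1).2
  have key : ∀ a b, a ∈ S → b ∈ S → ∀ U ∈ fam, U ≠ {a} → U ≠ {b} → (a ∈ U → b ∈ U) := by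
    intro a b ha hb U hU hUa hUb haU
    rcases h.2.2 U hU S hS.1 with h1 | h1 | h1
    · by_cases hc : 1 < U.card
      · have := Finset.eq_of_subset_of_card_le h1 (hmin U ⟨hU, hc⟩)
        rw [this]
        exact hb
      · exfalso
        apply hUa
        have hc1 : U.card = 1 := by
          have := Finset.card_pos.2 ⟨a, haU⟩
          omega
        obtain ⟨c, rfl⟩ := Finset.card_eq_one.1 hc1
        rw [Finset.mem_singleton] at haU
        rw [haU]
    · exact h1 hb
    · exact absurd ha (Finset.disjoint_left.1 h1 haU)
  by_cases hbf : {b} ∈ fam → {a} ∈ fam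
  · exact ⟨a, hsub ha, b, hsub hb, hab, fun U hU h1 h2 =>
      ⟨key a b ha hb U hU h1 h2, key b a hb ha U hU h2 h1⟩, hbf⟩
  · exact ⟨b, hsub hb, a, hsub ha, hab.symm, fun U hU h1 h2 =>
      ⟨key b a hb ha U hU h1 h2, key a b ha hb U hU h2 h1⟩, by tauto⟩

theorem exists_perm {k a b : ℕ} (hk : 1 ≤ k) (ha : a ∈ Finset.Icc 1 (k + 1))
    (hb : b ∈ Finset.Icc 1 (k + 1)) (hab : a ≠ b) :
    ∃ σ : Equiv.Perm ℕ, (∀ j ∉ Finset.Icc 1 (k + 1), σ j = j) ∧ σ a = k ∧ σ b = k + 1 := by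
  rw [Finset.mem_Icc] at ha hb
  refine ⟨(Equiv.swap a k).trans (Equiv.swap (Equiv.swap a k b) (k + 1)), ?_, ?_, ?_⟩
  · intro j hj
    rw [Finset.mem_Icc] at hj
    simp only [Equiv.trans_apply, Equiv.swap_apply_def]
    split_ifs <;> omega
  · simp only [Equiv.trans_apply, Equiv.swap_apply_def]
    split_ifs <;> omega
  · simp only [Equiv.trans_apply, Equiv.swap_apply_def]
    split_ifs <;> omega

theorem relabL_erase {k : ℕ} {S : Finset ℕ} (hS : S ⊆ Finset.Icc 1 (k + 1))
    (h : k ∈ S ↔ k + 1 ∈ S) : relabL k 2 (S.erase (k + 1)) = S := by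
  rw [relabL_eq]
  ext a
  simp only [Finset.mem_biUnion, mem_blkL one_le_two, Finset.mem_erase]
  constructor
  · rintro ⟨j, ⟨hj1, hj2⟩, h1⟩
    have := Finset.mem_Icc.1 (hS hj2)
    rcases h1 with ⟨_, rfl⟩ | ⟨rfl, h2, h3⟩ | h1
    · exact hj2
    · obtain rfl | rfl : a = j ∨ a = j + 1 := by omega
      · exact hj2
      · exact h.1 hj2
    · omega
  · intro ha
    have := Finset.mem_Icc.1 (hS ha)
    by_cases hak : a = k + 1
    · subst hak
      exact ⟨k, ⟨by omega, h.2 ha⟩, by omega⟩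
    · exact ⟨a, ⟨hak, ha⟩, by omega⟩

/-- contraction of the labels `k`, `k+1` -/
def contr (k : ℕ) (D : Finset (Finset ℕ)) : Finset (Finset ℕ) := D.image fun S => S.erase (k + 1)

theorem contr_image {k : ℕ} {D : Finset (Finset ℕ)}
    (hD : ∀ S ∈ D, S ⊆ Finset.Icc 1 (k + 1) ∧ (k ∈ S ↔ k + 1 ∈ S)) :
    (contr k D).image (relabL k 2) = D := by
  rw [contr, Finset.image_image]
  conv_rhs => rw [← Finset.image_id (s := D)]
  refine Finset.image_congr fun S hS => ?_
  exact relabL_erase (hD S hS).1 (hD S hS).2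

theorem contr_tree {k : ℕ} {D : Finset (Finset ℕ)}
    (hD : ∀ S ∈ D, S.Nonempty ∧ S ⊆ Finset.Icc 1 (k + 1) ∧ (k ∈ S ↔ k + 1 ∈ S))
    (hroot : Finset.Icc 1 (k + 1) ∈ D)
    (hlam : ∀ S ∈ D, ∀ T ∈ D, S ⊆ T ∨ T ⊆ S ∨ Disjoint S T) : IsRWTree k (contr k D) := by
  refine ⟨?_, ?_, ?_⟩
  · rw [contr, Finset.forall_mem_image]
    intro S hS
    obtain ⟨⟨a, ha⟩, h2, h3⟩ := hD S hS
    constructor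
    · by_cases hak : a = k + 1
      · exact ⟨k, Finset.mem_erase.2 ⟨by omega, h3.2 (hak ▸ ha)⟩⟩
      · exact ⟨a, Finset.mem_erase.2 ⟨hak, ha⟩⟩
    · intro b hb
      rw [Finset.mem_erase] at hb
      have := Finset.mem_Icc.1 (h2 hb.2)
      rw [Finset.mem_Icc]
      omega
  · refine Finset.mem_image.2 ⟨_, hroot, ?_⟩
    ext a
    simp only [Finset.mem_erase, Finset.mem_Icc]
    omega
  · rw [contr, Finset.forall_mem_image]
    intro S hS
    rw [Finset.forall_mem_image]
    intro T hT
    rcases hlam S hS T hT with h | h | h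
    · exact Or.inl (Finset.erase_subset_erase _ h)
    · exact Or.inr (Or.inl (Finset.erase_subset_erase _ h))
    · exact Or.inr (Or.inr (Finset.disjoint_of_subset_left (Finset.erase_subset _ _)
        (Finset.disjoint_of_subset_right (Finset.erase_subset _ _) h)))

theorem B_two (k : ℕ) : Finset.Icc k (k + 2 - 1) = {k, k + 1} := by
  ext a
  simp only [Finset.mem_Icc, Finset.mem_insert, Finset.mem_singleton]
  omega

theorem pair_ne_left (k : ℕ) : ({k} : Finset ℕ) ≠ {k, k + 1} := by
  intro h
  have : k + 1 ∈ ({k} : Finset ℕ) := by rw [h]; simp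
  simp at this

theorem pair_ne_right (k : ℕ) : ({k + 1} : Finset ℕ) ≠ {k, k + 1} := by
  intro h
  have : k ∈ ({k + 1} : Finset ℕ) := by rw [h]; simp
  simp at this

theorem R_mid (k : ℕ) : Tmid.image (relabR k) = {{k, k + 1}} := by
  simp [Tmid, relabR, Finset.image_insert]

theorem R_succ (k : ℕ) : Tsucc.image (relabR k) = {{k, k + 1}, {k}} := by
  simp [Tsucc, relabR, Finset.image_insert]

theorem R_dot (k : ℕ) : Tdot.image (relabR k) = {{k, k + 1}, {k}, {k + 1}} := by
  simp [Tdot, relabR, Finset.image_insert]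

theorem gen_succ : FFSymClosure GenFF3Sym 2 (PhiT 2 Tsucc) :=
  FFSymClosure.gen (Or.inr ⟨rfl, Or.inl Phi_succ⟩)

theorem gen_mid : FFSymClosure GenFF3Sym 2 (PhiT 2 Tmid) :=
  FFSymClosure.gen (Or.inr ⟨rfl, Or.inr (Or.inl Phi_mid)⟩)

theorem gen_dot : FFSymClosure GenFF3Sym 2 (PhiT 2 Tdot) :=
  FFSymClosure.gen (Or.inr ⟨rfl, Or.inr (Or.inr Phi_dot)⟩)

theorem step {k : ℕ} (hk : 1 ≤ k)
    (IH : ∀ fam, IsRWTree k fam → FFSymClosure GenFF3Sym k (PhiT k fam))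
    {T T₁ T₂ : Finset (Finset ℕ)} (h₁ : IsRWTree k T₁) (h₂ : IsRWTree 2 T₂)
    (hg : FFSymClosure GenFF3Sym 2 (PhiT 2 T₂)) (he : rwCompose 2 k T₁ T₂ = T) :
    FFSymClosure GenFF3Sym (k + 1) (PhiT (k + 1) T) := by
  have := FFSymClosure.comp (IH T₁ h₁) hg hk le_rfl
  rw [← comp_PhiT h₁ h₂ hk le_rfl, he] at this
  exact this

theorem normal_case {k : ℕ} (hk : 1 ≤ k)
    (IH : ∀ fam, IsRWTree k fam → FFSymClosure GenFF3Sym k (PhiT k fam))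
    {T : Finset (Finset ℕ)} (h : IsRWTree (k + 1) T)
    (hsat : ∀ S ∈ T, S ≠ {k} → S ≠ {k + 1} → (k ∈ S ↔ k + 1 ∈ S))
    (hord : {k + 1} ∈ T → {k} ∈ T) :
    FFSymClosure GenFF3Sym (k + 1) (PhiT (k + 1) T) := by
  have hroot1 : Finset.Icc 1 (k + 1) ≠ {k} := by
    intro h
    have : k + 1 ∈ ({k} : Finset ℕ) := h ▸ Finset.mem_Icc.2 (by omega)
    simp at this
  have hroot2 : Finset.Icc 1 (k + 1) ≠ {k + 1} := by
    intro h
    have : k ∈ ({k + 1} : Finset ℕ) := h ▸ Finset.mem_Icc.2 (by omega)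
    simp at this
  by_cases hka : {k} ∈ T
  · by_cases hkb : {k + 1} ∈ T
    · by_cases hkab : {k, k + 1} ∈ T
      · by_cases hk1 : k = 1
        · subst hk1
          have : T = Tdot := by
            refine Finset.Subset.antisymm (fun S hS => ?_) ?_
            · obtain ⟨h1, h2⟩ := h.1 S hS
              have h2' : S ∈ ({1, 2} : Finset ℕ).powerset := by
                rw [Finset.mem_powerset, ← Icc12]
                exact h2
              have h3 : ({1, 2} : Finset ℕ).powerset = insert ∅ Tdot := by decide
              rw [h3, Finset.mem_insert] at h2'
              exact h2'.resolve_left h1.ne_empty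
            · intro S hS
              simp only [Tdot, Finset.mem_insert, Finset.mem_singleton] at hS
              rcases hS with rfl | rfl | rfl <;> assumption
          rw [this]
          exact gen_dot
        · -- case D
          set D := T \ {{k, k + 1}, {k}, {k + 1}} with hD
          have memD : ∀ S, S ∈ D ↔ S ∈ T ∧ S ≠ {k, k + 1} ∧ S ≠ {k} ∧ S ≠ {k + 1} := by
            intro S; simp [hD]
          have hDs : ∀ S ∈ D, S.Nonempty ∧ S ⊆ Finset.Icc 1 (k + 1) ∧ (k ∈ S ↔ k + 1 ∈ S) := by
            intro S hS
            rw [memD] at hS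
            exact ⟨(h.1 S hS.1).1, (h.1 S hS.1).2, hsat S hS.1 hS.2.2.1 hS.2.2.2⟩
          have hrD : Finset.Icc 1 (k + 1) ∈ D := by
            refine (memD _).2 ⟨h.2.1, ?_, hroot1, hroot2⟩
            intro h
            have : 1 ∈ ({k, k + 1} : Finset ℕ) := h ▸ Finset.mem_Icc.2 (by omega)
            simp only [Finset.mem_insert, Finset.mem_singleton] at this
            omega
          have hT₁ := contr_tree hDs hrD fun S hS T hT =>
            h.2.2 S ((memD S).1 hS).1 T ((memD T).1 hT).1
          have himg := contr_image fun S hS => (hDs S hS).2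
          have hx : {k} ∉ contr k D := by
            rw [← B_mem one_le_two, himg, B_two, memD]
            tauto
          refine step hk IH hT₁ dot_tree gen_dot ?_
          rw [rwCompose, Icc12, if_pos red_dot, if_neg, if_neg hx, himg, R_dot]
          · rw [hD, Finset.sdiff_union_of_subset]
            intro S hS
            simp only [Finset.mem_insert, Finset.mem_singleton] at hS
            rcases hS with rfl | rfl | rfl <;> assumption
          · intro h
            apply hx
            rw [h]
            simp
      · -- case C
        set D := T \ {{k}, {k + 1}} with hD
        have memD : ∀ S, S ∈ D ↔ S ∈ T ∧ S ≠ {k} ∧ S ≠ {k + 1} := by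
          intro S; simp [hD]
        have hDs : ∀ S ∈ D, S.Nonempty ∧ S ⊆ Finset.Icc 1 (k + 1) ∧ (k ∈ S ↔ k + 1 ∈ S) := by
          intro S hS
          rw [memD] at hS
          exact ⟨(h.1 S hS.1).1, (h.1 S hS.1).2, hsat S hS.1 hS.2.1 hS.2.2⟩
        have hrD : Finset.Icc 1 (k + 1) ∈ D := (memD _).2 ⟨h.2.1, hroot1, hroot2⟩
        have hBD : {k, k + 1} ∉ D := fun h => hkab ((memD _).1 h).1
        have hT₀ := contr_tree hDs hrD fun S hS T hT =>
          h.2.2 S ((memD S).1 hS).1 T ((memD T).1 hT).1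
        have himg := contr_image fun S hS => (hDs S hS).2
        have hsing : ∀ S : Finset ℕ, S ⊆ {k} ∨ {k} ⊆ S ∨ Disjoint S {k} := by
          intro S
          by_cases hkS : k ∈ S
          · exact Or.inr (Or.inl (by simpa using hkS))
          · exact Or.inr (Or.inr (by simpa using hkS))
        have hT₁ : IsRWTree k (insert {k} (contr k D)) := by
          refine ⟨?_, Finset.mem_insert_of_mem hT₀.2.1, ?_⟩
          · intro S hS
            rcases Finset.mem_insert.1 hS with rfl | hS
            · refine ⟨by simp, ?_⟩
              simp [hk]
            · exact hT₀.1 S hS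
          · intro S hS U hU
            rcases Finset.mem_insert.1 hS with rfl | hS
            · rcases hsing U with h1 | h1 | h1
              · exact Or.inr (Or.inl h1)
              · exact Or.inl h1
              · exact Or.inr (Or.inr h1.symm)
            · rcases Finset.mem_insert.1 hU with rfl | hU
              · exact hsing S
              · exact hT₀.2.2 S hS U hU
        refine step hk IH hT₁ dot_tree gen_dot ?_
        rw [rwCompose, Icc12, if_pos red_dot, if_neg, if_pos (by simp), R_dot,
          Finset.image_insert, himg, B_two, relabL_single, B_two]
        · ext S
          simp only [Finset.mem_union, Finset.mem_sdiff, Finset.mem_insert, Finset.mem_singleton,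
            memD]
          constructor
          · rintro (⟨h1 | h1, h2⟩ | ⟨h1 | h1 | h1, h2⟩)
            · exact absurd h1 h2
            · exact h1.1
            · exact absurd h1 h2
            · exact h1 ▸ hka
            · exact h1 ▸ hkb
          · intro hS
            have h1 : S ≠ {k, k + 1} := fun h => hkab (h ▸ hS)
            tauto
        · intro h1
          rw [h1] at hT₁
          obtain ⟨hk1, _⟩ := single_arity hT₁
          subst hk1
          apply hkab
          have := h.2.1
          rwa [Icc12] at this
    · -- case B
      set D := T \ {{k}} with hD
      have memD : ∀ S, S ∈ D ↔ S ∈ T ∧ S ≠ {k} := by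
        intro S; simp [hD]
      have hDs : ∀ S ∈ D, S.Nonempty ∧ S ⊆ Finset.Icc 1 (k + 1) ∧ (k ∈ S ↔ k + 1 ∈ S) := by
        intro S hS
        rw [memD] at hS
        exact ⟨(h.1 S hS.1).1, (h.1 S hS.1).2,
          hsat S hS.1 hS.2 fun h => hkb (h ▸ hS.1)⟩
      have hrD : Finset.Icc 1 (k + 1) ∈ D := (memD _).2 ⟨h.2.1, hroot1⟩
      have hT₁ := contr_tree hDs hrD fun S hS T hT =>
        h.2.2 S ((memD S).1 hS).1 T ((memD T).1 hT).1
      have himg := contr_image fun S hS => (hDs S hS).2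
      refine step hk IH hT₁ succ_tree gen_succ ?_
      rw [rwCompose, Icc12, if_neg not_red_succ, himg, R_succ, B_two]
      ext S
      simp only [Finset.mem_union, Finset.mem_sdiff, Finset.mem_insert, Finset.mem_singleton, memD]
      have h1 := pair_ne_left k
      constructor
      · rintro (⟨h1, h2⟩ | ⟨h1 | h1, h2⟩)
        · exact h1
        · exact absurd h1 h2
        · exact h1 ▸ hka
      · intro hS
        by_cases hSk : S = {k}
        · exact Or.inr ⟨Or.inr hSk, hSk ▸ h1⟩
        · exact Or.inl ⟨hS, hSk⟩
  · -- case A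
    have hkb : {k + 1} ∉ T := fun h => hka (hord h)
    have hDs : ∀ S ∈ T, S.Nonempty ∧ S ⊆ Finset.Icc 1 (k + 1) ∧ (k ∈ S ↔ k + 1 ∈ S) := by
      intro S hS
      exact ⟨(h.1 S hS).1, (h.1 S hS).2,
        hsat S hS (fun h => hka (h ▸ hS)) fun h => hkb (h ▸ hS)⟩
    have hT₁ := contr_tree hDs h.2.1 h.2.2
    have himg := contr_image fun S hS => (hDs S hS).2
    refine step hk IH hT₁ mid_tree gen_mid ?_
    rw [rwCompose, Icc12, if_neg not_red_mid, himg, R_mid, B_two]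
    simp

theorem image_closure (n : ℕ) : ∀ fam, IsRWTree n fam → FFSymClosure GenFF3Sym n (PhiT n fam) := by
  induction n with
  | zero =>
    intro fam h
    exact absurd (tree_pos h) (by omega)
  | succ k IH =>
    intro fam h
    rcases Nat.eq_zero_or_pos k with rfl | hk
    · have : fam = unitT := by
        refine Finset.Subset.antisymm (fun V hV => ?_) ?_
        · have := h.1 V hV
          rw [Finset.Icc_self, Finset.Nonempty.subset_singleton_iff this.1] at this
          simpa [unitT] using this.2
        · have := h.2.1
          rw [Finset.Icc_self] at this
          simpa [unitT] using this
      rw [this]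
      exact FFSymClosure.gen (Or.inl ⟨rfl, Phi_unit⟩)
    · obtain ⟨a, ha, b, hb, hab, hsat, hord⟩ := exists_pair (by omega) h
      obtain ⟨σ, hσ, hσa, hσb⟩ := exists_perm hk ha hb hab
      have hσ' : ∀ j ∉ Finset.Icc 1 (k + 1), σ.symm j = j := by
        intro j hj
        rw [Equiv.symm_apply_eq, hσ j hj]
      have hinj : Function.Injective fun S : Finset ℕ => S.image fun j => σ j :=
        Finset.image_injective σ.injective
      have e1 : ∀ c, ({σ c} : Finset ℕ) = ({c} : Finset ℕ).image fun j => σ j := by simp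
      have hm : ∀ c, {σ c} ∈ fam.image (fun S => S.image fun j => σ j) ↔ {c} ∈ fam := by
        intro c
        rw [e1]
        exact hinj.mem_finset_image
      have hc : ∀ c (S : Finset ℕ), σ c ∈ S.image (fun j => σ j) ↔ c ∈ S := fun c S =>
        σ.injective.mem_finset_image
      have key := normal_case hk IH (perm_tree σ hσ h) (by
          rw [Finset.forall_mem_image]
          intro S hS h1 h2
          rw [← hσb] at h2 ⊢
          rw [← hσa] at h1 ⊢
          rw [hc, hc]
          rw [e1] at h1 h2
          exact hsat S hS (fun h => h1 (by rw [h])) (fun h => h2 (by rw [h]))) (by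
          rw [← hσb, ← hσa, hm, hm]
          exact hord)
      have key2 := FFSymClosure.perm σ.symm hσ' key
      rw [← perm_PhiT _ _ hσ', Finset.image_image] at key2
      have : (fun S : Finset ℕ => S.image fun j => σ.symm j) ∘ (fun S => S.image fun j => σ j)
          = id := by
        funext S
        simp [Finset.image_image, Function.comp_def]
      rw [this, Finset.image_id] at key2
      exact key2

end RW

/-- `Φ` is an isomorphism of symmetric operads onto its image:
it commutes with relabelling, it commutes with the compositions on all labelled red and
white trees, and its image is the symmetric sub-operad of formal fractions generated by
`1/([1][12])`, `1/[12]` and `1/([1][2])`. -/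
theorem phiT_symmetric_isomorphism :
    (∀ (n : ℕ) (fam : Finset (Finset ℕ)) (σ : Equiv.Perm ℕ),
        IsRWTree n fam → (∀ j ∉ Finset.Icc 1 n, σ j = j) →
        PhiT n (fam.image fun S => S.image fun j => σ j)
          = Finsupp.mapDomain (fun S => S.image fun j => σ j) (PhiT n fam)) ∧
    (∀ (m n x : ℕ) (fam₁ fam₂ : Finset (Finset ℕ)),
        IsRWTree m fam₁ → IsRWTree n fam₂ → 1 ≤ x → x ≤ m →
        PhiT (m + n - 1) (rwCompose n x fam₁ fam₂)
          = ffCompose n x (PhiT m fam₁) (PhiT n fam₂)) ∧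
    (∀ n : ℕ, 1 ≤ n →
        PhiT n '' {fam : Finset (Finset ℕ) | IsRWTree n fam}
          = {F : FFrac | FFSymClosure GenFF3Sym n F}) := by
  refine ⟨fun n fam σ _ hσ => RW.perm_PhiT fam σ hσ,
    fun m n x fam₁ fam₂ h₁ h₂ hx hxm => RW.comp_PhiT h₁ h₂ hx hxm, fun n _ => ?_⟩
  ext F
  constructor
  · rintro ⟨fam, h, rfl⟩
    exact RW.image_closure n fam h
  · intro h
    exact RW.closure_image h
end
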